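/- There exists a function assigning to every calligraph H a triple [H] = (a_H, b_H, c_H) ∈ ℤ³, with [L] = (1,1,0), [R] = (1,0,1), and [C] = (6,4,4), such that for every finite simple graph G satisfying the Laman conditions, every calligraphic split (G₁, G₂) of G, and every generic edge-length assignment λ : E(G) → ℝ_{>0}, the set of congruence classes of spherical realizations of G inducing λ is finite and has cardinality 2(a_{G₁}·a_{G₂} − b_{G₁}·b_{G₂} − c_{G₁}·c_{G₂}); that is, the main theorem remains valid if the S²-class of the basic calligraph C is chosen to be (6,4,4) instead of (2,0,0). -/

import Mathlib

/-- A finite simple graph: vertices are a finite set of naturals, edges are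
two-element subsets of the vertex set. -/
structure GeoGraph where
  V : Finset ℕ
  E : Finset (Finset ℕ)
  edge_sub : ∀ e ∈ E, e ⊆ V
  edge_two : ∀ e ∈ E, e.card = 2

def IsSubgraph (G' G : GeoGraph) : Prop :=
  G'.V ⊆ G.V ∧ G'.E ⊆ G.E

/-- The Laman conditions: `|E| = 2|V| - 3` and every subgraph with at least two
vertices satisfies `|E'| ≤ 2|V'| - 3`. -/
def Laman (G : GeoGraph) : Prop :=
  2 ≤ G.V.card ∧ G.E.card = 2 * G.V.card - 3 ∧
    ∀ G' : GeoGraph, IsSubgraph G' G → 2 ≤ G'.V.card → G'.E.card ≤ 2 * G'.V.card - 3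

/-- A generic edge-length assignment: positive real edge lengths that are
algebraically independent over ℚ. -/
def Generic (G : GeoGraph) (lam : Finset ℕ → ℝ) : Prop :=
  (∀ e ∈ G.E, 0 < lam e) ∧
    AlgebraicIndependent ℚ (fun e : G.E => lam e.1)

/-- A spherical realization: every vertex goes to the complex sphere. -/
def SphereRealization (G : GeoGraph) (ρ : ℕ → Fin 3 → ℂ) : Prop :=
  ∀ v ∈ G.V, ∑ i, ρ v i ^ 2 = 1

/-- A realization induces the edge lengths `lam`. -/
def SphereInduces (G : GeoGraph) (ρ : ℕ → Fin 3 → ℂ) (lam : Finset ℕ → ℝ) : Prop :=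
  ∀ u v : ℕ, ({u, v} : Finset ℕ) ∈ G.E →
    ∑ i, (ρ u i - ρ v i) ^ 2 = (lam {u, v} : ℂ)

/-- Congruence of spherical realizations via `SO₃(ℂ)`. -/
def SphereCongruent (G : GeoGraph) (ρ ρ' : ℕ → Fin 3 → ℂ) : Prop :=
  ∃ A : Matrix (Fin 3) (Fin 3) ℂ, A * A.transpose = 1 ∧ A.det = 1 ∧
    ∀ v ∈ G.V, ρ' v = A.mulVec (ρ v)

/-- Congruence classes of spherical realizations of `G` inducing `lam`. -/
def SphereClasses (G : GeoGraph) (lam : Finset ℕ → ℝ) : Type :=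
  Quot fun ρ ρ' : {ρ : ℕ → Fin 3 → ℂ // SphereRealization G ρ ∧ SphereInduces G ρ lam} =>
    SphereCongruent G ρ.1 ρ'.1

def PlaneInduces (G : GeoGraph) (ρ : ℕ → Fin 2 → ℂ) (lam : Finset ℕ → ℝ) : Prop :=
  ∀ u v : ℕ, ({u, v} : Finset ℕ) ∈ G.E →
    ∑ i, (ρ u i - ρ v i) ^ 2 = (lam {u, v} : ℂ)

/-- Congruence of plane realizations via `SO₂(ℂ)` and a translation. -/
def PlaneCongruent (G : GeoGraph) (ρ ρ' : ℕ → Fin 2 → ℂ) : Prop :=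
  ∃ A : Matrix (Fin 2) (Fin 2) ℂ, ∃ b : Fin 2 → ℂ, A * A.transpose = 1 ∧ A.det = 1 ∧
    ∀ v ∈ G.V, ρ' v = A.mulVec (ρ v) + b

/-- Congruence classes of plane realizations of `G` inducing `lam`. -/
def PlaneClasses (G : GeoGraph) (lam : Finset ℕ → ℝ) : Type :=
  Quot fun ρ ρ' : {ρ : ℕ → Fin 2 → ℂ // PlaneInduces G ρ lam} =>
    PlaneCongruent G ρ.1 ρ'.1

/-- A calligraph: `{0,1,2} ⊆ V`, `{1,2} ∈ E`, `|E| = 2|V| - 4`, and adding the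
edge `{0,1}` or the edge `{0,2}` yields a graph satisfying the Laman conditions. -/
def Calligraph (H : GeoGraph) : Prop :=
  ({0, 1, 2} : Finset ℕ) ⊆ H.V ∧ ({1, 2} : Finset ℕ) ∈ H.E ∧
    H.E.card = 2 * H.V.card - 4 ∧
    ((∃ H' : GeoGraph, H'.V = H.V ∧ H'.E = insert {0, 1} H.E ∧ Laman H') ∨
     (∃ H' : GeoGraph, H'.V = H.V ∧ H'.E = insert {0, 2} H.E ∧ Laman H'))

/-- A split of `G` into two subgraphs sharing exactly the vertices `0,1,2` and
the edge `{1,2}`. -/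
def IsSplit (G G₁ G₂ : GeoGraph) : Prop :=
  G.V = G₁.V ∪ G₂.V ∧ G.E = G₁.E ∪ G₂.E ∧
    G₁.V ∩ G₂.V = ({0, 1, 2} : Finset ℕ) ∧
    G₁.E ∩ G₂.E = ({{1, 2}} : Finset (Finset ℕ))

/-- A calligraphic split: a split into two calligraphs. -/
def CalligraphicSplit (G G₁ G₂ : GeoGraph) : Prop :=
  IsSplit G G₁ G₂ ∧ Calligraph G₁ ∧ Calligraph G₂

set_option linter.unusedSectionVars false

open Polynomial in
theorem valuation_eq_one_of_isAlgebraic {L F Γ : Type*} [Field L] [Field F] [Algebra L F]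
    [LinearOrderedCommGroupWithZero Γ] {v : Valuation F Γ}
    (h : ∀ x : L, x ≠ 0 → v (algebraMap L F x) = 1) {y : F} (hy : y ≠ 0)
    (hal : IsAlgebraic L y) : v y = 1 := by
  have key : ∀ z : F, IsAlgebraic L z → v z ≤ 1 := by
    intro z hz
    by_contra! hlt
    obtain ⟨p, hp, he⟩ := hz.isIntegral
    rw [← aeval_def, hp.as_sum] at he
    simp only [map_add, map_pow, aeval_X, map_sum, map_mul, aeval_C] at he
    have h1 : z ^ p.natDegree = -∑ i ∈ Finset.range p.natDegree,
        algebraMap L F (p.coeff i) * z ^ i := eq_neg_of_add_eq_zero_left he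
    have h2 : v (z ^ p.natDegree) < v z ^ p.natDegree := by
      conv_lhs => rw [h1, Valuation.map_neg]
      refine Valuation.map_sum_lt _ (by simp; intro h0; simp [h0] at hlt) fun i hi => ?_
      rw [map_mul, map_pow]
      have hc : v (algebraMap L F (p.coeff i)) ≤ 1 := by
        by_cases h0 : p.coeff i = 0
        · simp [h0]
        · exact (h _ h0).le
      calc _ ≤ 1 * v z ^ i := by gcongr
        _ < _ := by rw [one_mul]; exact pow_lt_pow_right₀ hlt (Finset.mem_range.1 hi)
    rw [map_pow] at h2
    exact lt_irrefl _ h2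
  refine le_antisymm (key y hal) ?_
  have := key _ hal.inv
  rw [map_inv₀] at this
  exact (inv_le_one₀ (by simpa [zero_lt_iff] using hy)).1 this

/-- `f` is Gauss independent over `κ` for `v`: nonzero polynomials in `f` have valuation `1`. -/
def GaussIndep (κ : Type*) {F Γ η : Type*} [Field κ] [Field F] [Algebra κ F]
    [LinearOrderedCommGroupWithZero Γ] (v : Valuation F Γ) (f : η → F) : Prop :=
  ∀ P : MvPolynomial η κ, P ≠ 0 → v (MvPolynomial.aeval f P) = 1

namespace GaussIndep

variable {κ F Γ η ι : Type*} [Field κ] [Field F] [Algebra κ F]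
  [LinearOrderedCommGroupWithZero Γ] {v : Valuation F Γ} {f g : η → F}

theorem algebraicIndependent (h : GaussIndep κ v f) : AlgebraicIndependent κ f := by
  rw [algebraicIndependent_iff]
  intro P hP
  by_contra h0
  have := h P h0
  simp [hP] at this

theorem trivial (h : GaussIndep κ v f) {c : κ} (hc : c ≠ 0) : v (algebraMap κ F c) = 1 := by
  simpa using h (MvPolynomial.C c) (by simpa using hc)

theorem le_one (h : GaussIndep κ v f) (P : MvPolynomial η κ) :
    v (MvPolynomial.aeval f P) ≤ 1 := by
  by_cases h0 : P = 0
  · simp [h0]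
  · exact (h P h0).le

theorem congr (h : GaussIndep κ v f) (hfg : ∀ i, v (f i - g i) < 1) : GaussIndep κ v g := by
  have hc : ∀ c : κ, v (algebraMap κ F c) ≤ 1 := fun c => by
    simpa using h.le_one (MvPolynomial.C c)
  have hg : ∀ i, v (g i) ≤ 1 := fun i => by
    have h1 : v (f i) ≤ 1 := by simpa using h.le_one (MvPolynomial.X i)
    have : g i = f i - (f i - g i) := by ring
    rw [this]
    exact (v.map_sub _ _).trans (max_le h1 (hfg i).le)
  have key : ∀ P : MvPolynomial η κ,
      v (MvPolynomial.aeval f P - MvPolynomial.aeval g P) < 1 ∧ v (MvPolynomial.aeval g P) ≤ 1 := by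
    intro P
    induction P using MvPolynomial.induction_on with
    | C a => simpa using hc a
    | add p q hp hq =>
      constructor
      · rw [map_add, map_add, add_sub_add_comm]
        exact (v.map_add _ _).trans_lt (max_lt hp.1 hq.1)
      · rw [map_add]
        exact (v.map_add _ _).trans (max_le hp.2 hq.2)
    | mul_X p i hp =>
      simp only [map_mul, MvPolynomial.aeval_X]
      constructor
      · have : MvPolynomial.aeval f p * f i - MvPolynomial.aeval g p * g i
          = (MvPolynomial.aeval f p - MvPolynomial.aeval g p) * f i
            + MvPolynomial.aeval g p * (f i - g i) := by ring
        rw [this]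
        refine (v.map_add _ _).trans_lt (max_lt ?_ ?_)
        · rw [map_mul]
          exact mul_lt_one_of_lt_of_le hp.1 (by simpa using h.le_one (MvPolynomial.X i))
        · rw [map_mul, mul_comm]
          exact mul_lt_one_of_lt_of_le (hfg i) hp.2
      · exact mul_le_one' hp.2 (hg i)
  intro P hP
  have h1 := h P hP
  have h2 := (key P).1
  rw [← h1] at h2 ⊢
  exact (v.map_eq_of_sub_lt (by rwa [v.map_sub_swap]))

theorem eq_one_of_mem_adjoin (h : GaussIndep κ v f) {y : F} (hy : y ≠ 0)
    (hm : y ∈ IntermediateField.adjoin κ (Set.range f)) : v y = 1 := by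
  obtain ⟨r, s, rfl⟩ := (IntermediateField.mem_adjoin_range_iff _ _ _).1 hm
  have hr : r ≠ 0 := by rintro rfl; simp at hy
  have hs : s ≠ 0 := by rintro rfl; simp at hy
  rw [map_div₀, h r hr, h s hs, div_one]

theorem eq_one_of_isAlgebraic (h : GaussIndep κ v f) {y : F} (hy : y ≠ 0)
    (hm : IsAlgebraic (IntermediateField.adjoin κ (Set.range f)) y) : v y = 1 :=
  valuation_eq_one_of_isAlgebraic
    (fun x hx => h.eq_one_of_mem_adjoin (by simpa using hx) x.2) hy hm

theorem of_algebraicIndependent (h : AlgebraicIndependent κ f)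
    (hv : ∀ y ∈ Algebra.adjoin κ (Set.range f), y ≠ 0 → v y = 1) : GaussIndep κ v f := by
  intro P hP
  refine hv _ ?_ ?_
  · rw [Algebra.adjoin_range_eq_range_aeval]; exact ⟨P, rfl⟩
  · rwa [Ne, map_eq_zero_iff _ h]

end GaussIndep

/-- If an algebraically independent finite family lies in the field generated by a family of the
same size, then the latter is algebraically independent and algebraic over the former. -/
theorem AlgebraicIndependent.exchange {κ F η ι : Type*} [Field κ] [Field F] [Algebra κ F]
    [Finite η] [Finite ι] (hc : Nat.card η = Nat.card ι) {f : η → F} {x : ι → F}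
    (hf : AlgebraicIndependent κ f)
    (hfx : ∀ i, f i ∈ IntermediateField.adjoin κ (Set.range x)) :
    AlgebraicIndependent κ x ∧ ∀ y ∈ IntermediateField.adjoin κ (Set.range x),
      IsAlgebraic (IntermediateField.adjoin κ (Set.range f)) y := by
  set M := IntermediateField.adjoin κ (Set.range x) with hM
  let f' : η → M := fun i => ⟨f i, hfx i⟩
  let x' : ι → M := fun i => ⟨x i, IntermediateField.subset_adjoin _ _ ⟨i, rfl⟩⟩
  have hf' : AlgebraicIndependent κ f' := AlgebraicIndependent.of_comp M.val (x := f') hf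
  have htop : IntermediateField.adjoin κ (Set.range x') = ⊤ := by
    apply IntermediateField.map_injective M.val
    rw [IntermediateField.adjoin_map, ← AlgHom.fieldRange_eq_map, IntermediateField.fieldRange_val,
      ← Set.range_comp]
    rfl
  have : Algebra.IsAlgebraic (Algebra.adjoin κ (Set.range x')) M := by
    refine ⟨fun y => ?_⟩
    have hy : y ∈ IntermediateField.adjoin κ (Set.range x') := by rw [htop]; trivial
    obtain ⟨r, hr, s, hs, rfl⟩ := (IntermediateField.mem_adjoin_iff_div).1 hy
    rw [div_eq_mul_inv]
    exact (isAlgebraic_algebraMap (⟨r, hr⟩ : Algebra.adjoin κ (Set.range x'))).mul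
      (isAlgebraic_algebraMap (⟨s, hs⟩ : Algebra.adjoin κ (Set.range x'))).inv
  have hcard : (Nat.card η : Cardinal) ≤ Algebra.trdeg κ M := by
    have := hf'.lift_cardinalMk_le_trdeg
    rw [← Nat.cast_card (α := η), Cardinal.lift_natCast, Cardinal.nat_le_lift_iff] at this
    exact this
  have hx' : IsTranscendenceBasis κ x' := by
    refine Algebra.IsAlgebraic.isTranscendenceBasis_of_lift_le_trdeg_of_finite κ x' ?_
    rw [← Nat.cast_card (α := ι), Cardinal.lift_natCast, ← hc, Cardinal.nat_le_lift_iff]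
    exact hcard
  have hfb : IsTranscendenceBasis κ f' := by
    refine hf'.isTranscendenceBasis_of_lift_trdeg_le_of_finite ?_
    have := hx'.lift_cardinalMk_eq_trdeg
    rw [← Nat.cast_card (α := ι), Cardinal.lift_natCast, ← hc, Cardinal.nat_eq_lift_iff] at this
    rw [← this, ← Nat.cast_card (α := η), Cardinal.lift_natCast, Cardinal.lift_natCast]
  refine ⟨hx'.1.map' (f := M.val) M.val.injective, fun y hy => ?_⟩
  have halg := hfb.isAlgebraic_field.isAlgebraic (⟨y, hy⟩ : M)
  obtain ⟨p, hp, he⟩ := halg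
  have hle : IntermediateField.adjoin κ (Set.range f') ≤
      (IntermediateField.adjoin κ (Set.range f)).comap M.val := by
    rw [IntermediateField.adjoin_le_iff]
    rintro _ ⟨i, rfl⟩
    exact IntermediateField.subset_adjoin _ _ ⟨i, rfl⟩
  let φ : IntermediateField.adjoin κ (Set.range f') →+* IntermediateField.adjoin κ (Set.range f) :=
    { toFun := fun z => ⟨M.val z, hle z.2⟩
      map_one' := rfl
      map_mul' := fun _ _ => rfl
      map_zero' := rfl
      map_add' := fun _ _ => rfl }
  refine ⟨p.map φ, (Polynomial.map_ne_zero_iff φ.injective).2 hp, ?_⟩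
  rw [Polynomial.aeval_def, Polynomial.eval₂_map]
  have := congrArg (M.val : M →+* F) he
  rw [Polynomial.aeval_def, Polynomial.hom_eval₂, map_zero] at this
  exact this

theorem GaussIndep.exchange {κ F Γ η ι : Type*} [Field κ] [Field F] [Algebra κ F]
    [LinearOrderedCommGroupWithZero Γ] {v : Valuation F Γ}
    [Finite η] [Finite ι] (hc : Nat.card η = Nat.card ι) {f : η → F} {x : ι → F}
    (hf : GaussIndep κ v f)
    (hfx : ∀ i, f i ∈ IntermediateField.adjoin κ (Set.range x)) : GaussIndep κ v x := by
  obtain ⟨h1, h2⟩ := hf.algebraicIndependent.exchange hc hfx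
  refine .of_algebraicIndependent h1 fun y hy h0 => hf.eq_one_of_isAlgebraic h0 (h2 y ?_)
  exact IntermediateField.algebra_adjoin_le_adjoin _ _ hy

/-- `v` is trivial on the coefficient field `κ`. -/
def TrivialOn (κ : Type*) {F Γ : Type*} [Field κ] [Field F] [Algebra κ F]
    [LinearOrderedCommGroupWithZero Γ] (v : Valuation F Γ) : Prop :=
  ∀ c : κ, c ≠ 0 → v (algebraMap κ F c) = 1

section Residue

variable {κ F Γ : Type*} [Field κ] [Field F] [Algebra κ F]
  [LinearOrderedCommGroupWithZero Γ] {v : Valuation F Γ}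

theorem TrivialOn.le_one (h : TrivialOn κ v) (c : κ) : v (algebraMap κ F c) ≤ 1 := by
  by_cases h0 : c = 0
  · simp [h0]
  · exact (h c h0).le

theorem TrivialOn.sub_eq_one (h : TrivialOn κ v) {c d : κ} (hcd : c ≠ d) :
    v (algebraMap κ F c - algebraMap κ F d) = 1 := by
  rw [← map_sub]; exact h _ (sub_ne_zero.2 hcd)

theorem TrivialOn.tower {κ' : Type*} [Field κ'] [Algebra κ' F] [Algebra κ' κ]
    [IsScalarTower κ' κ F] (h : TrivialOn κ v) : TrivialOn κ' v := fun c hc => by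
  rw [IsScalarTower.algebraMap_apply κ' κ F]
  exact h _ (by simpa using hc)

open Polynomial in
theorem exists_valuationSubring_lt_one {y : F} (hy : Transcendental κ y) :
    ∃ A : ValuationSubring F, TrivialOn κ A.valuation ∧ A.valuation y < 1 := by
  let B : Subring F := (Algebra.adjoin κ {y}).toSubring
  let y' : B := ⟨y, Algebra.subset_adjoin rfl⟩
  have hI : Ideal.span {y'} ≠ ⊤ := by
    intro htop
    obtain ⟨z, hz⟩ := Ideal.mem_span_singleton'.1 ((Ideal.eq_top_iff_one _).1 htop)
    have hz' : (z : F) * y = 1 := congrArg Subtype.val hz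
    have hzm : (z : F) ∈ Algebra.adjoin κ {y} := z.2
    rw [Algebra.adjoin_singleton_eq_range_aeval] at hzm
    obtain ⟨p, hp⟩ := hzm
    refine hy ⟨p * X - 1, fun h0 => ?_, ?_⟩
    · have := congrArg (eval 0) h0
      simp at this
    · have hp' : aeval y p = (z : F) := hp
      simp [hp', hz']
  obtain ⟨A, hA, hAI⟩ := Ideal.image_subset_nonunits_valuationSubring _ hI
  have hκ : ∀ c : κ, A.valuation (algebraMap κ F c) ≤ 1 := fun c =>
    (A.valuation_le_one_iff _).2 (hA (Subalgebra.algebraMap_mem (Algebra.adjoin κ {y}) c))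
  refine ⟨A, fun c hc => le_antisymm (hκ c) ?_, ?_⟩
  · have := hκ c⁻¹
    rw [map_inv₀, map_inv₀] at this
    exact (inv_le_one₀ (by simpa [zero_lt_iff] using hc)).1 this
  · rw [← A.mem_nonunits_iff]
    exact hAI ⟨y', Ideal.subset_span rfl, rfl⟩

open Polynomial in
theorem eval_eq_one_of_residually_transcendental [IsAlgClosed κ] (ht : TrivialOn κ v) {y : F}
    (h : ∀ c : κ, v (y - algebraMap κ F c) = 1) {p : κ[X]} (hp : p ≠ 0) :
    v (aeval y p) = 1 := by
  rw [(IsAlgClosed.splits p).eq_prod_roots]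
  have : ∀ s : Multiset κ, v (aeval y (s.map fun a => X - C a).prod) = 1 := by
    intro s
    induction s using Multiset.induction_on with
    | empty => simp
    | cons a s ih => simp [ih, h a]
  rw [map_mul, map_mul, this, aeval_C, ht _ (by simpa using hp), one_mul]

theorem transcendental_of_residually_transcendental [IsAlgClosed κ] (ht : TrivialOn κ v) {y : F}
    (h : ∀ c : κ, v (y - algebraMap κ F c) = 1) : Transcendental κ y := by
  rintro ⟨p, hp, h0⟩
  have := eval_eq_one_of_residually_transcendental ht h hp
  simp [h0] at this

theorem eq_one_of_residually_transcendental [IsAlgClosed κ] (ht : TrivialOn κ v) {y z : F}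
    (h : ∀ c : κ, v (y - algebraMap κ F c) = 1) (hz : z ≠ 0)
    (hal : IsAlgebraic (Algebra.adjoin κ {y}) z) : v z = 1 := by
  rw [← IntermediateField.isAlgebraic_adjoin_iff] at hal
  refine valuation_eq_one_of_isAlgebraic (fun x hx => ?_) hz hal
  obtain ⟨r, s, hrs⟩ := (IntermediateField.mem_adjoin_simple_iff κ _).1 x.2
  have hx' : (x : F) ≠ 0 := by simpa using hx
  change v (x : F) = 1
  rw [hrs] at hx' ⊢
  have hr : r ≠ 0 := by rintro rfl; simp at hx'
  have hs : s ≠ 0 := by rintro rfl; simp at hx'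
  rw [map_div₀, eval_eq_one_of_residually_transcendental ht h hr,
    eval_eq_one_of_residually_transcendental ht h hs, div_one]

/-- If `v` is trivial on the algebraically closed `κ` but not on the algebraic closure of `κ(u)`,
then every integral element algebraic over `κ(u)` has a residue in `κ`. -/
theorem exists_residue [IsAlgClosed κ] (ht : TrivialOn κ v) {u y z : F}
    (hu : Transcendental κ u) (hz : z ≠ 0) (hz1 : v z ≠ 1)
    (hzu : IsAlgebraic (Algebra.adjoin κ {u}) z)
    (hyu : IsAlgebraic (Algebra.adjoin κ {u}) y) (hy : v y ≤ 1) :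
    ∃ c : κ, v (y - algebraMap κ F c) < 1 := by
  by_contra! hcon
  have h : ∀ c : κ, v (y - algebraMap κ F c) = 1 := fun c =>
    le_antisymm ((v.map_sub _ _).trans (max_le hy (ht.le_one c))) (hcon c)
  have hty := transcendental_of_residually_transcendental ht h
  have huy : IsAlgebraic (Algebra.adjoin κ {y}) u := IsAlgebraic.adjoin_singleton hu hty hyu
  refine hz1 (eq_one_of_residually_transcendental ht h hz ?_)
  refine IsAlgebraic.adjoin_of_forall_isAlgebraic (s := {u}) (t := {y}) ?_ hzu
  rintro _ ⟨rfl, -⟩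
  exact huy

end Residue

section Near

variable {F Γ : Type*} [Field F] [LinearOrderedCommGroupWithZero Γ]

/-- `x` and `y` differ by a principal unit of `v`. -/
def Near (v : Valuation F Γ) (x y : F) : Prop := ∃ w, v (w - 1) < 1 ∧ x = w * y

variable {v : Valuation F Γ} {x y z t : F}

theorem valuation_eq_one_of_sub_one_lt {w : F} (h : v (w - 1) < 1) : v w = 1 := by
  have := v.map_eq_of_sub_lt (x := 1) (y := w) (by simpa using h)
  simpa using this

theorem Near.refl (v : Valuation F Γ) (x : F) : Near v x x := ⟨1, by simp, by simp⟩

theorem Near.symm (h : Near v x y) : Near v y x := by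
  obtain ⟨w, hw, rfl⟩ := h
  have h1 := valuation_eq_one_of_sub_one_lt hw
  have h0 : w ≠ 0 := by rintro rfl; simp at h1
  refine ⟨w⁻¹, ?_, by field_simp⟩
  have : w⁻¹ - 1 = -(w - 1) * w⁻¹ := by field_simp; ring
  rw [this, map_mul, Valuation.map_neg, map_inv₀, h1]
  simpa using hw

theorem Near.mul (h : Near v x y) (h' : Near v z t) : Near v (x * z) (y * t) := by
  obtain ⟨w, hw, rfl⟩ := h
  obtain ⟨w', hw', rfl⟩ := h'
  refine ⟨w * w', ?_, by ring⟩
  have : w * w' - 1 = (w - 1) * w' + (w' - 1) := by ring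
  rw [this]
  refine (v.map_add _ _).trans_lt (max_lt ?_ hw')
  rwa [map_mul, valuation_eq_one_of_sub_one_lt hw', mul_one]

theorem Near.inv (h : Near v x y) : Near v x⁻¹ y⁻¹ := by
  obtain ⟨w, hw, rfl⟩ := h.symm
  have h1 := valuation_eq_one_of_sub_one_lt hw
  have h0 : w ≠ 0 := by rintro rfl; simp at h1
  exact ⟨w, hw, by rw [mul_inv, mul_inv_cancel_left₀ h0]⟩

theorem Near.div (h : Near v x y) (h' : Near v z t) : Near v (x / z) (y / t) := by
  simpa only [div_eq_mul_inv] using h.mul h'.inv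

theorem Near.of_sub_lt (h : v (x - y) < v y) : Near v x y := by
  have h0 : y ≠ 0 := by rintro rfl; simp at h
  refine ⟨x / y, ?_, by field_simp⟩
  have : x / y - 1 = (x - y) / y := by field_simp
  rw [this, map_div₀]
  exact (div_lt_one₀ (by simpa [zero_lt_iff] using h0)).2 h

theorem Near.sub_lt (h : Near v x y) (hy : v y = 1) : v (x - y) < 1 := by
  obtain ⟨w, hw, rfl⟩ := h
  have : w * y - y = (w - 1) * y := by ring
  rwa [this, map_mul, hy, mul_one]

end Near

open Polynomial in
/-- A Lipschitz estimate: if `y` is algebraic over `A`, two specializations that agree up to `ε` on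
`A` and are close at `y` agree up to `ε` at `y`, provided one of them is separable there. -/
theorem valuation_sub_le_of_isAlgebraic {κ B K Γ : Type*} [Field κ] [CommRing B] [IsDomain B]
    [Algebra κ B] [CharZero B] [Field K] [LinearOrderedCommGroupWithZero Γ] (v : Valuation K Γ)
    (A : Subalgebra κ B) {y : B} (hy : IsAlgebraic A y) (φ ψ : B →+* K)
    (hψ : ∀ b : B, b ≠ 0 → v (ψ b) = 1) {ε : Γ} (hA : ∀ a ∈ A, v (φ a - ψ a) ≤ ε)
    (hφ : v (φ y - ψ y) < 1) : v (φ y - ψ y) ≤ ε := by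
  classical
  obtain ⟨p, ⟨hp0, hp⟩, hmin⟩ : ∃ p : A[X], (p ≠ 0 ∧ aeval y p = 0) ∧
      ∀ q : A[X], q ≠ 0 → aeval y q = 0 → p.natDegree ≤ q.natDegree := by
    obtain ⟨p, hp⟩ := hy
    let S : Set ℕ := {n | ∃ p : A[X], p.natDegree = n ∧ p ≠ 0 ∧ aeval y p = 0}
    have hS : S.Nonempty := ⟨_, p, rfl, hp⟩
    obtain ⟨q, hq1, hq⟩ := Nat.sInf_mem hS
    exact ⟨q, hq, fun r hr0 hr => hq1 ▸ Nat.sInf_le ⟨r, rfl, hr0, hr⟩⟩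
  have hder : aeval y (derivative p) ≠ 0 := by
    intro h0
    have hdeg : p.natDegree ≠ 0 := by
      intro hd
      rw [natDegree_eq_zero] at hd
      obtain ⟨c, rfl⟩ := hd
      rw [aeval_C] at hp
      exact hp0 (by rw [show c = 0 from Subtype.ext hp, C_0])
    have hd0 : derivative p ≠ 0 := fun h => hdeg (derivative_eq_zero.1 h)
    have := hmin _ hd0 h0
    exact absurd (natDegree_derivative_lt hdeg) (by omega)
  let φA : A →+* K := φ.comp (algebraMap A B)
  let ψA : A →+* K := ψ.comp (algebraMap A B)
  have hφp : (p.map φA).eval (φ y) = 0 := by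
    rw [eval_map, ← hom_eval₂, ← aeval_def, hp, map_zero]
  have hψp : (p.map ψA).eval (ψ y) = 0 := by
    rw [eval_map, ← hom_eval₂, ← aeval_def, hp, map_zero]
  have hψd : v ((derivative (p.map ψA)).eval (ψ y)) = 1 := by
    rw [derivative_map, eval_map, ← hom_eval₂, ← aeval_def]
    exact hψ _ hder
  have hle : ∀ b : B, v (ψ b) ≤ 1 := fun b => by
    by_cases h0 : b = 0
    · simp [h0]
    · exact (hψ b h0).le
  have hyle : v (φ y) ≤ 1 := by
    have : φ y = (φ y - ψ y) + ψ y := by ring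
    rw [this]
    exact (v.map_add _ _).trans (max_le hφ.le (hle y))
  have hcoef : v ((p.map φA).eval (φ y) - (p.map ψA).eval (φ y)) ≤ ε := by
    rw [← eval_sub, eval_eq_sum_range]
    refine v.map_sum_le fun i _ => ?_
    rw [map_mul, map_pow, coeff_sub, coeff_map, coeff_map]
    calc _ ≤ ε * 1 := mul_le_mul' (hA _ (p.coeff i).2) (pow_le_one' hyle i)
      _ = ε := mul_one _
  have hk : ∀ q : B[X], ∀ z ∈ v.integer, (q.map ψ).eval z ∈ v.integer := by
    intro q z hz
    rw [eval_map, eval₂_eq_sum_range]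
    exact sum_mem fun i _ => mul_mem (hle _) (pow_mem hz i)
  obtain ⟨r, hr⟩ : ∃ r ∈ v.integer, (p.map ψA).eval (φ y) = (p.map ψA).eval (ψ y) +
      (derivative (p.map ψA)).eval (ψ y) * (φ y - ψ y) + r * (φ y - ψ y) ^ 2 := by
    have hmem : ∀ i, (p.map ψA).coeff i ∈ v.integer := fun i => by
      rw [coeff_map]; exact hle _
    obtain ⟨P, hP⟩ : ∃ P : v.integer[X], P.map v.integer.subtype = p.map ψA := by
      have := (mem_lifts (p.map ψA) (f := v.integer.subtype)).1
        ((lifts_iff_coeff_lifts _).2 fun i => ⟨⟨_, hmem i⟩, rfl⟩)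
      exact this
    let a : v.integer := ⟨ψ y, hle y⟩
    let d : v.integer := ⟨φ y - ψ y, hφ.le⟩
    obtain ⟨k, hk⟩ := P.binomExpansion a d
    refine ⟨k, k.2, ?_⟩
    have h2 := congrArg v.integer.subtype hk
    simp only [map_add, map_mul, map_pow, ← eval₂_hom, ← eval_map, ← derivative_map, hP] at h2
    have h3 : v.integer.subtype a + v.integer.subtype d = φ y := by
      change ψ y + (φ y - ψ y) = φ y; ring
    rw [h3] at h2
    exact h2
  obtain ⟨hr1, hr2⟩ := hr
  rw [hφp, hr2, hψp] at hcoef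
  set d := φ y - ψ y
  by_cases hd0 : d = 0
  · rw [hd0, map_zero]; exact zero_le
  have h1 : v ((derivative (p.map ψA)).eval (ψ y) * d) = v d := by rw [map_mul, hψd, one_mul]
  have h2 : v (r * d ^ 2) < v ((derivative (p.map ψA)).eval (ψ y) * d) := by
    rw [h1, map_mul, map_pow, sq, ← mul_assoc]
    calc v r * v d * v d < 1 * v d :=
        mul_lt_mul_of_pos_right ((mul_le_of_le_one_left' hr1).trans_lt hφ)
          (by simpa [zero_lt_iff] using hd0)
      _ = v d := one_mul _
  have h3 := v.map_add_eq_of_lt_right h2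
  rw [zero_sub, Valuation.map_neg, zero_add, add_comm, h3, h1] at hcoef
  exact hcoef

section cluster

variable {κ F Γ : Type*} [Field κ] [Field F] [Algebra κ F]
  [LinearOrderedCommGroupWithZero Γ] {v : Valuation F Γ}

/-- If two points are closer to each other than to the remaining two, the cross ratio
degenerates. -/
theorem valuation_mul_lt_of_close {x y w t : F} (h1 : v (x - y) < v (w - x))
    (h2 : v (x - y) < v (t - x)) :
    v ((x - y) * (w - t)) < v ((x - w) * (y - t)) := by
  have e1 : v (x - w) = v (w - x) := v.map_sub_swap _ _
  have e2 : v (y - t) = v (t - x) := by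
    have : y - t = (y - x) + (x - t) := by ring
    rw [this, v.map_sub_swap t x]
    refine v.map_add_eq_of_lt_right ?_
    rwa [v.map_sub_swap y x, v.map_sub_swap x t]
  have e3 : v (w - t) ≤ max (v (w - x)) (v (t - x)) := by
    have : w - t = (w - x) - (t - x) := by ring
    rw [this]; exact v.map_sub _ _
  have p1 : (0 : Γ) < v (w - x) := lt_of_le_of_lt zero_le h1
  have p2 : (0 : Γ) < v (t - x) := lt_of_le_of_lt zero_le h2
  rw [map_mul, map_mul, e1, e2]
  rcases le_max_iff.1 e3 with h | h
  · calc v (x - y) * v (w - t) ≤ v (x - y) * v (w - x) := by gcongr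
      _ = v (w - x) * v (x - y) := mul_comm _ _
      _ < v (w - x) * v (t - x) := (mul_lt_mul_iff_right₀ p1).2 h2
  · calc v (x - y) * v (w - t) ≤ v (x - y) * v (t - x) := by gcongr
      _ < v (w - x) * v (t - x) := (mul_lt_mul_iff_left₀ p2).2 h1

variable {Λ η : Type*} [Finite Λ] [Finite η]

open Classical in
/-- Rescaling a cluster of points in a system of cross ratio equations with generic values. -/
theorem GaussIndep.cluster {g : η → F} (hg : GaussIndep κ v g) (z : Λ → F) (free J : Set Λ)
    (j0 j1 : Λ) (δ : F) (a b c d : η → Λ)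
    (hconst : ∀ l ∉ free, z l ∈ Set.range (algebraMap κ F))
    (h0 : j0 ∈ J) (hδ : δ ≠ 0)
    (hj1 : j1 ∈ J → (z j1 - z j0) / δ ∈ Set.range (algebraMap κ F))
    (hj1' : j1 ∈ J) (hj01 : j1 ≠ j0)
    (hJ : ∀ j ∈ J, ∀ j' ∈ J, ∀ i ∉ J, v (z j - z j') < v (z i - z j))
    (hJc : ∀ l ∈ J, l ∉ free → z l = z j0)
    (hab : ∀ e, z (a e) ≠ z (b e)) (hcd : ∀ e, z (c e) ≠ z (d e))
    (he : ∀ e, g e * ((z (a e) - z (b e)) * (z (c e) - z (d e))) =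
      (z (a e) - z (c e)) * (z (b e) - z (d e)))
    (hcard : Nat.card η = Nat.card {l // l ∈ free ∧ l ≠ j1}) :
    GaussIndep κ v (fun l : {l // l ∈ free ∧ l ≠ j1} =>
      if l.1 ∈ J ∧ l.1 ≠ j0 then (z l - z j0) / δ else z l) := by
  set x : {l // l ∈ free ∧ l ≠ j1} → F := fun l =>
      if l.1 ∈ J ∧ l.1 ≠ j0 then (z l - z j0) / δ else z l with hx
  set M := IntermediateField.adjoin κ (Set.range x)
  let z' : Λ → F := fun l => if l ∈ J then z j0 else z l
  let y : Λ → F := fun l => (z l - z j0) / δ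
  have hκ : ∀ t ∈ Set.range (algebraMap κ F), t ∈ M := by
    rintro _ ⟨t, rfl⟩; exact M.algebraMap_mem t
  have hxM : ∀ l, x l ∈ M := fun l => IntermediateField.subset_adjoin _ _ ⟨l, rfl⟩
  have hz0 : z j0 ∈ M := by
    by_cases hf : j0 ∈ free
    · simpa [hx] using hxM ⟨j0, hf, hj01.symm⟩
    · exact hκ _ (hconst _ hf)
  have hz' : ∀ l, z' l ∈ M := by
    intro l
    by_cases hl : l ∈ J
    · simpa [z', hl] using hz0
    · simp only [z', hl, if_false]
      by_cases hf : l ∈ free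
      · simpa [hx, hl] using hxM ⟨l, hf, fun h => hl (h ▸ hj1')⟩
      · exact hκ _ (hconst _ hf)
  have hy : ∀ l ∈ J, y l ∈ M := by
    intro l hl
    by_cases hl0 : l = j0
    · simp [y, hl0]
    by_cases hl1 : l = j1
    · exact hl1 ▸ hκ _ (hj1 hj1')
    by_cases hf : l ∈ free
    · simpa [hx, hl, hl0, y] using hxM ⟨l, hf, hl1⟩
    · simp [y, hJc l hl hf]
  let D : Λ → Λ → F := fun l m => if l ∈ J ∧ m ∈ J then y l - y m else z' l - z' m
  let S : Λ → Λ → F := fun l m => if l ∈ J ∧ m ∈ J then δ else 1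
  have hD : ∀ l m, D l m ∈ M := by
    intro l m
    by_cases h : l ∈ J ∧ m ∈ J
    · simpa [D, h] using M.sub_mem (hy l h.1) (hy m h.2)
    · simpa [D, h] using M.sub_mem (hz' l) (hz' m)
  have hnear : ∀ l m, Near v (z l - z m) (S l m * D l m) := by
    intro l m
    by_cases hl : l ∈ J <;> by_cases hm : m ∈ J
    · have : z l - z m = S l m * D l m := by
        simp only [S, D, hl, hm, and_self, if_true, y]; field_simp; ring
      rw [this]; exact Near.refl _ _
    · simp only [S, D, hl, hm, and_false, if_false, z', if_true, one_mul]
      refine Near.of_sub_lt ?_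
      rw [sub_sub_sub_cancel_right, v.map_sub_swap (z j0) (z m), v.map_sub_swap (z l)]
      exact hJ _ h0 _ hl _ hm
    · simp only [S, D, hl, hm, false_and, if_false, z', if_true, one_mul]
      refine Near.of_sub_lt ?_
      rw [sub_sub_sub_cancel_left]
      exact hJ _ h0 _ hm _ hl
    · simp only [S, D, hl, hm, and_self, if_false, z', one_mul]
      exact Near.refl _ _
  have hg1 : ∀ e, v (g e) = 1 := fun e => by
    simpa using hg (MvPolynomial.X e) (MvPolynomial.X_ne_zero e)
  let f : η → F := fun e =>
    D (a e) (c e) * D (b e) (d e) / (D (a e) (b e) * D (c e) (d e))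
  have hfM : ∀ e, f e ∈ M := fun e =>
    M.div_mem (M.mul_mem (hD _ _) (hD _ _)) (M.mul_mem (hD _ _) (hD _ _))
  have hfg : ∀ e, v (g e - f e) < 1 := by
    intro e
    have hne : (z (a e) - z (b e)) * (z (c e) - z (d e)) ≠ 0 :=
      mul_ne_zero (sub_ne_zero.2 (hab e)) (sub_ne_zero.2 (hcd e))
    have heq : g e = (z (a e) - z (c e)) * (z (b e) - z (d e)) /
        ((z (a e) - z (b e)) * (z (c e) - z (d e))) := by
      rw [eq_div_iff hne, he]
    have hv1 : v ((z (a e) - z (b e)) * (z (c e) - z (d e))) =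
        v ((z (a e) - z (c e)) * (z (b e) - z (d e))) := by
      rw [← he e, map_mul v (g e), hg1, one_mul]
    have hS : S (a e) (c e) * S (b e) (d e) = S (a e) (b e) * S (c e) (d e) := by
      have key : ∀ p q r s : Λ, p ∈ J → q ∈ J → r ∉ J → s ∉ J →
          v ((z p - z q) * (z r - z s)) < v ((z p - z r) * (z q - z s)) :=
        fun p q r s hp hq hr hs =>
          valuation_mul_lt_of_close (hJ p hp q hq r hr) (hJ p hp q hq s hs)
      generalize a e = a, b e = b, c e = c, d e = d at *
      by_cases ha : a ∈ J <;> by_cases hb : b ∈ J <;> by_cases hc : c ∈ J <;>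
        by_cases hd : d ∈ J <;> simp only [S, ha, hb, hc, hd, and_self, and_true,
          and_false, if_true, if_false, mul_one, one_mul]
      · exact absurd hv1 (key a b c d ha hb hc hd).ne
      · have := key a c b d ha hc hb hd
        exact absurd hv1.symm this.ne
      · have := key b d a c hb hd ha hc
        have h1 : v ((z b - z d) * (z a - z c)) = v ((z a - z c) * (z b - z d)) := by
          rw [mul_comm]
        have h2 : v ((z b - z a) * (z d - z c)) = v ((z a - z b) * (z c - z d)) := by
          rw [map_mul, map_mul, v.map_sub_swap (z b), v.map_sub_swap (z d)]
        rw [h1, h2] at this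
        exact absurd hv1.symm this.ne
      · have := key c d a b hc hd ha hb
        have h1 : v ((z c - z d) * (z a - z b)) = v ((z a - z b) * (z c - z d)) := by
          rw [mul_comm]
        have h2 : v ((z c - z a) * (z d - z b)) = v ((z a - z c) * (z b - z d)) := by
          rw [map_mul, map_mul, v.map_sub_swap (z c), v.map_sub_swap (z d)]
        rw [h1, h2] at this
        exact absurd hv1 this.ne
    have hSne : S (a e) (b e) * S (c e) (d e) ≠ 0 := by
      refine mul_ne_zero ?_ ?_ <;> simp only [S] <;> split_ifs <;> simp [hδ]
    have hN : Near v (g e) (f e) := by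
      rw [heq]
      have := ((hnear (a e) (c e)).mul (hnear (b e) (d e))).div
        ((hnear (a e) (b e)).mul (hnear (c e) (d e)))
      convert this using 1
      rw [mul_mul_mul_comm, mul_mul_mul_comm (S (a e) (b e)), hS, mul_div_mul_left _ _ hSne]
    have h1 := hN.symm.sub_lt (hg1 e)
    rwa [v.map_sub_swap] at h1
  exact (hg.congr hfg).exchange hcard hfM

end cluster

section quadric

/-- The form `Z² + X² + Y²` in the coordinates `((X - iY)/2, Z, -(X + iY)/2)`. -/
def bil {R : Type*} [CommRing R] (p q : Fin 3 → R) : R := p 1 * q 1 - 2 * p 0 * q 2 - 2 * p 2 * q 0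

theorem map_bil {R S G : Type*} [CommRing R] [CommRing S] [FunLike G R S] [RingHomClass G R S]
    (φ : G) (p q : Fin 3 → R) : φ (bil p q) = bil (fun i => φ (p i)) fun i => φ (q i) := by
  simp [bil, show φ 2 = 2 from map_ofNat φ 2]

theorem bil_comm {R : Type*} [CommRing R] (p q : Fin 3 → R) : bil p q = bil q p := by
  unfold bil; ring

variable {F : Type*} [Field F]

/-- The normalized position of vertex `1`. -/
def basePoint : Fin 3 → F := ![0, 1, 0]

/-- The normalized position of vertex `2`. -/
def secondPoint (k : F) : Fin 3 → F := ![(k + 1) / 2, k, (k - 1) / 2]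

theorem bil_basePoint (p : Fin 3 → F) : bil p basePoint = p 1 := by
  simp [bil, basePoint]

theorem bil_secondPoint [CharZero F] (p : Fin 3 → F) (k : F) :
    bil p (secondPoint k) = k * p 1 - (k - 1) * p 0 - (k + 1) * p 2 := by
  simp [bil, secondPoint]; ring

/-- Realizations in the quadric with vertices `1` and `2` in normalized position, where the
edges `e` have prescribed inner products `μ e`. -/
structure IsSol (H : GeoGraph) (μ : Finset ℕ → F) (ρ : ℕ → Fin 3 → F) : Prop where
  off : ∀ w ∉ H.V, ρ w = 0
  one : ρ 1 = basePoint
  two : ρ 2 = secondPoint (μ {1, 2})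
  sph : ∀ w ∈ H.V, bil (ρ w) (ρ w) = 1
  edge : ∀ u w : ℕ, ({u, w} : Finset ℕ) ∈ H.E → bil (ρ u) (ρ w) = μ {u, w}

/-- The count and incidence part of the definition of a calligraph. -/
structure PreCalligraph (H : GeoGraph) : Prop where
  sub : ({0, 1, 2} : Finset ℕ) ⊆ H.V
  mem : ({1, 2} : Finset ℕ) ∈ H.E
  card : H.E.card = 2 * H.V.card - 4

theorem Calligraph.pre {H : GeoGraph} (h : Calligraph H) : PreCalligraph H :=
  ⟨h.1, h.2.1, h.2.2.1⟩

namespace PreCalligraph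

variable {H : GeoGraph}

theorem zero_mem (h : PreCalligraph H) : 0 ∈ H.V := h.sub (by simp)

theorem one_mem (h : PreCalligraph H) : 1 ∈ H.V := h.sub (by simp)

theorem two_mem (h : PreCalligraph H) : 2 ∈ H.V := h.sub (by simp)

end PreCalligraph

/-- Projective chart coordinates on the quadric. -/
def chartD (a : F) (p : Fin 3 → F) : F := p 2 - a * p 1 + a ^ 2 * p 0

def chartX (a : F) (p : Fin 3 → F) : F := (p 1 - 2 * a * p 0 - 1) / (2 * chartD a p)

def chartY (a : F) (p : Fin 3 → F) : F := (p 1 - 2 * a * p 0 + 1) / (2 * chartD a p)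

theorem chartX_sub_chartY [CharZero F] {a : F} {p : Fin 3 → F} (hD : chartD a p ≠ 0) :
    chartX a p - chartY a p = -1 / chartD a p := by
  unfold chartX chartY; field_simp; ring

theorem chart_zero [CharZero F] {a : F} {p : Fin 3 → F} (hD : chartD a p ≠ 0)
    (hp : bil p p = 1) : p 0 = chartD a p * (chartX a p * chartY a p) := by
  have h : p 0 * (4 * chartD a p) = (p 1 - 2 * a * p 0 - 1) * (p 1 - 2 * a * p 0 + 1) := by
    unfold chartD bil at *; linear_combination -hp
  unfold chartX chartY; field_simp; linear_combination h

theorem chart_one [CharZero F] {a : F} {p : Fin 3 → F} (hD : chartD a p ≠ 0)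
    (hp : bil p p = 1) : p 1 = chartD a p *
      (2 * a * (chartX a p * chartY a p) + chartX a p + chartY a p) := by
  have h := chart_zero hD hp
  have h2 : chartD a p * (chartX a p + chartY a p) = p 1 - 2 * a * p 0 := by
    unfold chartX chartY; field_simp; ring
  linear_combination -h2 + 2 * a * h

theorem chart_two [CharZero F] {a : F} {p : Fin 3 → F} (hD : chartD a p ≠ 0)
    (hp : bil p p = 1) : p 2 = chartD a p *
      ((a * chartX a p + 1) * (a * chartY a p + 1)) := by
  have h := chart_zero hD hp
  have h' := chart_one hD hp
  have h2 : chartD a p = p 2 - a * p 1 + a ^ 2 * p 0 := rfl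
  linear_combination a * h' - a ^ 2 * h - h2

/-- Inner products as cross ratios of chart coordinates. -/
theorem chart_edge [CharZero F] {a : F} {p q : Fin 3 → F} (hD : chartD a p ≠ 0)
    (hp : bil p p = 1) (hD' : chartD a q ≠ 0) (hq : bil q q = 1) :
    (1 - bil p q) / 2 * ((chartX a p - chartY a p) * (chartX a q - chartY a q)) =
      (chartX a p - chartX a q) * (chartY a p - chartY a q) := by
  have e1 := chartX_sub_chartY hD
  have e2 := chartX_sub_chartY hD'
  have e3 : (chartX a p - chartY a p) * chartD a p = -1 := by rw [e1]; field_simp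
  have e4 : (chartX a q - chartY a q) * chartD a q = -1 := by rw [e2]; field_simp
  unfold bil
  rw [chart_zero hD hp, chart_one hD hp, chart_two hD hp, chart_zero hD' hq, chart_one hD' hq,
    chart_two hD' hq]
  generalize chartX a p = x, chartY a p = y, chartX a q = x', chartY a q = y',
    chartD a p = d, chartD a q = d' at *
  linear_combination (-((x + y) * (x' + y') - 2 * x * y - 2 * x' * y') / 2 * ((x' - y') * d')) * e3
      +
    ((x + y) * (x' + y') - 2 * x * y - 2 * x' * y') / 2 * e4

end quadric

section place

variable {κ F Γ : Type*} [Field κ] [Field F] [Algebra κ F]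
  [LinearOrderedCommGroupWithZero Γ] {v : Valuation F Γ}

theorem GaussIndep.aeval_eq_one {η : Type*} {f : η → F} (h : GaussIndep κ v f) (i : η)
    {P : Polynomial κ} (hP : P ≠ 0) : v (Polynomial.aeval (f i) P) = 1 := by
  have := h (P.toMvPolynomial i)
    (by rwa [Ne, map_eq_zero_iff _ (Polynomial.toMvPolynomial_injective i)])
  rwa [MvPolynomial.aeval_toMvPolynomial] at this

/-- For all but finitely many charts, the denominator dominates the coordinates of a point. -/
theorem finite_setOf_chartD_lt [CharZero κ] (hv : TrivialOn κ v) (p : Fin 3 → F) :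
    {a : ℕ | ∃ i, v (chartD (a : F) p) < v (p i)}.Finite := by
  by_contra hinf
  obtain ⟨i, -, hi⟩ := Finset.exists_max_image Finset.univ (fun i => v (p i)) ⟨0, by simp⟩
  have hM : ∀ j, v (p j) ≤ v (p i) := fun j => hi j (by simp)
  obtain ⟨t, hts, htc⟩ := (show Set.Infinite _ from hinf).exists_subset_card_eq 3
  obtain ⟨a, b, c, hab, hac, hbc, rfl⟩ := Finset.card_eq_three.1 htc
  have hlt : ∀ x ∈ ({a, b, c} : Finset ℕ), v (chartD (x : F) p) < v (p i) := by
    intro x hx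
    obtain ⟨j, hj⟩ := hts hx
    exact hj.trans_le (hM j)
  have ha := hlt a (by simp)
  have hb := hlt b (by simp)
  have hc := hlt c (by simp)
  have hnat : ∀ x : ℕ, v (x : F) ≤ 1 := fun x => by simpa using hv.le_one (x : κ)
  have hsub : ∀ x y : ℕ, x ≠ y → v ((x : F) - y) = 1 := fun x y hxy => by
    simpa using hv.sub_eq_one (c := (x : κ)) (d := (y : κ)) (by exact_mod_cast hxy)
  have hlow : ∀ x y : ℕ, x ≠ y → v (chartD (x : F) p) < v (p i) → v (chartD (y : F) p) < v (p i) →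
      v (((x : F) + y) * p 0 - p 1) < v (p i) := by
    intro x y hxy h1 h2
    have : v (((x : F) - y) * (((x : F) + y) * p 0 - p 1)) < v (p i) := by
      have e : ((x : F) - y) * (((x : F) + y) * p 0 - p 1) = chartD (x : F) p - chartD (y : F) p :=
          by
        unfold chartD; ring
      rw [e]; exact v.map_sub_lt h1 h2
    rwa [map_mul, hsub x y hxy, one_mul] at this
  have h1 := hlow a b hab ha hb
  have h2 := hlow a c hac ha hc
  have h0 : v (p 0) < v (p i) := by
    have e : ((b : F) - c) * p 0 = (((a : F) + b) * p 0 - p 1) - (((a : F) + c) * p 0 - p 1) := by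
      ring
    have := v.map_sub_lt h1 h2
    rwa [← e, map_mul, hsub b c hbc, one_mul] at this
  have hmul : ∀ x y : F, v x ≤ 1 → v y < v (p i) → v (x * y) < v (p i) := by
    intro x y hx hy
    rw [map_mul]
    exact (mul_le_of_le_one_left' hx).trans_lt hy
  have h1' : v (p 1) < v (p i) := by
    have e : p 1 = ((a : F) + b) * p 0 - (((a : F) + b) * p 0 - p 1) := by ring
    rw [e]
    exact v.map_sub_lt (hmul _ _ (by exact_mod_cast hnat (a + b)) h0) h1
  have h2' : v (p 2) < v (p i) := by
    have e : p 2 = chartD (a : F) p + ((a : F) * p 1 - (a : F) ^ 2 * p 0) := by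
      unfold chartD; ring
    rw [e]
    refine v.map_add_lt ha (v.map_sub_lt (hmul _ _ (hnat a) h1') (hmul _ _ ?_ h0))
    exact_mod_cast hnat (a ^ 2)
  fin_cases i
  · exact h0.false
  · exact h1'.false
  · exact h2'.false

theorem exists_chart [CharZero κ] (hv : TrivialOn κ v) (V : Finset ℕ) (ρ : ℕ → Fin 3 → F) :
    ∃ a : ℕ, ∀ w ∈ V, ∀ i, v (ρ w i) ≤ v (chartD (a : F) (ρ w)) := by
  have : (⋃ w ∈ V, {a : ℕ | ∃ i, v (chartD (a : F) (ρ w)) < v (ρ w i)}).Finite :=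
    V.finite_toSet.biUnion fun w _ => finite_setOf_chartD_lt hv (ρ w)
  obtain ⟨a, ha⟩ := this.exists_notMem
  refine ⟨a, fun w hw i => ?_⟩
  by_contra! h
  exact ha (Set.mem_biUnion hw ⟨i, h⟩)

/-- A point of the quadric has a coordinate that is not infinitesimal. -/
theorem one_le_chartD [CharZero κ] (hv : TrivialOn κ v) {a : F} {p : Fin 3 → F}
    (hp : bil p p = 1) (h : ∀ i, v (p i) ≤ v (chartD a p)) : 1 ≤ v (chartD a p) := by
  by_contra! hlt
  have h1 : ∀ i, v (p i) < 1 := fun i => (h i).trans_lt hlt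
  have : v (bil p p) < 1 := by
    have h4 : v (4 : F) ≤ 1 := by simpa only [map_ofNat] using hv.le_one (4 : κ)
    have hm : ∀ i j, v (p i * p j) < 1 := fun i j => by
      rw [map_mul]
      exact (mul_le_of_le_one_left' (h1 i).le).trans_lt (h1 j)
    have e : bil p p = p 1 * p 1 - 4 * (p 0 * p 2) := by unfold bil; ring
    rw [e]
    refine v.map_sub_lt (hm 1 1) ?_
    rw [map_mul]
    exact (mul_le_of_le_one_left' h4).trans_lt (hm 0 2)
  rw [hp, map_one] at this
  exact this.false

/-- The edges other than `{1, 2}`. -/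
abbrev FreeEdge (H : GeoGraph) : Type := {e // e ∈ H.E ∧ e ≠ ({1, 2} : Finset ℕ)}

instance (H : GeoGraph) : Finite (FreeEdge H) :=
  (H.E.finite_toSet.subset fun _ h => h.1).to_subtype

/-- The chart coordinates of all vertices, together with a constant. -/
def chartLabel (H : GeoGraph) (a : F) (ρ : ℕ → Fin 3 → F) (c : F) :
    Option (H.V × Bool) → F
  | none => c
  | some (w, false) => chartX a (ρ w)
  | some (w, true) => chartY a (ρ w)

def freeLabel (H : GeoGraph) : Set (Option (H.V × Bool)) :=
  {l | ∃ w b, l = some (w, b) ∧ w.1 ≠ 1 ∧ w.1 ≠ 2}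

theorem PreCalligraph.card_freeEdge {H : GeoGraph} (h : PreCalligraph H) :
    Nat.card (FreeEdge H) = 2 * H.V.card - 5 := by
  have : Nat.card (FreeEdge H) = (H.E.erase {1, 2}).card :=
    Nat.subtype_card _ fun x => by simp [and_comm]
  rw [this, Finset.card_erase_of_mem h.mem, h.card]; omega

theorem PreCalligraph.card_freeLabel {H : GeoGraph} (h : PreCalligraph H)
    {j : Option (H.V × Bool)} (hj : j ∈ freeLabel H) :
    Nat.card {l // l ∈ freeLabel H ∧ l ≠ j} = 2 * H.V.card - 5 := by
  let f : {w // w ∈ (H.V.erase 1).erase 2} × Bool → Option (H.V × Bool) := fun p =>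
    some (⟨p.1.1, Finset.mem_of_mem_erase (Finset.mem_of_mem_erase p.1.2)⟩, p.2)
  have hf : Function.Injective f := by
    rintro ⟨⟨w, hw⟩, b⟩ ⟨⟨w', hw'⟩, b'⟩ hww
    simpa [f] using hww
  have hr : freeLabel H = Set.range f := by
    ext l
    constructor
    · rintro ⟨w, b, rfl, h1, h2⟩
      exact ⟨(⟨w.1, by simp [h1, h2]⟩, b), rfl⟩
    · rintro ⟨⟨⟨w, hw⟩, b⟩, rfl⟩
      simp only [Finset.mem_erase] at hw
      exact ⟨_, _, rfl, hw.2.1, hw.1⟩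
  have h1 : (freeLabel H).ncard = 2 * (H.V.card - 2) := by
    rw [hr, ← Set.image_univ, Set.ncard_image_of_injective _ hf, Set.ncard_univ, Nat.card_prod,
      Nat.card_eq_fintype_card, Nat.card_eq_fintype_card, Fintype.card_bool, Fintype.card_coe,
      Finset.card_erase_of_mem (by simp [h.two_mem]), Finset.card_erase_of_mem h.one_mem,
      Nat.sub_sub, mul_comm]
  have h2 : Nat.card {l // l ∈ freeLabel H ∧ l ≠ j} = (freeLabel H \ {j}).ncard := rfl
  rw [h2, Set.ncard_sdiff_singleton_of_mem hj, h1]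
  omega

end place

section place

variable {κ F Γ : Type*} [Field κ] [Field F] [Algebra κ F]
  [LinearOrderedCommGroupWithZero Γ] {v : Valuation F Γ}

theorem GaussIndep.half_one_sub [CharZero F] {η : Type*} [Finite η] {f : η → F}
    (h : GaussIndep κ v f) : GaussIndep κ v (fun i => (1 - f i) / 2) := by
  refine h.exchange rfl fun i => ?_
  set M := IntermediateField.adjoin κ (Set.range fun i => (1 - f i) / 2)
  have h1 : (1 - f i) / 2 ∈ M := IntermediateField.subset_adjoin _ _ ⟨i, rfl⟩
  have : f i = 1 - ((1 - f i) / 2 + (1 - f i) / 2) := by ring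
  rw [this]
  exact M.sub_mem M.one_mem (M.add_mem h1 h1)

theorem chartX_mem_range (a k : κ) :
    (∀ w : Fin 3 → F, w = basePoint ∨ w = secondPoint (algebraMap κ F k) →
      chartX (algebraMap κ F a) w ∈ Set.range (algebraMap κ F) ∧
      chartY (algebraMap κ F a) w ∈ Set.range (algebraMap κ F)) := by
  have htwo : algebraMap κ F 2 = 2 := map_ofNat _ 2
  have key : ∀ q : Fin 3 → κ, chartX (algebraMap κ F a) (algebraMap κ F ∘ q) ∈
      Set.range (algebraMap κ F) ∧ chartY (algebraMap κ F a) (algebraMap κ F ∘ q) ∈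
      Set.range (algebraMap κ F) := fun q =>
    ⟨⟨chartX a q, by simp [chartX, chartD, htwo]⟩, ⟨chartY a q, by simp [chartY, chartD, htwo]⟩⟩
  rintro w (rfl | rfl)
  · convert key basePoint using 3 <;>
    · ext i; fin_cases i <;> simp [basePoint]
  · convert key (secondPoint k) using 3 <;>
    · ext i; fin_cases i <;> simp [secondPoint, htwo]

variable {H : GeoGraph} {μ : Finset ℕ → F} {ρ : ℕ → Fin 3 → F}

theorem IsSol.cluster [CharZero F] (hρ : IsSol H μ ρ) (hH : PreCalligraph H)
    (hg : GaussIndep κ v fun e : FreeEdge H => μ e.1) {k : κ} (hk : algebraMap κ F k = μ {1, 2})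
    (a : ℕ) (hD : ∀ w ∈ H.V, chartD (a : F) (ρ w) ≠ 0) (c : κ)
    (J : Set (Option (H.V × Bool))) (j0 j1 : Option (H.V × Bool)) (δ : F)
    (hJ0 : j0 ∈ J) (hδ : δ ≠ 0) (hJ1 : j1 ∈ J) (hj1 : j1 ∈ freeLabel H) (hj : j1 ≠ j0)
    (hr : (chartLabel H (a : F) ρ (algebraMap κ F c) j1 -
      chartLabel H (a : F) ρ (algebraMap κ F c) j0) / δ ∈ Set.range (algebraMap κ F))
    (hJ : ∀ j ∈ J, ∀ j' ∈ J, ∀ i ∉ J,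
      v (chartLabel H (a : F) ρ (algebraMap κ F c) j -
        chartLabel H (a : F) ρ (algebraMap κ F c) j') <
      v (chartLabel H (a : F) ρ (algebraMap κ F c) i -
        chartLabel H (a : F) ρ (algebraMap κ F c) j))
    (hJc : ∀ l ∈ J, l ∉ freeLabel H → chartLabel H (a : F) ρ (algebraMap κ F c) l =
      chartLabel H (a : F) ρ (algebraMap κ F c) j0)
    {l : Option (H.V × Bool)} (hl : l ∈ freeLabel H) (hl1 : l ≠ j1)
    {P : Polynomial κ} (hP : P ≠ 0) :
    (l ∈ J → l ≠ j0 → v (Polynomial.aeval ((chartLabel H (a : F) ρ (algebraMap κ F c) l -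
      chartLabel H (a : F) ρ (algebraMap κ F c) j0) / δ) P) = 1) ∧
    (l ∉ J ∨ l = j0 →
      v (Polynomial.aeval (chartLabel H (a : F) ρ (algebraMap κ F c) l) P) = 1) := by
  have hends : ∀ e : FreeEdge H, ∃ u w : H.V, e.1 = {u.1, w.1} := by
    intro e
    obtain ⟨u, w, -, huw⟩ := Finset.card_eq_two.1 (H.edge_two e.1 e.2.1)
    have := H.edge_sub e.1 e.2.1
    rw [huw] at this
    exact ⟨⟨u, this (by simp)⟩, ⟨w, this (by simp)⟩, huw⟩
  choose p q hpq using hends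
  have hXY : ∀ w : H.V, chartX (a : F) (ρ w) ≠ chartY (a : F) (ρ w) := by
    intro w h
    have := chartX_sub_chartY (hD w w.2)
    rw [h, sub_self] at this
    exact (div_ne_zero (neg_ne_zero.2 one_ne_zero) (hD w w.2)) this.symm
  have := hg.half_one_sub.cluster (chartLabel H (a : F) ρ (algebraMap κ F c)) (freeLabel H) J
    j0 j1 δ (fun e => some (p e, false)) (fun e => some (p e, true))
    (fun e => some (q e, false)) (fun e => some (q e, true)) ?_ hJ0 hδ (fun _ => hr) hJ1 hj hJ hJc
    (fun e => hXY (p e)) (fun e => hXY (q e)) ?_ ?_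
  · have := this.aeval_eq_one ⟨l, hl, hl1⟩ hP
    constructor
    · intro h1 h2
      rwa [if_pos ⟨h1, h2⟩] at this
    · intro h1
      rwa [if_neg (by tauto)] at this
  · intro l hl
    match l, hl with
    | none, _ => exact ⟨c, rfl⟩
    | some (w, b), hl =>
      have hw : ρ w = basePoint ∨ ρ w = secondPoint (algebraMap κ F k) := by
        rw [hk]
        by_cases h1 : w.1 = 1
        · exact Or.inl (h1 ▸ hρ.one)
        by_cases h2 : w.1 = 2
        · exact Or.inr (h2 ▸ hρ.two)
        · exact absurd ⟨w, b, rfl, h1, h2⟩ hl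
      have h := chartX_mem_range (F := F) (a : κ) k _ hw
      rw [map_natCast] at h
      cases b
      · exact h.1
      · exact h.2
  · intro e
    simp only [chartLabel]
    have h1 := hρ.edge (p e) (q e) (by rw [← hpq]; exact e.2.1)
    rw [← hpq] at h1
    rw [← h1]
    exact chart_edge (hD _ (p e).2) (hρ.sph _ (p e).2) (hD _ (q e).2) (hρ.sph _ (q e).2)
  · rw [hH.card_freeEdge, hH.card_freeLabel hj1]

end place

section place

variable {κ F Γ : Type*} [Field κ] [Field F] [Algebra κ F]
  [LinearOrderedCommGroupWithZero Γ] {v : Valuation F Γ}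

open Polynomial

/-- Behaviour of two inner products at a point of the quadric tending to infinity in a generic
direction. -/
theorem valuation_bil_of_generic [CharZero κ] (hv : TrivialOn κ v)
    {x y s t : F} {x₁ y₁ x₂ y₂ : κ} (h1 : x₁ ≠ y₁) (h2 : x₂ ≠ y₂) (h12 : x₁ ≠ x₂) (h12' : x₁ ≠ y₂)
    (h21' : y₁ ≠ x₂)
    (hs : s * ((x - y) * (algebraMap κ F x₁ - algebraMap κ F y₁)) =
      (x + y) * (algebraMap κ F x₁ + algebraMap κ F y₁) - 2 * x * y -
        2 * algebraMap κ F x₁ * algebraMap κ F y₁)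
    (ht : t * ((x - y) * (algebraMap κ F x₂ - algebraMap κ F y₂)) =
      (x + y) * (algebraMap κ F x₂ + algebraMap κ F y₂) - 2 * x * y -
        2 * algebraMap κ F x₂ * algebraMap κ F y₂)
    (hxy : v (x - y) < 1) (hx : ∀ P : κ[X], P ≠ 0 → v (aeval x P) = 1)
    {m n : κ} (hmn : m ≠ 0 ∨ n ≠ 0) :
    v (algebraMap κ F m * s + algebraMap κ F n * t) * v (x - y) = 1 := by
  set c := m / (x₁ - y₁)
  set d := n / (x₂ - y₂)
  have hc : c * (x₁ - y₁) = m := div_mul_cancel₀ _ (sub_ne_zero.2 h1)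
  have hd : d * (x₂ - y₂) = n := div_mul_cancel₀ _ (sub_ne_zero.2 h2)
  have hP : C (-2 : κ) * (C c * ((X - C x₁) * (X - C y₁)) + C d * ((X - C x₂) * (X - C y₂))) ≠ 0 :=
      by
    refine mul_ne_zero (by simp) fun h => ?_
    have e1 := congrArg (eval x₁) h
    have e2 := congrArg (eval x₂) h
    simp only [eval_add, eval_mul, eval_C, eval_sub, eval_X, sub_self, zero_mul, mul_zero,
      add_zero, zero_add, eval_zero, mul_eq_zero, sub_eq_zero, h12, h12', h12.symm, h21'.symm,
      or_false] at e1 e2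
    rw [← hc, ← hd, e1, e2] at hmn
    simp at hmn
  have h0 := hx _ hP
  simp only [map_mul, map_add, map_sub, aeval_C, aeval_X] at h0
  have hle : ∀ r : κ, v (algebraMap κ F r) ≤ 1 := hv.le_one
  have hxle : v x ≤ 1 := by
    simpa using (hx X X_ne_zero).le
  have hY : v ((y - x) * (algebraMap κ F c * (algebraMap κ F x₁ + algebraMap κ F y₁ - 2 * x) +
      algebraMap κ F d * (algebraMap κ F x₂ + algebraMap κ F y₂ - 2 * x))) < 1 := by
    have h2x : v (2 * x) ≤ 1 := by
      rw [map_mul]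
      exact mul_le_one' (by simpa only [map_ofNat] using hle 2) hxle
    have hq : ∀ r r' r'' : κ, v (algebraMap κ F r * (algebraMap κ F r' + algebraMap κ F r'' -
        2 * x)) ≤ 1 := fun r r' r'' => by
      rw [map_mul, ← map_add]
      exact mul_le_one' (hle r) ((v.map_sub _ _).trans (max_le (hle _) h2x))
    rw [map_mul, mul_comm, v.map_sub_swap]
    refine (mul_le_of_le_one_left' ?_).trans_lt hxy
    exact (v.map_add _ _).trans (max_le (hq _ _ _) (hq _ _ _))
  rw [← map_mul]
  have e : (algebraMap κ F m * s + algebraMap κ F n * t) * (x - y) =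
      (algebraMap κ F (-2) * (algebraMap κ F c * ((x - algebraMap κ F x₁) * (x - algebraMap κ F y₁))
        + algebraMap κ F d * ((x - algebraMap κ F x₂) * (x - algebraMap κ F y₂)))) +
      (y - x) * (algebraMap κ F c * (algebraMap κ F x₁ + algebraMap κ F y₁ - 2 * x) +
      algebraMap κ F d * (algebraMap κ F x₂ + algebraMap κ F y₂ - 2 * x)) := by
    rw [← hc, ← hd]
    simp only [map_mul, map_sub, map_neg, map_ofNat]
    linear_combination algebraMap κ F c * hs + algebraMap κ F d * ht
  rw [e, v.map_add_eq_of_lt_left]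
  · rw [← h0]; simp only [map_mul]
  · refine hY.trans_eq ?_
    rw [← h0]; simp only [map_mul]

/-- Behaviour of two inner products at a point of the quadric tending to infinity along a ruling
line through one of the two fixed points. -/
theorem valuation_bil_of_special [CharZero κ] (hv : TrivialOn κ v)
    {x y s t : F} {x₁ y₁ x₂ y₂ : κ} (h1 : x₁ ≠ y₁) (h2 : x₂ ≠ y₂) (h12 : x₁ ≠ x₂) (h12' : x₁ ≠ y₂)
    (hs : s * ((x - y) * (algebraMap κ F x₁ - algebraMap κ F y₁)) =
      (x + y) * (algebraMap κ F x₁ + algebraMap κ F y₁) - 2 * x * y -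
        2 * algebraMap κ F x₁ * algebraMap κ F y₁)
    (ht : t * ((x - y) * (algebraMap κ F x₂ - algebraMap κ F y₂)) =
      (x + y) * (algebraMap κ F x₂ + algebraMap κ F y₂) - 2 * x * y -
        2 * algebraMap κ F x₂ * algebraMap κ F y₂)
    (hxy : v (x - y) < 1) (hx : x ≠ algebraMap κ F x₁)
    (hτ : ∀ P : κ[X], P ≠ 0 →
      v (aeval ((y - algebraMap κ F x₁) / (x - algebraMap κ F x₁)) P) = 1) :
    1 < v t ∧ ∀ β : κ, v (s - algebraMap κ F β) = 1 := by
  have hδ : x - algebraMap κ F x₁ ≠ 0 := sub_ne_zero.2 hx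
  obtain ⟨δ, rfl⟩ : ∃ δ, x = algebraMap κ F x₁ + δ := ⟨x - algebraMap κ F x₁, by ring⟩
  rw [add_sub_cancel_left] at hδ hτ
  obtain ⟨τ, rfl⟩ : ∃ τ, y = algebraMap κ F x₁ + δ * τ :=
    ⟨(y - algebraMap κ F x₁) / δ, by field_simp; ring⟩
  rw [add_sub_cancel_left, mul_div_cancel_left₀ _ hδ] at hτ
  have hle : ∀ r : κ, v (algebraMap κ F r) ≤ 1 := hv.le_one
  have hτ1 : v τ = 1 := by simpa using hτ X X_ne_zero
  have hτ2 : v (1 - τ) = 1 := by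
    have := hτ (C 1 - X) (by
      intro h
      have := congrArg (eval 0) h
      simp at this)
    simpa only [map_sub, aeval_C, aeval_X, map_one] using this
  have hδ1 : v δ < 1 := by
    have : algebraMap κ F x₁ + δ - (algebraMap κ F x₁ + δ * τ) = δ * (1 - τ) := by ring
    rwa [this, map_mul, hτ2, mul_one] at hxy
  have hv2 : v (2 : F) ≤ 1 := by simpa only [map_ofNat] using hle 2
  have hsub : ∀ {a b : κ}, a ≠ b → v (algebraMap κ F a - algebraMap κ F b) = 1 :=
    fun h => hv.sub_eq_one h
  constructor
  · have e : t * δ * (1 - τ) * (algebraMap κ F x₂ - algebraMap κ F y₂) =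
        algebraMap κ F (-2 * ((x₁ - x₂) * (x₁ - y₂))) + δ * ((1 + τ) *
          (algebraMap κ F (x₂ + y₂ - 2 * x₁)) - 2 * δ * τ) := by
      simp only [map_add, map_mul, map_sub, map_neg, map_ofNat]
      linear_combination ht
    have h3 : v (t * δ * (1 - τ) * (algebraMap κ F x₂ - algebraMap κ F y₂)) = 1 := by
      have hb : v (algebraMap κ F (-2 * ((x₁ - x₂) * (x₁ - y₂)))) = 1 :=
        hv _ (by simp [sub_eq_zero, h12, h12'])
      rw [e, v.map_add_eq_of_lt_left, hb]
      rw [hb, map_mul, mul_comm]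
      refine (mul_le_of_le_one_left' ?_).trans_lt hδ1
      refine (v.map_sub _ _).trans (max_le ?_ ?_)
      · rw [map_mul]
        exact mul_le_one' ((v.map_add _ _).trans (max_le (by simp) hτ1.le)) (hle _)
      · rw [map_mul, map_mul, hτ1, mul_one]
        exact mul_le_one' hv2 hδ1.le
    rw [map_mul, map_mul, hτ2, hsub h2, mul_one, mul_one, map_mul] at h3
    by_contra! hlt
    exact ((mul_le_of_le_one_left' hlt).trans_lt hδ1).ne h3
  · intro β
    have e : (s - algebraMap κ F β) * (1 - τ) * (algebraMap κ F x₁ - algebraMap κ F y₁) =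
        (-(1 + τ) - algebraMap κ F β * (1 - τ)) * (algebraMap κ F x₁ - algebraMap κ F y₁)
          - 2 * δ * τ := by
      apply mul_left_cancel₀ hδ
      linear_combination hs
    have hb : v (-(1 + τ) - algebraMap κ F β * (1 - τ)) = 1 := by
      have := hτ (-(C 1 + X) - C β * (C 1 - X)) (by
        intro h
        have := congrArg (eval 1) h
        simp at this)
      simpa only [map_sub, map_neg, map_add, map_mul, aeval_C, aeval_X, map_one] using this
    have h3 : v ((s - algebraMap κ F β) * (1 - τ) * (algebraMap κ F x₁ - algebraMap κ F y₁)) = 1 :=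
        by
      have hb' : v ((-(1 + τ) - algebraMap κ F β * (1 - τ)) *
          (algebraMap κ F x₁ - algebraMap κ F y₁)) = 1 := by
        rw [map_mul, hb, hsub h1, mul_one]
      rw [e, v.map_sub_eq_of_lt_left, hb']
      rw [hb', map_mul, map_mul, hτ1, mul_one]
      exact (mul_le_of_le_one_left' hv2).trans_lt hδ1
    rwa [map_mul, map_mul, hτ2, hsub h1, mul_one, mul_one] at h3

end place

section place

open Polynomial

theorem chart_edge' {F : Type*} [Field F] [CharZero F] {a : F} {p q : Fin 3 → F}
    (hD : chartD a p ≠ 0) (hp : bil p p = 1) (hD' : chartD a q ≠ 0) (hq : bil q q = 1) :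
    bil p q * ((chartX a p - chartY a p) * (chartX a q - chartY a q)) =
      (chartX a p + chartY a p) * (chartX a q + chartY a q) - 2 * chartX a p * chartY a p -
        2 * chartX a q * chartY a q := by
  have := chart_edge hD hp hD' hq
  linear_combination -2 * this

variable {κ F Γ : Type*} [Field κ] [Field F] [Algebra κ F] [CharZero κ] [CharZero F]
  [LinearOrderedCommGroupWithZero Γ] {v : Valuation F Γ}
  {H : GeoGraph} {μ : Finset ℕ → F} {ρ : ℕ → Fin 3 → F}

theorem chart_ne {F : Type*} [Field F] [CharZero F] {a : F} {p q : Fin 3 → F}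
    (hD : chartD a p ≠ 0) (hp : bil p p = 1) (hD' : chartD a q ≠ 0) (hq : bil q q = 1)
    (hpq : bil p q ^ 2 ≠ 1) :
    chartX a p ≠ chartX a q ∧ chartX a p ≠ chartY a q ∧ chartY a p ≠ chartX a q ∧
      chartY a p ≠ chartY a q := by
  have h := chart_edge hD hp hD' hq
  have hN : (chartX a p - chartY a p) * (chartX a q - chartY a q) ≠ 0 := by
    rw [chartX_sub_chartY hD, chartX_sub_chartY hD']
    simp [hD, hD']
  have h1 : (1 - bil p q) ≠ 0 := fun h => hpq (by linear_combination -(1 + bil p q) * h)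
  have h2 : (1 + bil p q) ≠ 0 := fun h => hpq (by linear_combination -(1 - bil p q) * h)
  have e1 : (1 - bil p q) * ((chartX a p - chartY a p) * (chartX a q - chartY a q)) =
    2 * ((chartX a p - chartX a q) * (chartY a p - chartY a q)) := by linear_combination 2 * h
  have e2 : (1 + bil p q) * ((chartX a p - chartY a p) * (chartX a q - chartY a q)) =
    -2 * ((chartX a p - chartY a q) * (chartY a p - chartX a q)) := by linear_combination -2 * h
  have n1 := mul_ne_zero h1 hN
  have n2 := mul_ne_zero h2 hN
  rw [e1] at n1
  rw [e2] at n2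
  simp only [mul_ne_zero_iff, sub_ne_zero] at n1 n2
  exact ⟨n1.2.1, n2.2.1, n2.2.2, n1.2.2⟩

theorem IsSol.place_infinite (hρ : IsSol H μ ρ) (hH : PreCalligraph H)
    (hg : GaussIndep κ v fun e : FreeEdge H => μ e.1) {k : κ} (hk : algebraMap κ F k = μ {1, 2})
    (hk1 : k ^ 2 ≠ 1) (hinf : ∃ i, 1 < v (ρ 0 i)) :
    (∃ ω, 1 < ω ∧ ∀ m n : κ, m ≠ 0 ∨ n ≠ 0 → v (algebraMap κ F m * bil (ρ 0) (ρ 1) +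
      algebraMap κ F n * bil (ρ 0) (ρ 2)) = ω) ∨
    (1 < v (bil (ρ 0) (ρ 2)) ∧ ∀ β : κ, v (bil (ρ 0) (ρ 1) - algebraMap κ F β) = 1) ∨
    (1 < v (bil (ρ 0) (ρ 1)) ∧ ∀ β : κ, v (bil (ρ 0) (ρ 2) - algebraMap κ F β) = 1) := by
  have hv : TrivialOn κ v := fun c hc => hg.trivial hc
  obtain ⟨a, ha⟩ := exists_chart hv H.V ρ
  have hM : ∀ w ∈ H.V, 1 ≤ v (chartD (a : F) (ρ w)) := fun w hw =>
    one_le_chartD hv (hρ.sph w hw) (ha w hw)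
  have hD : ∀ w ∈ H.V, chartD (a : F) (ρ w) ≠ 0 := fun w hw h0 => by
    have := hM w hw
    rw [h0, map_zero] at this
    exact absurd this (by simp)
  have hρ1 := hρ.one
  have hρ2 := hρ.two
  rw [← hk] at hρ2
  obtain ⟨⟨x₁, hx1⟩, ⟨y₁, hy1⟩⟩ := chartX_mem_range (F := F) (a : κ) k (ρ 1) (Or.inl hρ1)
  obtain ⟨⟨x₂, hx2⟩, ⟨y₂, hy2⟩⟩ := chartX_mem_range (F := F) (a : κ) k (ρ 2) (Or.inr hρ2)
  rw [map_natCast] at hx1 hx2 hy1 hy2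
  have hm0 := hH.zero_mem
  have hm1 := hH.one_mem
  have hm2 := hH.two_mem
  have inj := (algebraMap κ F).injective
  have h12 : bil (ρ 1) (ρ 2) ^ 2 ≠ 1 := by
    rw [hρ.edge 1 2 hH.mem, ← hk, ← map_pow]
    exact fun h => hk1 (inj (by rw [h, map_one]))
  obtain ⟨n1, n2, n3, n4⟩ := chart_ne (hD 1 hm1) (hρ.sph 1 hm1) (hD 2 hm2) (hρ.sph 2 hm2) h12
  have hXY : ∀ w ∈ H.V, chartX (a : F) (ρ w) ≠ chartY (a : F) (ρ w) := by
    intro w hw h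
    have := chartX_sub_chartY (hD w hw)
    rw [h, sub_self] at this
    exact (div_ne_zero (neg_ne_zero.2 one_ne_zero) (hD w hw)) this.symm
  have n5 := hXY 1 hm1
  have n6 := hXY 2 hm2
  have hs := chart_edge' (hD 0 hm0) (hρ.sph 0 hm0) (hD 1 hm1) (hρ.sph 1 hm1)
  have ht := chart_edge' (hD 0 hm0) (hρ.sph 0 hm0) (hD 2 hm2) (hρ.sph 2 hm2)
  rw [← hx1, ← hy1] at hs n5
  rw [← hx2, ← hy2] at ht n6
  rw [← hx1, ← hx2] at n1
  rw [← hx1, ← hy2] at n2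
  rw [← hy1, ← hx2] at n3
  rw [← hy1, ← hy2] at n4
  rw [inj.ne_iff] at n1 n2 n3 n4 n5 n6
  set z := chartLabel H (a : F) ρ (algebraMap κ F x₁) with hz
  set i0 : Option (H.V × Bool) := some (⟨0, hm0⟩, false) with hi0
  set i1 : Option (H.V × Bool) := some (⟨0, hm0⟩, true) with hi1
  have hi01 : i0 ≠ i1 := by simp [hi0, hi1]
  have hf0 : i0 ∈ freeLabel H := ⟨_, _, rfl, by simp, by simp⟩
  have hf1 : i1 ∈ freeLabel H := ⟨_, _, rfl, by simp, by simp⟩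
  have hz0 : z i0 = chartX (a : F) (ρ 0) := rfl
  have hz1 : z i1 = chartY (a : F) (ρ 0) := rfl
  have hne := hXY 0 hm0
  rw [← hz0, ← hz1] at hs ht hne
  have hd0 : 1 < v (chartD (a : F) (ρ 0)) := by
    obtain ⟨i, hi⟩ := hinf
    exact hi.trans_le (ha 0 hm0 i)
  have hxyv : v (z i0 - z i1) = (v (chartD (a : F) (ρ 0)))⁻¹ := by
    rw [hz0, hz1, chartX_sub_chartY (hD 0 hm0)]; simp
  have hxy : v (z i0 - z i1) < 1 := by
    rw [hxyv]; exact inv_lt_one_of_one_lt₀ hd0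
  set J : Set (Option (H.V × Bool)) := {l | v (z l - z i0) ≤ v (z i0 - z i1)} with hJdef
  have hJ0 : i0 ∈ J := by simp [hJdef]
  have hJ1 : i1 ∈ J := by simp [hJdef, v.map_sub_swap (z i1)]
  have hJJ : ∀ j ∈ J, ∀ j' ∈ J, v (z j - z j') ≤ v (z i0 - z i1) := by
    intro j hj j' hj'
    have : z j - z j' = (z j - z i0) - (z j' - z i0) := by ring
    rw [this]
    exact (v.map_sub _ _).trans (max_le hj hj')
  have hJ : ∀ j ∈ J, ∀ j' ∈ J, ∀ i ∉ J, v (z j - z j') < v (z i - z j) := by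
    intro j hj j' hj' i hi
    have hi' : v (z i0 - z i1) < v (z i - z i0) := not_le.1 hi
    have : z i - z j = (z i - z i0) - (z j - z i0) := by ring
    rw [this, v.map_sub_eq_of_lt_left (lt_of_le_of_lt hj hi')]
    exact (hJJ j hj j' hj').trans_lt hi'
  have hlab : ∀ l ∉ freeLabel H, (∃ c, z l = algebraMap κ F c ∧ (c = x₁ ∨ c = y₁ ∨ c = x₂ ∨ c = y₂))
      := by
    intro l hl
    match l, hl with
    | none, _ => exact ⟨x₁, rfl, by simp⟩
    | some (⟨w, hw⟩, b), hl =>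
      by_cases h1 : w = 1
      · subst h1
        cases b
        · exact ⟨x₁, hx1.symm, by simp⟩
        · exact ⟨y₁, hy1.symm, by simp⟩
      by_cases h2 : w = 2
      · subst h2
        cases b
        · exact ⟨x₂, hx2.symm, by simp⟩
        · exact ⟨y₂, hy2.symm, by simp⟩
      exact absurd ⟨_, b, rfl, h1, h2⟩ hl
  by_cases hfix : ∀ l ∈ J, l ∈ freeLabel H
  · left
    have hx : ∀ P : κ[X], P ≠ 0 → v (aeval (z i0) P) = 1 := fun P hP =>
      (hρ.cluster hH hg hk a hD x₁ J i0 i1 (z i1 - z i0) hJ0 (sub_ne_zero.2 hne.symm) hJ1 hf1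
        hi01.symm ⟨1, by rw [map_one, div_self (sub_ne_zero.2 hne.symm)]⟩ hJ
        (fun l hl hl' => absurd (hfix l hl) hl') hf0 hi01 hP).2 (Or.inr rfl)
    refine ⟨v (chartD (a : F) (ρ 0)), hd0, fun m n hmn => ?_⟩
    have := valuation_bil_of_generic hv n5 n6 n1 n2 n3 hs ht hxy hx hmn
    rw [hxyv] at this
    exact (mul_inv_eq_one₀ (ne_zero_of_lt hd0)).1 this
  · right
    push Not at hfix
    obtain ⟨l0, hl0, hl0f⟩ := hfix
    obtain ⟨c, hc, hcc⟩ := hlab l0 hl0f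
    have hsame : ∀ l ∈ J, l ∉ freeLabel H → z l = z l0 := by
      intro l hl hlf
      obtain ⟨c', hc', -⟩ := hlab l hlf
      rw [hc', hc]
      by_contra hne
      have h1 : v (z l - z l0) = 1 := by
        rw [hc', hc]; exact hv.sub_eq_one fun h => hne (by rw [h])
      exact (((hJJ l hl l0 hl0).trans_lt hxy).ne h1)
    have key : ∃ x y : F, ((x = z i0 ∧ y = z i1) ∨ (x = z i1 ∧ y = z i0)) ∧ x ≠ algebraMap κ F c ∧
        ∀ P : κ[X], P ≠ 0 → v (aeval ((y - algebraMap κ F c) / (x - algebraMap κ F c)) P) = 1 := by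
      by_cases h0 : z i0 = algebraMap κ F c
      · have h1 : z i1 ≠ algebraMap κ F c := fun h => hne (h0.trans h.symm)
        refine ⟨z i1, z i0, Or.inr ⟨rfl, rfl⟩, h1, fun P hP => ?_⟩
        have h1' : z i1 - z l0 ≠ 0 := by rw [hc]; exact sub_ne_zero.2 h1
        rw [← hc]
        exact (hρ.cluster hH hg hk a hD x₁ J l0 i1 (z i1 - z l0) hl0 h1' hJ1 hf1
          (fun h => hl0f (h ▸ hf1)) ⟨1, by rw [map_one, div_self h1']⟩ hJ hsame hf0 hi01 hP).1 hJ0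
          (fun h => hl0f (h ▸ hf0))
      · refine ⟨z i0, z i1, Or.inl ⟨rfl, rfl⟩, h0, fun P hP => ?_⟩
        have h1' : z i0 - z l0 ≠ 0 := by rw [hc]; exact sub_ne_zero.2 h0
        rw [← hc]
        exact (hρ.cluster hH hg hk a hD x₁ J l0 i0 (z i0 - z l0) hl0 h1' hJ0 hf0
          (fun h => hl0f (h ▸ hf0)) ⟨1, by rw [map_one, div_self h1']⟩ hJ hsame hf1 hi01.symm hP).1
              hJ1
          (fun h => hl0f (h ▸ hf1))
    obtain ⟨x, y, hxyz, hxc, hP⟩ := key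
    have hxy' : v (x - y) < 1 := by
      rcases hxyz with ⟨rfl, rfl⟩ | ⟨rfl, rfl⟩
      · exact hxy
      · rwa [v.map_sub_swap]
    have hneg : ∀ s : F, (∀ β : κ, v (-s - algebraMap κ F β) = 1) →
        ∀ β : κ, v (s - algebraMap κ F β) = 1 := by
      intro s h β
      have := h (-β)
      rwa [map_neg, ← neg_sub', v.map_neg] at this
    have hsy : ∃ s t, (s = bil (ρ 0) (ρ 1) ∨ s = -bil (ρ 0) (ρ 1)) ∧
        (t = bil (ρ 0) (ρ 2) ∨ t = -bil (ρ 0) (ρ 2)) ∧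
        s * ((x - y) * (algebraMap κ F x₁ - algebraMap κ F y₁)) =
        (x + y) * (algebraMap κ F x₁ + algebraMap κ F y₁) - 2 * x * y -
        2 * algebraMap κ F x₁ * algebraMap κ F y₁ ∧
        t * ((x - y) * (algebraMap κ F x₂ - algebraMap κ F y₂)) =
        (x + y) * (algebraMap κ F x₂ + algebraMap κ F y₂) - 2 * x * y -
        2 * algebraMap κ F x₂ * algebraMap κ F y₂ := by
      rcases hxyz with ⟨rfl, rfl⟩ | ⟨rfl, rfl⟩
      · exact ⟨_, _, Or.inl rfl, Or.inl rfl, hs, ht⟩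
      · exact ⟨_, _, Or.inr rfl, Or.inr rfl, by linear_combination hs, by linear_combination ht⟩
    clear hs ht
    obtain ⟨s, t, hs', ht', hs, ht⟩ := hsy
    have hvt : 1 < v t → 1 < v (bil (ρ 0) (ρ 2)) := by
      rcases ht' with rfl | rfl <;> simp
    have hvs : 1 < v s → 1 < v (bil (ρ 0) (ρ 1)) := by
      rcases hs' with rfl | rfl <;> simp
    have hrs : (∀ β : κ, v (s - algebraMap κ F β) = 1) →
        ∀ β : κ, v (bil (ρ 0) (ρ 1) - algebraMap κ F β) = 1 := by
      rcases hs' with rfl | rfl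
      · exact id
      · exact hneg _
    have hrt : (∀ β : κ, v (t - algebraMap κ F β) = 1) →
        ∀ β : κ, v (bil (ρ 0) (ρ 2) - algebraMap κ F β) = 1 := by
      rcases ht' with rfl | rfl
      · exact id
      · exact hneg _
    have hs2 : -s * ((x - y) * (algebraMap κ F y₁ - algebraMap κ F x₁)) =
        (x + y) * (algebraMap κ F y₁ + algebraMap κ F x₁) - 2 * x * y -
        2 * algebraMap κ F y₁ * algebraMap κ F x₁ := by linear_combination hs
    have ht2 : -t * ((x - y) * (algebraMap κ F y₂ - algebraMap κ F x₂)) =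
        (x + y) * (algebraMap κ F y₂ + algebraMap κ F x₂) - 2 * x * y -
        2 * algebraMap κ F y₂ * algebraMap κ F x₂ := by linear_combination ht
    rcases hcc with rfl | rfl | rfl | rfl
    · have := valuation_bil_of_special hv n5 n6 n1 n2 hs ht hxy' hxc hP
      exact Or.inl ⟨hvt this.1, hrs this.2⟩
    · have := valuation_bil_of_special hv n5.symm n6 n3 n4 hs2 ht hxy' hxc hP
      exact Or.inl ⟨hvt this.1, hrs (hneg _ this.2)⟩
    · have := valuation_bil_of_special hv n6 n5 n1.symm n3.symm ht hs hxy' hxc hP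
      exact Or.inr ⟨hvs this.1, hrt this.2⟩
    · have := valuation_bil_of_special hv n6.symm n5 n2.symm n4.symm ht2 hs hxy' hxc hP
      exact Or.inr ⟨hvs this.1, hrt (hneg _ this.2)⟩

end place

section residue

variable {κ F Γ : Type*} [Field κ] [Field F] [Algebra κ F]
  [LinearOrderedCommGroupWithZero Γ] {v : Valuation F Γ}

/-- `x` has residue `c` in the field of constants. -/
def HasResidue (v : Valuation F Γ) (x : F) (c : κ) : Prop := v (x - algebraMap κ F c) < 1

namespace HasResidue

variable {x y : F} {c d : κ}

theorem const (v : Valuation F Γ) (c : κ) : HasResidue v (algebraMap κ F c) c := by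
  simp [HasResidue]

theorem le_one (hv : TrivialOn κ v) (h : HasResidue v x c) : v x ≤ 1 := by
  have : x = (x - algebraMap κ F c) + algebraMap κ F c := by ring
  rw [this]
  exact (v.map_add _ _).trans (max_le h.le (hv.le_one c))

theorem add (h : HasResidue v x c) (h' : HasResidue v y d) : HasResidue v (x + y) (c + d) := by
  unfold HasResidue at *
  rw [map_add, add_sub_add_comm]
  exact v.map_add_lt h h'

theorem neg (h : HasResidue v x c) : HasResidue v (-x) (-c) := by
  unfold HasResidue at *
  rwa [map_neg, ← neg_sub', v.map_neg]

theorem sub (h : HasResidue v x c) (h' : HasResidue v y d) : HasResidue v (x - y) (c - d) := by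
  rw [sub_eq_add_neg, sub_eq_add_neg]; exact h.add h'.neg

theorem mul (hv : TrivialOn κ v) (h : HasResidue v x c) (h' : HasResidue v y d) :
    HasResidue v (x * y) (c * d) := by
  have hx := h.le_one hv
  unfold HasResidue at *
  have e : x * y - algebraMap κ F (c * d) = x * (y - algebraMap κ F d) +
      (x - algebraMap κ F c) * algebraMap κ F d := by rw [map_mul]; ring
  rw [e]
  refine v.map_add_lt ?_ ?_
  · rw [map_mul]; exact (mul_le_of_le_one_left' hx).trans_lt h'
  · rw [map_mul]; exact (mul_le_of_le_one_right' (hv.le_one d)).trans_lt h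

theorem eq_one (hv : TrivialOn κ v) (h : HasResidue v x c) (hc : c ≠ 0) : v x = 1 := by
  have : x = algebraMap κ F c + (x - algebraMap κ F c) := by ring
  rw [this, v.map_add_eq_of_lt_left, hv c hc]
  rwa [hv c hc]

theorem lt_one_iff (hv : TrivialOn κ v) (h : HasResidue v x c) : v x < 1 ↔ c = 0 := by
  constructor
  · intro hx
    by_contra hc
    exact hx.ne (h.eq_one hv hc)
  · rintro rfl
    simpa [HasResidue] using h

theorem inv (hv : TrivialOn κ v) (h : HasResidue v x c) (hc : c ≠ 0) :
    HasResidue v x⁻¹ c⁻¹ := by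
  have hx := h.eq_one hv hc
  have hx0 : x ≠ 0 := by rintro rfl; simp at hx
  have hc0 : algebraMap κ F c ≠ 0 := by simpa using hc
  have e : x⁻¹ - algebraMap κ F c⁻¹ = -(x - algebraMap κ F c) * (x⁻¹ * (algebraMap κ F c)⁻¹) := by
    rw [map_inv₀]; field_simp; ring
  unfold HasResidue at *
  rw [e, map_mul, map_mul, v.map_neg, map_inv₀, map_inv₀, hx, hv c hc]
  simpa using h

theorem div (hv : TrivialOn κ v) (h : HasResidue v x c) (h' : HasResidue v y d) (hd : d ≠ 0) :
    HasResidue v (x / y) (c / d) := by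
  rw [div_eq_mul_inv, div_eq_mul_inv]; exact h.mul hv (h'.inv hv hd)

theorem unique (hv : TrivialOn κ v) (h : HasResidue v x c) (h' : HasResidue v x d) : c = d := by
  have := h.sub h'
  rw [sub_self] at this
  exact sub_eq_zero.1 ((this.lt_one_iff hv).1 (by simp))

theorem of_sq [IsAlgClosed κ] (h : HasResidue v (x ^ 2) c) : ∃ d : κ, HasResidue v x d := by
  obtain ⟨d, hd⟩ := IsAlgClosed.exists_eq_mul_self c
  have e : x ^ 2 - algebraMap κ F c = (x - algebraMap κ F d) * (x - algebraMap κ F (-d)) := by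
    rw [hd, map_mul, map_neg]; ring
  unfold HasResidue at h
  rw [e, map_mul] at h
  by_contra! hcon
  have h1 := hcon d
  have h2 := hcon (-d)
  unfold HasResidue at h1 h2
  exact (not_le.2 h) (one_le_mul (not_lt.1 h1) (not_lt.1 h2))

end HasResidue

variable [CharZero κ] [CharZero F] {H : GeoGraph} {μ : Finset ℕ → F} {ρ : ℕ → Fin 3 → F}

theorem exists_residue_coord [IsAlgClosed κ] (hv : TrivialOn κ v) {k : κ} (hk1 : k ^ 2 ≠ 1)
    {p : Fin 3 → F} (hp : bil p p = 1) {α β : κ} (hs : HasResidue v (bil p basePoint) α)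
    (ht : HasResidue v (bil p (secondPoint (algebraMap κ F k))) β) :
    ∃ q : Fin 3 → κ, ∀ i, HasResidue v (p i) (q i) := by
  rw [bil_basePoint] at hs
  rw [bil_secondPoint] at ht
  have c (r : κ) := HasResidue.const v r
  have k1 : k - 1 ≠ 0 := fun h => hk1 (by linear_combination (k + 1) * h)
  have k2 : k + 1 ≠ 0 := fun h => hk1 (by linear_combination (k - 1) * h)
  have h1 := ((c k).mul hv hs).sub ht
  have h2 := ((((c 2).mul hv (c (k - 1))).mul hv (c 0)).add
    ((h1.mul hv h1).sub (((c (k + 1)).mul hv (c (k - 1))).mul hv ((hs.mul hv hs).sub (c 1)))))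
  have h3 := HasResidue.of_sq (x := algebraMap κ F (2 * (k - 1)) * p 0 -
    (algebraMap κ F k * p 1 - (algebraMap κ F k * p 1 - (algebraMap κ F k - 1) * p 0 -
      (algebraMap κ F k + 1) * p 2))) (by
    convert h2 using 1
    simp only [map_mul, map_sub, map_add, map_one, map_zero, map_ofNat]
    have hp' := hp
    unfold bil at hp'
    linear_combination (algebraMap κ F k ^ 2 - 1) * hp')
  obtain ⟨d, hd⟩ := h3
  have h4 := (hd.add h1).div hv (c (2 * (k - 1))) (mul_ne_zero two_ne_zero k1)
  have hk1' : algebraMap κ F (2 * (k - 1)) ≠ 0 :=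
    (map_ne_zero _).2 (mul_ne_zero two_ne_zero k1)
  have hk2' : algebraMap κ F (k + 1) ≠ 0 := (map_ne_zero _).2 k2
  rw [sub_add_cancel, mul_div_cancel_left₀ _ hk1'] at h4
  obtain ⟨x, hx⟩ : ∃ x : κ, HasResidue v (p 2) x := by
    refine ⟨((k * α - β) - (k - 1) * ((d + (k * α - β)) / (2 * (k - 1)))) / (k + 1), ?_⟩
    convert (h1.sub ((c (k - 1)).mul hv h4)).div hv (c (k + 1)) k2 using 1
    rw [eq_div_iff hk2']
    simp only [map_sub, map_add, map_one]
    ring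
  have h (i : Fin 3) : ∃ y : κ, HasResidue v (p i) y := by
    fin_cases i
    exacts [⟨_, h4⟩, ⟨_, hs⟩, ⟨x, hx⟩]
  choose q hq using h
  exact ⟨q, hq⟩

theorem IsSol.place_finite [IsAlgClosed κ] (hρ : IsSol H μ ρ) (hH : PreCalligraph H)
    (hg : GaussIndep κ v fun e : FreeEdge H => μ e.1) {k : κ} (hk : algebraMap κ F k = μ {1, 2})
    (hk1 : k ^ 2 ≠ 1) {α β : κ} (hs : HasResidue v (bil (ρ 0) (ρ 1)) α)
    (ht : HasResidue v (bil (ρ 0) (ρ 2)) β) : False := by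
  have hv : TrivialOn κ v := fun c hc => hg.trivial hc
  have hm0 := hH.zero_mem
  obtain ⟨q, hq⟩ := exists_residue_coord hv hk1 (hρ.sph 0 hm0) (by rwa [← hρ.one])
    (by rwa [hk, ← hρ.two])
  obtain ⟨a, ha⟩ := exists_chart hv H.V ρ
  have hM : ∀ w ∈ H.V, 1 ≤ v (chartD (a : F) (ρ w)) := fun w hw =>
    one_le_chartD hv (hρ.sph w hw) (ha w hw)
  have hD : ∀ w ∈ H.V, chartD (a : F) (ρ w) ≠ 0 := fun w hw h0 => by
    have := hM w hw
    rw [h0, map_zero] at this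
    exact absurd this (by simp)
  have c (r : κ) := HasResidue.const v r
  have ca : HasResidue v (a : F) (a : κ) := by simpa using c (a : κ)
  have c2 : HasResidue v (2 : F) (2 : κ) := by simpa only [map_ofNat] using c 2
  have c1 : HasResidue v (1 : F) (1 : κ) := by simpa using c 1
  have hDr : HasResidue v (chartD (a : F) (ρ 0)) (chartD (a : κ) q) := by
    unfold chartD
    rw [sq, sq]
    exact ((hq 2).sub (ca.mul hv (hq 1))).add ((ca.mul hv ca).mul hv (hq 0))
  have hD0 : chartD (a : κ) q ≠ 0 := by
    intro h
    exact (not_le.2 ((hDr.lt_one_iff hv).2 h)) (hM 0 hm0)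
  have h2D : 2 * chartD (a : κ) q ≠ 0 := mul_ne_zero two_ne_zero hD0
  have hX : HasResidue v (chartX (a : F) (ρ 0)) (chartX (a : κ) q) :=
    (((hq 1).sub ((c2.mul hv ca).mul hv (hq 0))).sub c1).div hv (c2.mul hv hDr) h2D
  have hY : HasResidue v (chartY (a : F) (ρ 0)) (chartY (a : κ) q) :=
    (((hq 1).sub ((c2.mul hv ca).mul hv (hq 0))).add c1).div hv (c2.mul hv hDr) h2D
  have hXY : chartX (a : κ) q ≠ chartY (a : κ) q := by
    rw [← sub_ne_zero, chartX_sub_chartY hD0]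
    exact div_ne_zero (by simp) hD0
  set z := chartLabel H (a : F) ρ (algebraMap κ F (chartX (a : κ) q)) with hz
  set i0 : Option (H.V × Bool) := some (⟨0, hm0⟩, false) with hi0
  set i1 : Option (H.V × Bool) := some (⟨0, hm0⟩, true) with hi1
  have hi01 : i0 ≠ i1 := by simp [hi0, hi1]
  have hf0 : i0 ∈ freeLabel H := ⟨_, _, rfl, by simp, by simp⟩
  have hf1 : i1 ∈ freeLabel H := ⟨_, _, rfl, by simp, by simp⟩
  set J : Set (Option (H.V × Bool)) := {l | v (z l - z none) < 1} with hJdef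
  have hJn : none ∈ J := by simp [hJdef]
  have hJ0 : i0 ∈ J := hX
  have hJ1 : i1 ∉ J := fun h => hXY ((hY.unique hv h).symm)
  have hJJ : ∀ j ∈ J, ∀ j' ∈ J, v (z j - z j') < 1 := by
    intro j hj j' hj'
    have : z j - z j' = (z j - z none) - (z j' - z none) := by ring
    rw [this]
    exact v.map_sub_lt hj hj'
  have hJ : ∀ j ∈ J, ∀ j' ∈ J, ∀ i ∉ J, v (z j - z j') < v (z i - z j) := by
    intro j hj j' hj' i hi
    have hi' : 1 ≤ v (z i - z none) := not_lt.1 hi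
    have : z i - z j = (z i - z none) - (z j - z none) := by ring
    rw [this, v.map_sub_eq_of_lt_left (lt_of_lt_of_le hj hi')]
    exact (hJJ j hj j' hj').trans_le hi'
  have hsame : ∀ l ∈ J, l ∉ freeLabel H → z l = z none := by
    intro l hl hlf
    have : ∃ c : κ, z l = algebraMap κ F c := by
      match l, hlf with
      | none, _ => exact ⟨_, rfl⟩
      | some (w, b), hlf =>
        have hw : ρ w = basePoint ∨ ρ w = secondPoint (algebraMap κ F k) := by
          rw [hk]
          by_cases h1 : w.1 = 1
          · exact Or.inl (h1 ▸ hρ.one)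
          by_cases h2 : w.1 = 2
          · exact Or.inr (h2 ▸ hρ.two)
          · exact absurd ⟨w, b, rfl, h1, h2⟩ hlf
        obtain ⟨⟨x, hx⟩, ⟨y, hy⟩⟩ := chartX_mem_range (F := F) (a : κ) k _ hw
        rw [map_natCast] at hx hy
        cases b
        · exact ⟨x, hx.symm⟩
        · exact ⟨y, hy.symm⟩
    obtain ⟨c, hc⟩ := this
    have hl' : v (z l - z none) < 1 := hl
    rw [hc] at hl' ⊢
    by_contra hne
    exact hl'.ne (hv.sub_eq_one fun h => hne (by rw [h]; rfl))
  have hδ : ∃ δ : F, δ ≠ 0 ∧ (z i0 - z none) / δ ∈ Set.range (algebraMap κ F) := by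
    by_cases h : z i0 - z none = 0
    · exact ⟨1, one_ne_zero, 0, by simp [h]⟩
    · exact ⟨_, h, 1, by simp [div_self h]⟩
  obtain ⟨δ, hδ0, hδr⟩ := hδ
  have hP : (Polynomial.X - Polynomial.C (chartY (a : κ) q)) ≠ 0 := Polynomial.X_sub_C_ne_zero _
  have := (hρ.cluster hH hg hk a hD _ J none i0 δ hJn hδ0 hJ0 hf0 (by simp [hi0]) hδr hJ hsame
    hf1 hi01.symm hP).2 (Or.inl hJ1)
  simp only [map_sub, Polynomial.aeval_X, Polynomial.aeval_C] at this
  exact hY.ne this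

end residue

section configuration

variable {κ F : Type*} [Field κ] [Field F] [Algebra κ F]

/-- Placements of `V` on the quadric with vertices `1` and `2` in normalized position. -/
structure IsConf (V : Finset ℕ) (k : F) (ρ : ℕ → Fin 3 → F) : Prop where
  off : ∀ w ∉ V, ρ w = 0
  one : ρ 1 = basePoint
  two : ρ 2 = secondPoint k
  sph : ∀ w ∈ V, bil (ρ w) (ρ w) = 1

theorem IsSol.conf {H : GeoGraph} {μ : Finset ℕ → F} {ρ : ℕ → Fin 3 → F} (h : IsSol H μ ρ) :
    IsConf H.V (μ {1, 2}) ρ := ⟨h.off, h.one, h.two, h.sph⟩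

/-- The sum of the inner products of one vertex with several others. -/
def pairing {R : Type*} [CommRing R] (ρ : ℕ → Fin 3 → R) (c : ℕ × Finset ℕ) : R :=
  ∑ w ∈ c.2, bil (ρ c.1) (ρ w)

theorem map_pairing {R S G : Type*} [CommRing R] [CommRing S] [FunLike G R S] [RingHomClass G R S]
    (φ : G) (ρ : ℕ → Fin 3 → R) (c : ℕ × Finset ℕ) :
    φ (pairing ρ c) = pairing (fun w i => φ (ρ w i)) c := by
  simp [pairing, map_bil]

/-- The vertices that are not in normalized position. -/
abbrev Mobile (V : Finset ℕ) : Type := {w // w ∈ V ∧ w ≠ 1 ∧ w ≠ 2}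

instance (V : Finset ℕ) : Finite (Mobile V) :=
  Finite.of_injective (fun w : Mobile V => (⟨w.1, w.2.1⟩ : V)) fun a b h => by
    ext; simpa using h

theorem card_mobile {V : Finset ℕ} (h1 : 1 ∈ V) (h2 : 2 ∈ V) :
    Nat.card (Mobile V × Bool) = 2 * (V.card - 2) := by
  have : Nat.card (Mobile V) = ((V.erase 1).erase 2).card := by
    rw [Nat.subtype_card]
    intro x; simp; tauto
  rw [Nat.card_prod, this, Finset.card_erase_of_mem (by simp [h2]), Finset.card_erase_of_mem h1]
  simp; omega

open MvPolynomial in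
/-- The universal placement of `V` on the quadric, with vertices `1` and `2` normalized. -/
noncomputable def coordPoly (V : Finset ℕ) (k : κ) (w : ℕ) :
    Fin 3 → MvPolynomial (Mobile V × Bool) κ :=
  if h : w ∈ V ∧ w ≠ 1 ∧ w ≠ 2 then
    ![X (⟨w, h⟩, false), 2 * X (⟨w, h⟩, false) * X (⟨w, h⟩, true) - 1,
      X (⟨w, h⟩, false) * X (⟨w, h⟩, true) ^ 2 - X (⟨w, h⟩, true)]
  else if w = 1 then fun i => C (basePoint i)
  else if w = 2 then fun i => C (secondPoint k i)
  else 0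

/-- Coordinates of a placement in the chart of the universal placement. -/
noncomputable def genCoord {V : Finset ℕ} (ρ : ℕ → Fin 3 → F) (j : Mobile V × Bool) : F :=
  if j.2 then (ρ j.1 1 + 1) / (2 * ρ j.1 0) else ρ j.1 0

theorem map_basePoint (i : Fin 3) : algebraMap κ F (basePoint i) = basePoint i := by
  fin_cases i <;> simp [basePoint]

theorem map_secondPoint (k : κ) (i : Fin 3) :
    algebraMap κ F (secondPoint k i) = secondPoint (algebraMap κ F k) i := by
  have htwo : algebraMap κ F 2 = 2 := map_ofNat _ 2
  fin_cases i <;> simp [secondPoint, htwo]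

variable [CharZero F] {V : Finset ℕ} {k : κ} {ρ : ℕ → Fin 3 → F}

theorem IsConf.aeval_coordPoly (hρ : IsConf V (algebraMap κ F k) ρ)
    (h0 : ∀ w : Mobile V, ρ w 0 ≠ 0) (w : ℕ) (i : Fin 3) :
    MvPolynomial.aeval (genCoord (V := V) ρ) (coordPoly V k w i) = ρ w i := by
  unfold coordPoly
  split_ifs with h h1 h2
  · have := h0 ⟨w, h⟩
    have hs := hρ.sph w h.1
    simp only [] at this
    unfold bil at hs
    fin_cases i
    · simp [genCoord]
    · simp [genCoord]
      field_simp
      ring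
    · simp [genCoord]
      field_simp
      linear_combination (1 : F) * hs
  · subst h1
    simp [hρ.one, map_basePoint]
  · subst h2
    simp [hρ.two, map_secondPoint]
  · rw [hρ.off w (by tauto)]
    simp

theorem IsConf.generic (hρ : IsConf V (algebraMap κ F k) ρ) (h1 : 1 ∈ V) (h2 : 2 ∈ V)
    {η : Type*} [Finite η] {c : η → ℕ × Finset ℕ} (hc : Nat.card η = 2 * (V.card - 2))
    (hi : AlgebraicIndependent κ fun j => pairing ρ (c j)) :
    (∀ w : Mobile V, ρ w 0 ≠ 0) ∧ AlgebraicIndependent κ (genCoord (V := V) ρ) ∧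
      ∀ y ∈ IntermediateField.adjoin κ (Set.range (genCoord (V := V) ρ)),
        IsAlgebraic (IntermediateField.adjoin κ (Set.range fun j => pairing ρ (c j))) y := by
  classical
  let z : Mobile V × Bool → F := fun j =>
    if ρ j.1 0 = 0 then (if j.2 then ρ j.1 2 else 0) else genCoord ρ j
  set M := IntermediateField.adjoin κ (Set.range z) with hM
  have hz (j) : z j ∈ M := IntermediateField.subset_adjoin _ _ ⟨j, rfl⟩
  have hmem (w : ℕ) (i : Fin 3) : ρ w i ∈ M := by
    by_cases h : w ∈ V ∧ w ≠ 1 ∧ w ≠ 2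
    · have hs := hρ.sph w h.1
      have hf := hz (⟨w, h⟩, false)
      have ht := hz (⟨w, h⟩, true)
      by_cases h0 : ρ w 0 = 0
      · simp only [z, h0, if_true] at ht
        simp only [bil, h0] at hs
        fin_cases i
        · exact (congrArg (· ∈ M) h0).mpr (zero_mem M)
        · have : (ρ w 1 - 1) * (ρ w 1 + 1) = 0 := by linear_combination hs
          rcases mul_eq_zero.1 this with h' | h'
          · exact (congrArg (· ∈ M) (sub_eq_zero.1 h')).mpr (one_mem M)
          · exact (congrArg (· ∈ M) (eq_neg_of_add_eq_zero_left h')).mpr (neg_mem (one_mem M))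
        · exact ht
      · simp only [z, h0, if_false, genCoord, if_true, Bool.false_eq_true] at ht hf
        have h2M : (2 : F) ∈ M := by
          have := M.algebraMap_mem (2 : κ)
          rwa [map_ofNat] at this
        have hb : ρ w 1 ∈ M := by
          have := sub_mem (mul_mem (mul_mem h2M hf) ht) (one_mem M)
          convert this using 1
          field_simp
          ring
        fin_cases i
        · exact hf
        · exact hb
        · have := div_mem (sub_mem (mul_mem hb hb) (one_mem M)) (mul_mem (mul_mem h2M h2M) hf)
          convert this using 1
          unfold bil at hs
          change ρ w 2 = _
          field_simp
          linear_combination (-1 : F) * hs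
    · by_cases hw1 : w = 1
      · subst hw1
        rw [hρ.one, ← map_basePoint (κ := κ)]
        exact M.algebraMap_mem _
      by_cases hw2 : w = 2
      · subst hw2
        rw [hρ.two, ← map_secondPoint]
        exact M.algebraMap_mem _
      rw [hρ.off w (by tauto)]
      exact zero_mem M
  have hfx (j) : pairing ρ (c j) ∈ M := by
    have h2M : (2 : F) ∈ M := by
      have := M.algebraMap_mem (2 : κ)
      rwa [map_ofNat] at this
    refine sum_mem fun w _ => ?_
    exact sub_mem (sub_mem (mul_mem (hmem _ _) (hmem _ _))
      (mul_mem (mul_mem h2M (hmem _ _)) (hmem _ _))) (mul_mem (mul_mem h2M (hmem _ _)) (hmem _ _))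
  obtain ⟨ha, hb⟩ := hi.exchange (hc.trans (card_mobile h1 h2).symm) hfx
  have h0 (w : Mobile V) : ρ w 0 ≠ 0 := by
    intro h
    have := ha.ne_zero (w, false)
    simp [z, h] at this
  have hzg : z = genCoord ρ := by
    funext j
    simp [z, h0 j.1]
  rw [hzg] at ha hb
  exact ⟨h0, ha, hb⟩

theorem IsConf.isAlgebraic (hρ : IsConf V (algebraMap κ F k) ρ) (h1 : 1 ∈ V) (h2 : 2 ∈ V)
    {η : Type*} [Finite η] {c : η → ℕ × Finset ℕ} (hc : Nat.card η = 2 * (V.card - 2))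
    (hi : AlgebraicIndependent κ fun j => pairing ρ (c j)) (w : ℕ) (i : Fin 3) :
    IsAlgebraic (IntermediateField.adjoin κ (Set.range fun j => pairing ρ (c j))) (ρ w i) := by
  obtain ⟨h0, -, h⟩ := hρ.generic h1 h2 hc hi
  refine h _ ?_
  rw [← hρ.aeval_coordPoly h0 w i]
  exact IntermediateField.algebra_adjoin_le_adjoin _ _
    (Algebra.adjoin_range_eq_range_aeval κ (genCoord (V := V) ρ) ▸ ⟨_, rfl⟩)

/-- The universal placement is algebraic over a generic full set of pairings. -/
theorem IsConf.isAlgebraic_coordPoly (hρ : IsConf V (algebraMap κ F k) ρ) (h1 : 1 ∈ V) (h2 : 2 ∈ V)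
    {η : Type*} [Finite η] {c : η → ℕ × Finset ℕ} (hc : Nat.card η = 2 * (V.card - 2))
    (hi : AlgebraicIndependent κ fun j => pairing ρ (c j))
    (b : MvPolynomial (Mobile V × Bool) κ) :
    IsAlgebraic (Algebra.adjoin κ (Set.range fun j => pairing (coordPoly V k) (c j))) b := by
  obtain ⟨h0, hg, h⟩ := hρ.generic h1 h2 hc hi
  set φ := MvPolynomial.aeval (R := κ) (genCoord (V := V) ρ) with hφ
  set A := Algebra.adjoin κ (Set.range fun j => pairing (coordPoly V k) (c j)) with hA
  have hφA : A.map φ = Algebra.adjoin κ (Set.range fun j => pairing ρ (c j)) := by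
    rw [hA, AlgHom.map_adjoin, ← Set.range_comp]
    congr 2
    funext j
    simp only [Function.comp, map_pairing, hφ, hρ.aeval_coordPoly h0]
  have hb := h (φ b) (IntermediateField.algebra_adjoin_le_adjoin _ _
    (Algebra.adjoin_range_eq_range_aeval κ (genCoord (V := V) ρ) ▸ ⟨_, rfl⟩))
  have hb' : IsAlgebraic (Algebra.adjoin κ (Set.range fun j => pairing ρ (c j))) (φ b) :=
    IntermediateField.isAlgebraic_adjoin_iff.1 hb
  let f : A →ₐ[κ] Algebra.adjoin κ (Set.range fun j => pairing ρ (c j)) :=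
    (φ.comp A.val).codRestrict _ fun a => hφA ▸ ⟨a.1, a.2, rfl⟩
  refine hb'.of_ringHom_of_comp_eq f φ ?_ ?_ rfl
  · rintro ⟨y, hy⟩
    rw [← hφA] at hy
    obtain ⟨a, ha, rfl⟩ := hy
    exact ⟨⟨a, ha⟩, rfl⟩
  · exact hg

theorem finite_setOf_isConf (h1 : 1 ∈ V) (h2 : 2 ∈ V) {η : Type*} [Finite η]
    {c : η → ℕ × Finset ℕ} (hc : Nat.card η = 2 * (V.card - 2)) {f : η → F}
    (hi : AlgebraicIndependent κ f) :
    {ρ | IsConf V (algebraMap κ F k) ρ ∧ ∀ j, pairing ρ (c j) = f j}.Finite := by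
  rcases Set.eq_empty_or_nonempty
    {ρ | IsConf V (algebraMap κ F k) ρ ∧ ∀ j, pairing ρ (c j) = f j} with he | ⟨ρ₀, hρ₀, hf₀⟩
  · rw [he]; exact Set.finite_empty
  obtain rfl : (fun j => pairing ρ₀ (c j)) = f := funext hf₀
  have halg := hρ₀.isAlgebraic_coordPoly h1 h2 hc hi
  set A := Algebra.adjoin κ (Set.range fun j => pairing (coordPoly V k) (c j)) with hA
  choose q hq0 hq using fun j => halg (MvPolynomial.X j)
  let θ (ρ : ℕ → Fin 3 → F) : A →ₐ[κ] F :=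
    (MvPolynomial.aeval (R := κ) (genCoord (V := V) ρ)).comp A.val
  have hθ {ρ : ℕ → Fin 3 → F} (hρ : IsConf V (algebraMap κ F k) ρ)
      (hf : ∀ j, pairing ρ (c j) = pairing ρ₀ (c j)) : θ ρ = θ ρ₀ := by
    have h0 := (hρ₀.generic h1 h2 hc hi).1
    have h0' := (hρ.generic h1 h2 hc ((funext hf : (fun j => pairing ρ (c j)) = _) ▸ hi)).1
    refine AlgHom.adjoin_ext fun x hx => ?_
    obtain ⟨j, rfl⟩ := hx
    simp only [θ, AlgHom.comp_apply, Subalgebra.coe_val, map_pairing, hρ.aeval_coordPoly h0',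
      hρ₀.aeval_coordPoly h0, hf]
  have hθ0 : Function.Injective (θ ρ₀) := by
    have := (hρ₀.generic h1 h2 hc hi).2.1
    exact Function.Injective.comp (g := MvPolynomial.aeval (genCoord ρ₀)) this
      Subtype.val_injective
  have hfin : (Set.univ.pi fun j => {x : F | ((q j).map (θ ρ₀ : A →+* F)).IsRoot x}).Finite :=
    Set.Finite.pi fun j => Polynomial.finite_setOfPred_isRoot
      ((Polynomial.map_ne_zero_iff hθ0).2 (hq0 j))
  refine (hfin.image fun z w i => MvPolynomial.aeval z (coordPoly V k w i)).subset ?_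
  rintro ρ ⟨hρ, hf⟩
  have h0' := (hρ.generic h1 h2 hc ((funext hf : (fun j => pairing ρ (c j)) = _) ▸ hi)).1
  refine ⟨genCoord ρ, fun j _ => ?_, ?_⟩
  · have := congrArg (MvPolynomial.aeval (R := κ) (genCoord (V := V) ρ)) (hq j)
    rw [Set.mem_ofPred_eq, Polynomial.IsRoot, Polynomial.eval_map, ← hθ hρ hf]
    rw [map_zero, Polynomial.aeval_def, ← AlgHom.coe_toRingHom, Polynomial.hom_eval₂] at this
    rw [AlgHom.coe_toRingHom, MvPolynomial.aeval_X] at this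
    exact this
  · funext w i
    exact hρ.aeval_coordPoly h0' w i

end configuration

section lipschitz

variable {κ F Γ : Type*} [Field κ] [Field F] [Algebra κ F] [LinearOrderedCommGroupWithZero Γ]
  {v : Valuation F Γ} [CharZero κ] [CharZero F] {V : Finset ℕ} {k : κ} {ρ ρ' : ℕ → Fin 3 → F}

theorem IsConf.gaussIndep_genCoord (hρ : IsConf V (algebraMap κ F k) ρ) (h1 : 1 ∈ V) (h2 : 2 ∈ V)
    {η : Type*} [Finite η] {c : η → ℕ × Finset ℕ} (hc : Nat.card η = 2 * (V.card - 2))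
    (hg : GaussIndep κ v fun j => pairing ρ (c j)) :
    GaussIndep κ v (genCoord (V := V) ρ) := by
  refine hg.exchange (hc.trans (card_mobile h1 h2).symm) fun j => ?_
  have h0 := (hρ.generic h1 h2 hc hg.algebraicIndependent).1
  have : pairing ρ (c j) = MvPolynomial.aeval (genCoord (V := V) ρ)
      (pairing (coordPoly V k) (c j)) := by
    simp only [map_pairing, hρ.aeval_coordPoly h0]
  rw [this]
  exact IntermediateField.algebra_adjoin_le_adjoin _ _
    (Algebra.adjoin_range_eq_range_aeval κ (genCoord (V := V) ρ) ▸ ⟨_, rfl⟩)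

/-- If a full set of generic pairings of two placements agrees up to `ε`, then so does every
pairing that agrees up to an infinitesimal. -/
theorem IsConf.pairing_sub_le (hρ : IsConf V (algebraMap κ F k) ρ)
    (hρ' : IsConf V (algebraMap κ F k) ρ') (h1 : 1 ∈ V) (h2 : 2 ∈ V)
    {η : Type*} [Finite η] {c : η → ℕ × Finset ℕ} (hc : Nat.card η = 2 * (V.card - 2))
    (hg : GaussIndep κ v fun j => pairing ρ' (c j)) {ε : Γ} (hε : ε < 1)
    (hj : ∀ j, v (pairing ρ (c j) - pairing ρ' (c j)) ≤ ε) {d : ℕ × Finset ℕ}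
    (hd : v (pairing ρ d - pairing ρ' d) < 1) : v (pairing ρ d - pairing ρ' d) ≤ ε := by
  have hg' : GaussIndep κ v fun j => pairing ρ (c j) :=
    hg.congr fun j => by rw [v.map_sub_swap]; exact (hj j).trans_lt hε
  have h0 := (hρ.generic h1 h2 hc hg'.algebraicIndependent).1
  have h0' := (hρ'.generic h1 h2 hc hg.algebraicIndependent).1
  have hz := hρ.gaussIndep_genCoord h1 h2 hc hg'
  have hz' := hρ'.gaussIndep_genCoord h1 h2 hc hg
  set φ : MvPolynomial (Mobile V × Bool) κ →ₐ[κ] F := MvPolynomial.aeval (genCoord ρ) with hφ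
  set ψ : MvPolynomial (Mobile V × Bool) κ →ₐ[κ] F := MvPolynomial.aeval (genCoord ρ') with hψ
  have eφ (d) : φ (pairing (coordPoly V k) d) = pairing ρ d := by
    simp only [map_pairing, hφ, hρ.aeval_coordPoly h0]
  have eψ (d) : ψ (pairing (coordPoly V k) d) = pairing ρ' d := by
    simp only [map_pairing, hψ, hρ'.aeval_coordPoly h0']
  have := valuation_sub_le_of_isAlgebraic v _
    (hρ'.isAlgebraic_coordPoly h1 h2 hc hg.algebraicIndependent (pairing (coordPoly V k) d))
    (φ : _ →+* F) (ψ : _ →+* F) (fun b hb => hz' b hb) (ε := ε) ?_ ?_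
  · simpa only [RingHom.coe_coe, eφ, eψ] using this
  · intro a ha
    induction ha using Algebra.adjoin_induction with
    | mem x hx =>
      obtain ⟨j, rfl⟩ := hx
      simpa only [RingHom.coe_coe, eφ, eψ] using hj j
    | algebraMap r => simp
    | add x y _ _ hx hy =>
      rw [map_add, map_add, add_sub_add_comm]
      exact v.map_add_le hx hy
    | mul x y _ _ hx hy =>
      have e : (φ : _ →+* F) (x * y) - (ψ : _ →+* F) (x * y) =
          φ x * (φ y - ψ y) + ψ y * (φ x - ψ x) := by
        simp only [RingHom.coe_coe, map_mul]; ring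
      rw [e]
      refine v.map_add_le ?_ ?_
      · rw [map_mul]
        exact (mul_le_mul' (hz.le_one x) hy).trans (one_mul ε).le
      · rw [map_mul]
        exact (mul_le_mul' (hz'.le_one y) hx).trans (one_mul ε).le
  · simpa only [RingHom.coe_coe, eφ, eψ] using hd

end lipschitz

section tower

variable {κ₀ κ F : Type*} [Field κ₀] [Field κ] [Field F] [Algebra κ₀ κ] [Algebra κ₀ F] [Algebra κ F]
  [IsScalarTower κ₀ κ F] {η : Type*} {f : η → F} {u : F}

theorem AlgebraicIndependent.option_of_transcendental (hf : AlgebraicIndependent κ₀ f)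
    (hr : ∀ j, f j ∈ Set.range (algebraMap κ F)) (hu : Transcendental κ u) :
    AlgebraicIndependent κ₀ fun o : Option η => o.elim u f := by
  rw [hf.option_iff_transcendental]
  intro hal
  apply hu
  set L := (IsScalarTower.toAlgHom κ₀ κ F).range with hL
  have hle : Algebra.adjoin κ₀ (Set.range f) ≤ L := by
    rw [Algebra.adjoin_le_iff]
    rintro _ ⟨j, rfl⟩
    exact hr j
  have h1 : IsAlgebraic L u :=
    hal.ringHom_of_comp_eq (Subalgebra.inclusion hle) (RingHom.id F)
      (Subalgebra.inclusion_injective hle) rfl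
  exact h1.of_ringHom_of_comp_eq (IsScalarTower.toAlgHom κ₀ κ F).rangeRestrict (RingHom.id F)
    (AlgHom.rangeRestrict_surjective _) Function.injective_id rfl

theorem IsAlgebraic.adjoin_singleton_of_option {y : F}
    (hy : IsAlgebraic (IntermediateField.adjoin κ₀ (Set.range fun o : Option η => o.elim u f)) y)
    (hr : ∀ j, f j ∈ Set.range (algebraMap κ F)) : IsAlgebraic (Algebra.adjoin κ {u}) y := by
  rw [IntermediateField.isAlgebraic_adjoin_iff] at hy
  have hle : Algebra.adjoin κ₀ (Set.range fun o : Option η => o.elim u f) ≤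
      (Algebra.adjoin κ {u}).restrictScalars κ₀ := by
    rw [Algebra.adjoin_le_iff]
    rintro _ ⟨j, rfl⟩
    rw [SetLike.mem_coe, Subalgebra.mem_restrictScalars]
    cases j with
    | none => exact Algebra.self_mem_adjoin_singleton κ u
    | some j =>
      obtain ⟨c, hc⟩ := hr j
      have h := (Algebra.adjoin κ {u}).algebraMap_mem c
      rw [hc] at h
      exact h
  exact hy.ringHom_of_comp_eq (Subalgebra.inclusion hle) (RingHom.id F)
    (Subalgebra.inclusion_injective hle) rfl

end tower

section solutions

theorem GeoGraph.exists_edgePair (H : GeoGraph) (e : FreeEdge H) :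
    ∃ p : ℕ × ℕ, e.1 = {p.1, p.2} := by
  obtain ⟨a, b, -, h⟩ := Finset.card_eq_two.1 (H.edge_two _ e.2.1)
  exact ⟨(a, b), h⟩

/-- An edge as a pairing. -/
noncomputable def edgePair {H : GeoGraph} (e : FreeEdge H) : ℕ × Finset ℕ :=
  ((H.exists_edgePair e).choose.1, {(H.exists_edgePair e).choose.2})

/-- The free edges together with the sum of the two diagonals at `0`. -/
noncomputable def sectionPair {H : GeoGraph} (o : Option (FreeEdge H)) : ℕ × Finset ℕ :=
  o.elim (0, {1, 2}) edgePair

variable {κ F : Type*} [Field κ] [Field F] [Algebra κ F] {H : GeoGraph} {μ : Finset ℕ → F}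
  {ρ : ℕ → Fin 3 → F} {k : κ} {u : F}

theorem IsSol.pairing_edgePair (h : IsSol H μ ρ) (e : FreeEdge H) :
    pairing ρ (edgePair e) = μ e.1 := by
  have hs := (H.exists_edgePair e).choose_spec
  simp only [pairing, edgePair, Finset.sum_singleton]
  rw [h.edge _ _ (hs ▸ e.2.1), ← hs]

theorem pairing_diagonals {R : Type*} [CommRing R] (ρ : ℕ → Fin 3 → R) :
    pairing ρ (0, {1, 2}) = bil (ρ 0) (ρ 1) + bil (ρ 0) (ρ 2) := by
  simp [pairing]

theorem IsSol.pairing_sectionPair (h : IsSol H μ ρ)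
    (hu : bil (ρ 0) (ρ 1) + bil (ρ 0) (ρ 2) = u) (o : Option (FreeEdge H)) :
    pairing ρ (sectionPair o) = o.elim u fun e => μ e.1 := by
  cases o with
  | none => exact (pairing_diagonals ρ).trans hu
  | some e => exact h.pairing_edgePair e

theorem PreCalligraph.three_le_card (hH : PreCalligraph H) : 3 ≤ H.V.card := by
  simpa using Finset.card_le_card hH.sub

theorem PreCalligraph.card_section (hH : PreCalligraph H) :
    Nat.card (Option (FreeEdge H)) = 2 * (H.V.card - 2) := by
  have := hH.three_le_card
  rw [Finite.card_option, hH.card_freeEdge]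
  omega

variable [CharZero F]

theorem PreCalligraph.finite_section (hH : PreCalligraph H) (hk : algebraMap κ F k = μ {1, 2})
    (hi : AlgebraicIndependent κ fun o : Option (FreeEdge H) => o.elim u fun e => μ e.1) :
    {ρ | IsSol H μ ρ ∧ bil (ρ 0) (ρ 1) + bil (ρ 0) (ρ 2) = u}.Finite := by
  refine (finite_setOf_isConf (k := k) (c := sectionPair) hH.one_mem hH.two_mem hH.card_section
      hi).subset ?_
  rintro ρ ⟨h, hu⟩
  exact ⟨hk ▸ h.conf, h.pairing_sectionPair hu⟩

theorem IsSol.section_isAlgebraic (h : IsSol H μ ρ) (hH : PreCalligraph H)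
    (hk : algebraMap κ F k = μ {1, 2}) (hu : bil (ρ 0) (ρ 1) + bil (ρ 0) (ρ 2) = u)
    (hi : AlgebraicIndependent κ fun o : Option (FreeEdge H) => o.elim u fun e => μ e.1)
    (w : ℕ) (i : Fin 3) :
    IsAlgebraic (IntermediateField.adjoin κ
      (Set.range fun o : Option (FreeEdge H) => o.elim u fun e => μ e.1)) (ρ w i) := by
  have e : (fun o : Option (FreeEdge H) => pairing ρ (sectionPair o)) = _ :=
    funext (h.pairing_sectionPair hu)
  have := (show IsConf H.V (algebraMap κ F k) ρ from hk ▸ h.conf).isAlgebraic hH.one_mem hH.two_mem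
    hH.card_section (c := sectionPair) (e ▸ hi) w i
  rwa [e] at this

theorem GeoGraph.card_freeEdge_of_tight {G : GeoGraph} (h12 : {1, 2} ∈ G.E)
    (hG : G.E.card = 2 * G.V.card - 3) : Nat.card (FreeEdge G) = 2 * (G.V.card - 2) := by
  have : Nat.card (FreeEdge G) = (G.E.erase {1, 2}).card := by
    rw [Nat.subtype_card]
    intro x; simp; tauto
  rw [this, Finset.card_erase_of_mem h12]
  omega

theorem GeoGraph.finite_isSol {G : GeoGraph} (h12 : {1, 2} ∈ G.E)
    (hG : G.E.card = 2 * G.V.card - 3) (hk : algebraMap κ F k = μ {1, 2})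
    (hi : AlgebraicIndependent κ fun e : FreeEdge G => μ e.1) : {ρ | IsSol G μ ρ}.Finite := by
  have hV := G.edge_sub _ h12
  refine (finite_setOf_isConf (k := k) (c := edgePair) (hV (by simp)) (hV (by simp))
    (card_freeEdge_of_tight h12 hG) hi).subset fun ρ h => ?_
  exact ⟨hk ▸ h.conf, h.pairing_edgePair⟩

/-- In a generic configuration no vertex lies on the plane through the origin and the
normalized vertices. -/
theorem IsConf.ne_of_generic {V : Finset ℕ} (hc : IsConf V (algebraMap κ F k) ρ) (h1 : 1 ∈ V)
    (h2 : 2 ∈ V) {η : Type*} [Finite η] {c : η → ℕ × Finset ℕ}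
    (hη : Nat.card η = 2 * (V.card - 2)) (hi : AlgebraicIndependent κ fun j => pairing ρ (c j))
    (hk1 : k ^ 2 ≠ 1) (h0 : 0 ∈ V) :
    (algebraMap κ F k - 1) * ρ 0 0 ≠ (algebraMap κ F k + 1) * ρ 0 2 := by
  intro he
  obtain ⟨hz, hgen, -⟩ := hc.generic h1 h2 hη hi
  let w : Mobile V := ⟨0, h0, by simp, by simp⟩
  have k1 : k - 1 ≠ 0 := fun h => hk1 (by linear_combination (k + 1) * h)
  set P : MvPolynomial (Mobile V × Bool) κ := MvPolynomial.C (k - 1) * MvPolynomial.X (w, false) -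
    MvPolynomial.C (k + 1) * (MvPolynomial.X (w, false) * MvPolynomial.X (w, true) ^ 2 -
      MvPolynomial.X (w, true)) with hP
  have hP0 : P = 0 := by
    apply hgen
    rw [map_zero]
    have h1 := hc.aeval_coordPoly hz 0 0
    have h2 := hc.aeval_coordPoly hz 0 2
    have hw : (0 : ℕ) ∈ V ∧ 0 ≠ 1 ∧ 0 ≠ 2 := w.2
    simp only [coordPoly, dif_pos hw] at h1 h2
    simp at h1 h2
    simp [hP, w]
    linear_combination he + (algebraMap κ F k - 1) * h1 - (algebraMap κ F k + 1) * h2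
  have := congrArg (MvPolynomial.eval fun j : Mobile V × Bool => if j.2 then (0 : κ) else 1) hP0
  simp [hP] at this
  exact k1 this

theorem IsSol.ne_of_generic {G : GeoGraph} (h : IsSol G μ ρ) (h12 : {1, 2} ∈ G.E)
    (hG : G.E.card = 2 * G.V.card - 3) (hk : algebraMap κ F k = μ {1, 2}) (hk1 : k ^ 2 ≠ 1)
    (hi : AlgebraicIndependent κ fun e : FreeEdge G => μ e.1) (h0 : 0 ∈ G.V) :
    (algebraMap κ F k - 1) * ρ 0 0 ≠ (algebraMap κ F k + 1) * ρ 0 2 := by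
  have hV := G.edge_sub _ h12
  exact (hk ▸ h.conf : IsConf G.V (algebraMap κ F k) ρ).ne_of_generic (hV (by simp))
    (hV (by simp)) (G.card_freeEdge_of_tight h12 hG)
    ((funext h.pairing_edgePair : (fun e => pairing ρ (edgePair e)) = _) ▸ hi) hk1 h0

theorem IsSol.section_ne_of_generic (h : IsSol H μ ρ) (hH : PreCalligraph H)
    (hk : algebraMap κ F k = μ {1, 2}) (hu : bil (ρ 0) (ρ 1) + bil (ρ 0) (ρ 2) = u)
    (hi : AlgebraicIndependent κ fun o : Option (FreeEdge H) => o.elim u fun e => μ e.1)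
    (hk1 : k ^ 2 ≠ 1) :
    (algebraMap κ F k - 1) * ρ 0 0 ≠ (algebraMap κ F k + 1) * ρ 0 2 :=
  (hk ▸ h.conf : IsConf H.V (algebraMap κ F k) ρ).ne_of_generic hH.one_mem hH.two_mem
    hH.card_section
    ((funext (h.pairing_sectionPair hu) : (fun o => pairing ρ (sectionPair o)) = _) ▸ hi) hk1
    hH.zero_mem

end solutions

section rational

open Polynomial

variable {C K : Type*} [Field C] [Field K] [Algebra (RatFunc C) K] [Algebra C K]
  [IsScalarTower C (RatFunc C) K]

variable (C K) in
/-- The coordinate of the rational function field in an extension `K`. -/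
noncomputable def ratGen : K := algebraMap (RatFunc C) K RatFunc.X

theorem algebraMap_algebraMap_ratGen (p : C[X]) :
    algebraMap (RatFunc C) K (algebraMap C[X] (RatFunc C) p) = aeval (ratGen C K) p := by
  have h : algebraMap C[X] (RatFunc C) p = aeval (RatFunc.X : RatFunc C) p := by
    induction p using Polynomial.induction_on' with
    | add p q hp hq => rw [map_add, map_add, hp, hq]
    | monomial n a =>
      rw [← C_mul_X_pow_eq_monomial]
      simp [RatFunc.algebraMap_C, RatFunc.algebraMap_X]
  rw [h, ratGen, aeval_algebraMap_apply]

variable (C K) in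
theorem transcendental_ratGen : Transcendental C (ratGen C K) := by
  rw [transcendental_iff]
  intro p hp
  rw [← algebraMap_algebraMap_ratGen, map_eq_zero] at hp
  exact (map_eq_zero_iff _ (RatFunc.algebraMap_injective C)).1 hp

theorem exists_algebraMap_ratFunc_eq [CharZero C] [Algebra.IsAlgebraic (RatFunc C) K]
    [IsAlgClosed K] {y : K} (h : ∀ σ : K ≃ₐ[RatFunc C] K, σ y = y) :
    ∃ f : RatFunc C, algebraMap (RatFunc C) K f = y := by
  have : CharZero (RatFunc C) := algebraRat.charZero (RatFunc C)
  have : IsAlgClosure (RatFunc C) K := ⟨inferInstance, inferInstance⟩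
  have : IsGalois (RatFunc C) K := { }
  have := (InfiniteGalois.mem_bot_iff_fixed (k := RatFunc C) y).2 h
  simpa [IntermediateField.mem_bot] using this

variable [IsAlgClosed C]

theorem aeval_ratGen_eq (p : C[X]) :
    aeval (ratGen C K) p = algebraMap C K p.leadingCoeff *
      (p.roots.map fun r => ratGen C K - algebraMap C K r).prod := by
  conv_lhs => rw [(IsAlgClosed.splits p).eq_prod_roots]
  rw [map_mul, aeval_C, map_multiset_prod, Multiset.map_map]
  simp

/-- The order of a rational function at infinity is the same for all valuations. -/
theorem exists_degree (f : RatFunc C) (hf : f ≠ 0) :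
    ∃ n : ℤ, ∀ A : ValuationSubring K, TrivialOn C A.valuation → 1 < A.valuation (ratGen C K) →
      A.valuation (algebraMap (RatFunc C) K f) = A.valuation (ratGen C K) ^ n := by
  refine ⟨(f.num.roots.card : ℤ) - f.denom.roots.card, fun A ht hu => ?_⟩
  have key : ∀ p : C[X], p ≠ 0 → A.valuation (aeval (ratGen C K) p) =
      A.valuation (ratGen C K) ^ p.roots.card := by
    intro p hp
    rw [aeval_ratGen_eq, map_mul, ht _ (leadingCoeff_ne_zero.2 hp), one_mul, map_multiset_prod,
      Multiset.map_map]
    have : (A.valuation ∘ fun r => ratGen C K - algebraMap C K r) =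
        fun _ => A.valuation (ratGen C K) := by
      ext r
      exact Valuation.map_sub_eq_of_lt_left _ ((ht.le_one r).trans_lt hu)
    rw [this]
    simp
  have h0 : A.valuation (ratGen C K) ≠ 0 := (zero_lt_one.trans hu).ne'
  rw [← RatFunc.num_div_denom f, map_div₀, algebraMap_algebraMap_ratGen,
    algebraMap_algebraMap_ratGen, map_div₀, key _ (RatFunc.num_ne_zero hf),
    key _ (RatFunc.denom_ne_zero f), zpow_sub₀ h0, RatFunc.num_div_denom]
  simp

/-- A rational function without zeros and poles on the affine line is constant. -/
theorem exists_algebraMap_eq_of_forall_place (f : RatFunc C)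
    (hf : ∀ a : C, ∃ A : ValuationSubring K, TrivialOn C A.valuation ∧
      A.valuation (ratGen C K - algebraMap C K a) < 1 ∧
      A.valuation (algebraMap (RatFunc C) K f) = 1) :
    ∃ c : C, c ≠ 0 ∧ algebraMap (RatFunc C) K f = algebraMap C K c := by
  have hf0 : f ≠ 0 := by
    rintro rfl
    obtain ⟨A, -, -, h⟩ := hf 0
    simp at h
  have small : ∀ (A : ValuationSubring K) (a : C) (p : C[X]), TrivialOn C A.valuation →
      A.valuation (ratGen C K - algebraMap C K a) < 1 → p.IsRoot a →
      A.valuation (aeval (ratGen C K) p) < 1 := by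
    intro A a p ht ha hp
    obtain ⟨q, rfl⟩ := dvd_iff_isRoot.2 hp
    rw [map_mul, map_mul]
    have hu : A.valuation (ratGen C K) ≤ 1 := by
      have := A.valuation.map_add (ratGen C K - algebraMap C K a) (algebraMap C K a)
      rw [sub_add_cancel] at this
      exact this.trans (max_le ha.le (ht.le_one a))
    have hq : A.valuation (aeval (ratGen C K) q) ≤ 1 := by
      rw [aeval_eq_sum_range]
      refine A.valuation.map_sum_le fun i _ => ?_
      rw [Algebra.smul_def, map_mul, map_pow]
      exact mul_le_one' (ht.le_one _) (pow_le_one' hu _)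
    calc _ ≤ A.valuation (ratGen C K - algebraMap C K a) * 1 := by
          gcongr; simp
      _ < 1 := by simpa using ha
  have cop : ∀ (A : ValuationSubring K), TrivialOn C A.valuation →
      ∀ a, A.valuation (ratGen C K - algebraMap C K a) < 1 → ∀ p q : C[X], IsCoprime p q →
      p.IsRoot a → A.valuation (aeval (ratGen C K) q) = 1 := by
    intro A ht a ha p q hpq hp
    have hq : ¬ q.IsRoot a := by
      intro hq
      obtain ⟨x, y, hxy⟩ := hpq
      have := congrArg (eval a) hxy
      simp [hp.eq_zero, hq.eq_zero] at this
    have hr : HasResidue A.valuation (aeval (ratGen C K) q) (q.eval a) := by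
      have : aeval (ratGen C K) q - algebraMap C K (q.eval a) =
          aeval (ratGen C K) (q - Polynomial.C (q.eval a)) := by simp
      unfold HasResidue
      rw [this]
      exact small A a _ ht ha (by simp)
    exact hr.eq_one ht hq
  have hnum : f.num.natDegree = 0 := by
    by_contra h
    obtain ⟨a, ha⟩ := IsAlgClosed.exists_root f.num (by
      intro h'; exact h (natDegree_eq_of_degree_eq_some h'))
    obtain ⟨A, ht, hu, h1⟩ := hf a
    rw [← RatFunc.num_div_denom f, map_div₀, algebraMap_algebraMap_ratGen,
      algebraMap_algebraMap_ratGen, map_div₀,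
      cop A ht a hu _ _ (RatFunc.isCoprime_num_denom f) ha, div_one] at h1
    exact (small A a _ ht hu ha).ne h1
  have hden : f.denom.natDegree = 0 := by
    by_contra h
    obtain ⟨a, ha⟩ := IsAlgClosed.exists_root f.denom (by
      intro h'; exact h (natDegree_eq_of_degree_eq_some h'))
    obtain ⟨A, ht, hu, h1⟩ := hf a
    rw [← RatFunc.num_div_denom f, map_div₀, algebraMap_algebraMap_ratGen,
      algebraMap_algebraMap_ratGen, map_div₀,
      cop A ht a hu _ _ (RatFunc.isCoprime_num_denom f).symm ha, one_div, inv_eq_one] at h1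
    exact (small A a _ ht hu ha).ne h1
  rw [natDegree_eq_zero] at hnum hden
  obtain ⟨x, hx⟩ := hnum
  obtain ⟨y, hy⟩ := hden
  have hx0 : x ≠ 0 := by rintro rfl; exact RatFunc.num_ne_zero hf0 (by simpa using hx.symm)
  have hy0 : y ≠ 0 := by
    rintro rfl; exact RatFunc.denom_ne_zero f (by simpa using hy.symm)
  refine ⟨x / y, div_ne_zero hx0 hy0, ?_⟩
  rw [← RatFunc.num_div_denom f, map_div₀, algebraMap_algebraMap_ratGen,
    algebraMap_algebraMap_ratGen, ← hx, ← hy]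
  simp

end rational

section places

variable {κ F Γ : Type*} [Field κ] [Field F] [Algebra κ F]
  [LinearOrderedCommGroupWithZero Γ] {v : Valuation F Γ}

theorem IsAlgebraic.exists_algebraMap_eq [IsAlgClosed κ] {y : F} (h : IsAlgebraic κ y) :
    ∃ c : κ, algebraMap κ F c = y :=
  minpoly.mem_range_of_degree_eq_one κ y
    (IsAlgClosed.degree_eq_one_of_irreducible κ (minpoly.irreducible h.isIntegral))

theorem TrivialOn.gaussIndep {C η : Type*} [Field C] [Algebra C F] [Algebra κ C]
    [IsScalarTower κ C F] (hv : TrivialOn C v) {f : η → C} (hf : AlgebraicIndependent κ f) :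
    GaussIndep κ v fun i => algebraMap C F (f i) := by
  intro P hP
  have : MvPolynomial.aeval (fun i => algebraMap C F (f i)) P =
      algebraMap C F (MvPolynomial.aeval f P) := by
    exact MvPolynomial.aeval_algebraMap_apply (B := F) f P
  rw [this]
  exact hv _ fun h => hP (hf.eq_zero_of_aeval_eq_zero P h)

theorem valuation_bil_le_one (hv : TrivialOn κ v) {p q : Fin 3 → F} (hp : ∀ i, v (p i) ≤ 1)
    (hq : ∀ i, v (q i) ≤ 1) : v (bil p q) ≤ 1 := by
  have h2 : v 2 ≤ 1 := by simpa only [map_ofNat] using hv.le_one 2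
  have h (i j) : v (p i * q j) ≤ 1 := by rw [map_mul]; exact mul_le_one' (hp i) (hq j)
  have h' (i j) : v (2 * p i * q j) ≤ 1 := by
    rw [mul_assoc, map_mul]; exact mul_le_one' h2 (h i j)
  exact (v.map_sub _ _).trans (max_le ((v.map_sub _ _).trans (max_le (h 1 1) (h' 0 2))) (h' 2 0))

variable [CharZero κ] [CharZero F] {H : GeoGraph} {μ : Finset ℕ → F} {ρ : ℕ → Fin 3 → F} {k : κ}

theorem IsSol.exists_one_lt (hρ : IsSol H μ ρ) (hv : TrivialOn κ v)
    (hk : algebraMap κ F k = μ {1, 2})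
    (h : 1 < v (bil (ρ 0) (ρ 1)) ∨ 1 < v (bil (ρ 0) (ρ 2))) : ∃ i, 1 < v (ρ 0 i) := by
  by_contra! hcon
  have h1 : v (bil (ρ 0) (ρ 1)) ≤ 1 := by
    refine valuation_bil_le_one hv hcon fun i => ?_
    rw [hρ.one]
    fin_cases i <;> simp [basePoint]
  have h2 : v (bil (ρ 0) (ρ 2)) ≤ 1 := by
    refine valuation_bil_le_one hv hcon fun i => ?_
    rw [hρ.two, ← hk]
    have : secondPoint (algebraMap κ F k) i = algebraMap κ F (secondPoint k i) := by
      have htwo : algebraMap κ F 2 = 2 := map_ofNat _ 2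
      fin_cases i <;> simp [secondPoint, htwo]
    rw [this]
    exact hv.le_one _
  exact h.elim h1.not_gt h2.not_gt

/-- The behaviour of the diagonals of a calligraph where their sum is infinite. -/
theorem IsSol.place_types (hρ : IsSol H μ ρ) (hH : PreCalligraph H)
    (hg : GaussIndep κ v fun e : FreeEdge H => μ e.1) (hk : algebraMap κ F k = μ {1, 2})
    (hk1 : k ^ 2 ≠ 1) {u : F} (hu : bil (ρ 0) (ρ 1) + bil (ρ 0) (ρ 2) = u) (h1 : 1 < v u) :
    (∀ m n : κ, m ≠ 0 ∨ n ≠ 0 → v (algebraMap κ F m * bil (ρ 0) (ρ 1) +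
      algebraMap κ F n * bil (ρ 0) (ρ 2)) = v u) ∨
    (v (bil (ρ 0) (ρ 2)) = v u ∧ ∀ β : κ, v (bil (ρ 0) (ρ 1) - algebraMap κ F β) = 1) ∨
    (v (bil (ρ 0) (ρ 1)) = v u ∧ ∀ β : κ, v (bil (ρ 0) (ρ 2) - algebraMap κ F β) = 1) := by
  have hv : TrivialOn κ v := fun c hc => hg.trivial hc
  have hinf := hρ.exists_one_lt hv hk (by
    by_contra! h
    rw [← hu] at h1
    exact ((v.map_add _ _).trans (max_le h.1 h.2)).not_gt h1)
  rcases hρ.place_infinite hH hg hk hk1 hinf with ⟨ω, -, h⟩ | ⟨h, hβ⟩ | ⟨h, hβ⟩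
  · left
    have := h 1 1 (by simp)
    rw [map_one, one_mul, one_mul, hu] at this
    rwa [this]
  · right; left
    refine ⟨?_, hβ⟩
    rw [← hu, v.map_add_eq_of_lt_right]
    simpa using (hβ 0).trans_lt h
  · right; right
    refine ⟨?_, hβ⟩
    rw [← hu, v.map_add_eq_of_lt_left]
    simpa using (hβ 0).trans_lt h

theorem IsSol.diagonals_le_one (hρ : IsSol H μ ρ) (hH : PreCalligraph H)
    (hg : GaussIndep κ v fun e : FreeEdge H => μ e.1) (hk : algebraMap κ F k = μ {1, 2})
    (hk1 : k ^ 2 ≠ 1) {u : F} (hu : bil (ρ 0) (ρ 1) + bil (ρ 0) (ρ 2) = u) (h1 : v u ≤ 1) :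
    v (bil (ρ 0) (ρ 1)) ≤ 1 ∧ v (bil (ρ 0) (ρ 2)) ≤ 1 := by
  have hv : TrivialOn κ v := fun c hc => hg.trivial hc
  by_contra hcon
  have hinf := hρ.exists_one_lt hv hk (by rwa [not_and_or, not_le, not_le] at hcon)
  apply h1.not_gt
  rcases hρ.place_infinite hH hg hk hk1 hinf with ⟨ω, hω, h⟩ | ⟨h, hβ⟩ | ⟨h, hβ⟩
  · have := h 1 1 (by simp)
    rw [map_one, one_mul, one_mul, hu] at this
    rwa [this]
  · rw [← hu, v.map_add_eq_of_lt_right]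
    · exact h
    · simpa using (hβ 0).trans_lt h
  · rw [← hu, v.map_add_eq_of_lt_left]
    · exact h
    · simpa using (hβ 0).trans_lt h

/-- The order at infinity of the difference of the diagonals of two calligraphs. -/
theorem valuation_sub_at_infinity [IsAlgClosed κ] (hv : TrivialOn κ v) {u s t s' t' : F}
    (hu : Transcendental κ u) (h1 : 1 < v u) (hs : s + t = u) (hs' : s' + t' = u)
    (hal : IsAlgebraic (Algebra.adjoin κ {u}) t')
    (h : (∀ m n : κ, m ≠ 0 ∨ n ≠ 0 → v (algebraMap κ F m * s + algebraMap κ F n * t) = v u) ∨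
      (v t = v u ∧ ∀ β : κ, v (s - algebraMap κ F β) = 1) ∨
      (v s = v u ∧ ∀ β : κ, v (t - algebraMap κ F β) = 1))
    (h' : (v s' = v u ∧ v t' = v u) ∨ (v s' = 1 ∧ v t' = v u) ∨ (v s' = v u ∧ v t' = 1)) :
    v (t - t') = if v s ≤ 1 ∧ v s' ≤ 1 ∨ v t ≤ 1 ∧ v t' ≤ 1 then 1 else v u := by
  have hu0 : u ≠ 0 := by rintro rfl; simp at h1
  have hu1 : v u ≠ 1 := h1.ne'
  have hvu : v u ≠ 0 := by simpa using hu0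
  have halu : IsAlgebraic (Algebra.adjoin κ {u}) u :=
    isAlgebraic_algebraMap (⟨u, Algebra.self_mem_adjoin_singleton κ u⟩ : Algebra.adjoin κ {u})
  have e : t - t' = s' - s := by linear_combination hs - hs'
  rcases h with h | ⟨ht, hβ⟩ | ⟨hs1, hβ⟩
  · have e1 : v s = v u := by simpa using h 1 0 (by simp)
    have e2 : v t = v u := by simpa using h 0 1 (by simp)
    rw [if_neg (by simp [e1, e2, h1])]
    have hle : v t' ≤ v u := by
      rcases h' with h | h | h
      · exact h.2.le
      · exact h.2.le
      · exact h.2.le.trans h1.le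
    obtain ⟨r, hr⟩ := exists_residue hv hu hu0 hu1 halu (y := t' / u)
      (by rw [div_eq_mul_inv]; exact hal.mul halu.inv)
      (by rw [map_div₀]; exact (div_le_one₀ (by simpa [zero_lt_iff] using hvu)).2 hle)
    have hr' : v (t' - algebraMap κ F r * u) < v u := by
      have : t' - algebraMap κ F r * u = (t' / u - algebraMap κ F r) * u := by field_simp
      rw [this, map_mul]
      exact mul_lt_of_lt_one_left (by simpa [zero_lt_iff] using hvu) hr
    have h2 := h (-r) (1 - r) (by
      by_contra! hc
      have : r = 0 := by simpa using hc.1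
      simp [this] at hc)
    have : t - t' = (algebraMap κ F (-r) * s + algebraMap κ F (1 - r) * t) -
        (t' - algebraMap κ F r * u) := by
      simp only [map_neg, map_sub, map_one]; linear_combination (algebraMap κ F r) * hs
    rw [this, v.map_sub_eq_of_lt_left (by rwa [h2]), h2]
  · have hs0 : v s = 1 := by simpa using hβ 0
    rw [e]
    rcases h' with ⟨h2, h3⟩ | ⟨h2, h3⟩ | ⟨h2, h3⟩
    · rw [if_neg (by simp [h2, h3, h1]), v.map_sub_eq_of_lt_left (by rwa [hs0, h2]), h2]
    · rw [if_pos (by simp [hs0, h2])]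
      obtain ⟨r, hr⟩ := exists_residue hv hu hu0 hu1 halu (y := s')
        (by
          have : s' = u - t' := by linear_combination hs'
          rw [this]; exact halu.sub hal) h2.le
      have : s' - s = (s' - algebraMap κ F r) - (s - algebraMap κ F r) := by ring
      rw [this, v.map_sub_eq_of_lt_right (by rwa [hβ]), hβ]
    · rw [if_neg (by simp [h2, ht, h1]), v.map_sub_eq_of_lt_left (by rwa [hs0, h2]), h2]
  · have ht0 : v t = 1 := by simpa using hβ 0
    rcases h' with ⟨h2, h3⟩ | ⟨h2, h3⟩ | ⟨h2, h3⟩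
    · rw [if_neg (by simp [h2, h3, h1]), v.map_sub_eq_of_lt_right (by rwa [ht0, h3]), h3]
    · rw [if_neg (by simp [hs1, h3, h1]), v.map_sub_eq_of_lt_right (by rwa [ht0, h3]), h3]
    · rw [if_pos (by simp [ht0, h3])]
      obtain ⟨r, hr⟩ := exists_residue hv hu hu0 hu1 halu (y := t') hal h3.le
      have : t - t' = (t - algebraMap κ F r) - (t' - algebraMap κ F r) := by ring
      rw [this, v.map_sub_eq_of_lt_left (by rwa [hβ]), hβ]

/-- At a place over a point of `κ` the diagonals of two calligraphs do not meet. -/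
theorem IsSol.valuation_sub_at_special [IsAlgClosed κ] (hρ : IsSol H μ ρ) (hH : PreCalligraph H)
    (hg : GaussIndep κ v fun e : FreeEdge H => μ e.1) (hk : algebraMap κ F k = μ {1, 2})
    (hk1 : k ^ 2 ≠ 1) {u t : F} (hu : Transcendental κ u) {a : κ}
    (ha : HasResidue v u a) (h1 : bil (ρ 0) (ρ 1) + bil (ρ 0) (ρ 2) = u)
    (hal : IsAlgebraic (Algebra.adjoin κ {u}) t) (ht : v t ≤ 1) :
    ¬ v (bil (ρ 0) (ρ 2) - t) < 1 := by
  intro hlt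
  have hv : TrivialOn κ v := fun c hc => hg.trivial hc
  have halu : IsAlgebraic (Algebra.adjoin κ {u}) (u - algebraMap κ F a) :=
    (isAlgebraic_algebraMap (⟨u, Algebra.self_mem_adjoin_singleton κ u⟩ : Algebra.adjoin κ {u})).sub
      (isAlgebraic_algebraMap (algebraMap κ (Algebra.adjoin κ {u}) a))
  obtain ⟨β, hβ⟩ := exists_residue hv hu (z := u - algebraMap κ F a) (by
    intro h0
    rw [sub_eq_zero] at h0
    exact hu (h0 ▸ isAlgebraic_algebraMap a)) ha.ne halu hal ht
  have r2 : HasResidue v (bil (ρ 0) (ρ 2)) β := by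
    have : bil (ρ 0) (ρ 2) - algebraMap κ F β = (bil (ρ 0) (ρ 2) - t) + (t - algebraMap κ F β) := by
      ring
    unfold HasResidue
    rw [this]
    exact (v.map_add _ _).trans_lt (max_lt hlt hβ)
  have r1 : HasResidue v (bil (ρ 0) (ρ 1)) (a - β) := by
    have := ha.sub r2
    rwa [← h1, add_sub_cancel_right] at this
  exact hρ.place_finite hH hg hk hk1 r1 r2

/-- The diagonals of a realization whose section is in `κ` are in `κ`. -/
theorem IsSol.isAlgebraic_diagonals {κ₀ : Type*} [Field κ₀] [CharZero κ₀] [Algebra κ₀ κ]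
    [Algebra κ₀ F] [IsScalarTower κ₀ κ F] [IsAlgClosed κ] (hρ : IsSol H μ ρ) (hH : PreCalligraph H)
    {m : FreeEdge H → κ} (hm : ∀ e, algebraMap κ F (m e) = μ e.1) (hi : AlgebraicIndependent κ₀ m)
    {k : κ₀} (hk : algebraMap κ₀ F k = μ {1, 2}) (hk1 : k ^ 2 ≠ 1) {a : κ}
    (ha : bil (ρ 0) (ρ 1) + bil (ρ 0) (ρ 2) = algebraMap κ F a) :
    ∃ α β : κ, bil (ρ 0) (ρ 1) = algebraMap κ F α ∧ bil (ρ 0) (ρ 2) = algebraMap κ F β := by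
  have main (A : ValuationSubring F) (hA : TrivialOn κ A.valuation) :
      A.valuation (bil (ρ 0) (ρ 1)) ≤ 1 ∧ A.valuation (bil (ρ 0) (ρ 2)) ≤ 1 :=
    hρ.diagonals_le_one hH (funext hm ▸ hA.gaussIndep hi) hk hk1 ha (hA.le_one a)
  have key (y : F) (hy : ∀ A : ValuationSubring F, TrivialOn κ A.valuation → A.valuation y ≤ 1) :
      ∃ c : κ, y = algebraMap κ F c := by
    by_contra hcon
    have hyt : Transcendental κ y := by
      intro h
      obtain ⟨c, hc⟩ := h.exists_algebraMap_eq
      exact hcon ⟨c, hc.symm⟩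
    obtain ⟨A, hA, h1⟩ := exists_valuationSubring_lt_one (y :=
        y⁻¹) (fun h => hyt (inv_inv y ▸ h.inv))
    have := hy A hA
    rw [map_inv₀, inv_lt_one₀] at h1
    · exact this.not_gt h1
    · rw [zero_lt_iff]; simp; rintro rfl; exact hcon ⟨0, by simp⟩
  obtain ⟨α, hα⟩ := key _ fun A hA => (main A hA).1
  obtain ⟨β, hβ⟩ := key _ fun A hA => (main A hA).2
  exact ⟨α, β, hα, hβ⟩

end places

section generic

variable {κ C K Γ : Type*} [Field κ] [Field C] [Field K] [Algebra κ C] [Algebra C K] [Algebra κ K]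
  [IsScalarTower κ C K] [IsAlgClosed κ] [LinearOrderedCommGroupWithZero Γ] {v : Valuation K Γ}
  {u : K} {a : C}

theorem HasResidue.eq_one_of_isAlgebraic (ha : HasResidue v u a) (hv : TrivialOn C v)
    (hat : Transcendental κ a) {y : K} (hy : IsAlgebraic (Algebra.adjoin κ {u}) y) (h0 : y ≠ 0) :
    v y = 1 := by
  refine eq_one_of_residually_transcendental (hv.tower (κ' := κ)) (y := u) (fun c => ?_) h0 hy
  have hac : a - algebraMap κ C c ≠ 0 := by
    intro h
    rw [sub_eq_zero] at h
    exact hat (h ▸ isAlgebraic_algebraMap c)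
  have e : u - algebraMap κ K c = (u - algebraMap C K a) + algebraMap C K (a - algebraMap κ C c) :=
      by
    rw [map_sub, ← IsScalarTower.algebraMap_apply]; ring
  rw [e, v.map_add_eq_of_lt_right, hv _ hac]
  rw [hv _ hac]; exact ha

theorem HasResidue.eq_zero_of_isAlgebraic (ha : HasResidue v u a) (hv : TrivialOn C v)
    (hat : Transcendental κ a) {y : K} (hy : IsAlgebraic (Algebra.adjoin κ {u}) y) (h0 : v y < 1) :
    y = 0 := by
  by_contra h
  exact h0.ne (ha.eq_one_of_isAlgebraic hv hat hy h)

theorem HasResidue.le_one_of_isAlgebraic (ha : HasResidue v u a) (hv : TrivialOn C v)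
    (hat : Transcendental κ a) {y : K} (hy : IsAlgebraic (Algebra.adjoin κ {u}) y) : v y ≤ 1 := by
  by_cases h : y = 0
  · simp [h]
  · exact (ha.eq_one_of_isAlgebraic hv hat hy h).le

theorem IsAlgebraic.adjoin_tower {y : K} (hy : IsAlgebraic (Algebra.adjoin κ {u}) y) :
    IsAlgebraic (Algebra.adjoin C {u}) y := by
  have hle : Algebra.adjoin κ {u} ≤ (Algebra.adjoin C {u}).restrictScalars κ := by
    rw [Algebra.adjoin_le_iff]
    rintro _ rfl
    exact Algebra.self_mem_adjoin_singleton C _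
  exact hy.ringHom_of_comp_eq (Subalgebra.inclusion hle) (RingHom.id K)
    (Subalgebra.inclusion_injective hle) rfl

variable [IsAlgClosed C]

theorem HasResidue.exists_residue (ha : HasResidue v u a) (hv : TrivialOn C v)
    (hu : Transcendental C u) {y : K} (hy : IsAlgebraic (Algebra.adjoin C {u}) y) (h : v y ≤ 1) :
    ∃ c : C, HasResidue v y c :=
  _root_.exists_residue hv hu (z := u - algebraMap C K a) (by
    intro h0
    rw [sub_eq_zero] at h0
    exact hu (h0 ▸ isAlgebraic_algebraMap a)) ha.ne
    ((isAlgebraic_algebraMap (⟨u, Algebra.self_mem_adjoin_singleton C u⟩ : Algebra.adjoin C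
        {u})).sub
      (isAlgebraic_algebraMap (algebraMap C (Algebra.adjoin C {u}) a))) hy h

/-- The residue map on the elements algebraic over `κ(u)`. -/
theorem HasResidue.exists_ringHom [IsAlgClosed K] (ha : HasResidue v u a) (hv : TrivialOn C v)
    (hat : Transcendental κ a) (hu : Transcendental C u) :
    ∃ φ : algebraicClosure (IntermediateField.adjoin κ {u}) K →+* C,
      (∀ y : algebraicClosure (IntermediateField.adjoin κ {u}) K, HasResidue v (y : K) (φ y)) ∧
      ∀ c : C, IsAlgebraic (Algebra.adjoin κ {a}) c → c ∈ φ.range := by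
  set W := algebraicClosure (IntermediateField.adjoin κ {u}) K with hW
  have hWa (y : W) : IsAlgebraic (Algebra.adjoin κ {u}) (y : K) := by
    rw [← IntermediateField.isAlgebraic_adjoin_iff]
    exact mem_algebraicClosure_iff.1 y.2
  have hle (y : W) : v (y : K) ≤ 1 := ha.le_one_of_isAlgebraic hv hat (hWa y)
  choose f hf using fun y : W => ha.exists_residue hv hu (hWa y).adjoin_tower (hle y)
  let φ : W →+* C :=
    { toFun := f
      map_one' := (hf 1).unique hv (by simpa using HasResidue.const v (1 : C))
      map_zero' := (hf 0).unique hv (by simpa using HasResidue.const v (0 : C))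
      map_add' := fun x y => (hf (x + y)).unique hv ((hf x).add (hf y))
      map_mul' := fun x y => (hf (x * y)).unique hv ((hf x).mul hv (hf y)) }
  refine ⟨φ, hf, fun c hc => ?_⟩
  let _ : Algebra W C := φ.toAlgebra
  have : IsAlgClosed W := (algebraicClosure.isAlgClosure _ K).isAlgClosed
  have huW : u ∈ W := by
    rw [hW, mem_algebraicClosure_iff]
    exact isAlgebraic_algebraMap
      (⟨u, IntermediateField.mem_adjoin_simple_self κ u⟩ : IntermediateField.adjoin κ {u})
  have hκW (x : κ) : algebraMap κ K x ∈ W := by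
    rw [hW, mem_algebraicClosure_iff]
    exact isAlgebraic_algebraMap (algebraMap κ (IntermediateField.adjoin κ {u}) x)
  let g : Algebra.adjoin κ {a} →+* φ.range := (algebraMap (Algebra.adjoin κ {a}) C).codRestrict
      φ.range
    (by
      rintro ⟨x, hx⟩
      change x ∈ φ.range
      induction hx using Algebra.adjoin_induction with
      | mem x hx =>
        rw [Set.mem_singleton_iff] at hx
        subst hx
        exact ⟨⟨u, huW⟩, (hf ⟨u, huW⟩).unique hv ha⟩
      | algebraMap r =>
        refine ⟨⟨_, hκW r⟩, (hf ⟨_, hκW r⟩).unique hv ?_⟩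
        have := HasResidue.const v (algebraMap κ C r)
        rwa [← IsScalarTower.algebraMap_apply] at this
      | add x y _ _ hx hy => exact add_mem hx hy
      | mul x y _ _ hx hy => exact mul_mem hx hy)
  have h1 : IsAlgebraic φ.range c :=
    hc.ringHom_of_comp_eq g (RingHom.id C) (fun x y h => Subtype.ext (congrArg (fun z : φ.range =>
        (z : C)) h)) rfl
  have h2 : IsAlgebraic W c :=
    h1.of_ringHom_of_comp_eq φ.rangeRestrict (RingHom.id C) φ.rangeRestrict_surjective
      Function.injective_id rfl
  obtain ⟨w, hw⟩ := h2.exists_algebraMap_eq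
  exact ⟨w, hw⟩

end generic

section transport

variable {H : GeoGraph}

theorem IsSol.congr {F : Type*} [Field F] {μ ν : Finset ℕ → F} {ρ : ℕ → Fin 3 → F}
    (h : IsSol H μ ρ) (h12 : {1, 2} ∈ H.E) (he : ∀ e ∈ H.E, μ e = ν e) : IsSol H ν ρ :=
  ⟨h.off, h.one, he _ h12 ▸ h.two, h.sph, fun u w huw => he _ huw ▸ h.edge u w huw⟩

theorem map_basePoint_apply {F F' : Type*} [Field F] [Field F'] (φ : F →+* F') (i : Fin 3) :
    φ (basePoint i) = basePoint i := by
  fin_cases i <;> simp [basePoint]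

theorem map_secondPoint_apply {F F' : Type*} [Field F] [Field F'] (φ : F →+* F') (k : F)
    (i : Fin 3) : φ (secondPoint k i) = secondPoint (φ k) i := by
  have htwo : φ 2 = 2 := map_ofNat _ 2
  fin_cases i <;> simp [secondPoint, htwo]

theorem isSol_map_iff {F F' : Type*} [Field F] [Field F'] (φ : F →+* F') {μ : Finset ℕ → F}
    {ρ : ℕ → Fin 3 → F} :
    IsSol H (fun e => φ (μ e)) (fun w i => φ (ρ w i)) ↔ IsSol H μ ρ := by
  have hb (p q : Fin 3 → F) : bil (fun i => φ (p i)) (fun i => φ (q i)) = φ (bil p q) :=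
    (map_bil φ p q).symm
  constructor
  · intro h
    refine ⟨fun w hw => ?_, ?_, ?_, fun w hw => φ.injective ?_, fun u w huw => φ.injective ?_⟩
    · ext i
      exact φ.injective ((congrFun (h.off w hw) i).trans (map_zero φ).symm)
    · ext i
      exact φ.injective ((congrFun h.one i).trans (map_basePoint_apply φ i).symm)
    · ext i
      exact φ.injective ((congrFun h.two i).trans (map_secondPoint_apply φ _ i).symm)
    · rw [map_one, ← h.sph w hw, hb]
    · rw [← h.edge u w huw, hb]
  · intro h
    refine ⟨fun w hw => ?_, ?_, ?_, fun w hw => ?_, fun u w huw => ?_⟩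
    · ext i
      simp [h.off w hw]
    · ext i
      rw [h.one, map_basePoint_apply]
    · ext i
      rw [h.two, map_secondPoint_apply]
    · rw [hb, h.sph w hw, map_one]
    · rw [hb, h.edge u w huw]

end transport

section algebraic

variable {κ₀ κ F : Type*} [Field κ₀] [Field κ] [Field F] [Algebra κ₀ κ] [Algebra κ₀ F]
  [Algebra κ F] [IsScalarTower κ₀ κ F] [CharZero F] {H : GeoGraph} {μ : Finset ℕ → F}
  {ρ : ℕ → Fin 3 → F} {u : F}

theorem IsSol.section_isAlgebraic_adjoin (h : IsSol H μ ρ) (hH : PreCalligraph H) {k : κ₀}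
    (hk : algebraMap κ₀ F k = μ {1, 2}) (hu : bil (ρ 0) (ρ 1) + bil (ρ 0) (ρ 2) = u)
    (hm : ∀ e : FreeEdge H, μ e.1 ∈ Set.range (algebraMap κ F))
    (hi : AlgebraicIndependent κ₀ fun e : FreeEdge H => μ e.1) (hut : Transcendental κ u)
    (w : ℕ) (i : Fin 3) : IsAlgebraic (Algebra.adjoin κ {u}) (ρ w i) :=
  (h.section_isAlgebraic hH hk hu (hi.option_of_transcendental hm hut) w
      i).adjoin_singleton_of_option
    hm

end algebraic

/-- The edge data `μ` of the calligraph `H` are generic over `κ₀` and defined over `κ`. -/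
structure GenericOver (κ₀ κ : Type*) {C : Type*} [Field κ₀] [Field κ] [Field C] [Algebra κ₀ C]
    [Algebra κ C] (H : GeoGraph) (μ : Finset ℕ → C) (k : κ₀) : Prop where
  pre : PreCalligraph H
  base : algebraMap κ₀ C k = μ {1, 2}
  ne : k ^ 2 ≠ 1
  mem : ∀ e ∈ H.E, μ e ∈ Set.range (algebraMap κ C)
  indep : AlgebraicIndependent κ₀ fun e : FreeEdge H => μ e.1

/-- The edge data `μ` mapped to an extension field. -/
def liftEdge {C : Type*} (K : Type*) [Field C] [Field K] [Algebra C K] (μ : Finset ℕ → C) :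
    Finset ℕ → K := fun e => algebraMap C K (μ e)

/-- The realizations where the sum of the diagonals at `0` is `u`. -/
def sectionSet {F : Type*} [Field F] (H : GeoGraph) (μ : Finset ℕ → F) (u : F) :
    Set (ℕ → Fin 3 → F) :=
  {ρ | IsSol H μ ρ ∧ bil (ρ 0) (ρ 1) + bil (ρ 0) (ρ 2) = u}

theorem HasResidue.bil {C F Γ : Type*} [Field C] [Field F] [Algebra C F]
    [LinearOrderedCommGroupWithZero Γ] {v : Valuation F Γ} (hv : TrivialOn C v) {p q : Fin 3 → F}
    {p' q' : Fin 3 → C} (hp : ∀ i, HasResidue v (p i) (p' i)) (hq : ∀ i,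
        HasResidue v (q i) (q' i)) :
    HasResidue v (bil p q) (bil p' q') := by
  have h2 : HasResidue v (2 : F) (2 : C) := by
    have := HasResidue.const v (2 : C)
    rwa [map_ofNat] at this
  exact ((((hp 1).mul hv (hq 1)).sub ((h2.mul hv (hp 0)).mul hv (hq 2)))).sub
    ((h2.mul hv (hp 2)).mul hv (hq 0))

namespace GenericOver

variable {κ₀ κ C K Γ : Type*} [Field κ₀] [Field κ] [Field C] [Field K] [Algebra κ₀ κ]
  [Algebra κ₀ C] [Algebra κ C] [Algebra C K] [Algebra κ₀ K] [Algebra κ K]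
  [IsScalarTower κ₀ κ C] [IsScalarTower κ₀ C K] [IsScalarTower κ₀ κ K] [IsScalarTower κ C K]
  {H : GeoGraph} {μ : Finset ℕ → C} {k : κ₀}

theorem algebraMap_base (h : GenericOver κ₀ κ H μ k) :
    algebraMap κ₀ K k = liftEdge K μ {1, 2} := by
  rw [IsScalarTower.algebraMap_apply κ₀ C K, h.base]; rfl

theorem mem_lift (h : GenericOver κ₀ κ H μ k) {e : Finset ℕ} (he : e ∈ H.E) :
    liftEdge K μ e ∈ Set.range (algebraMap κ K) := by
  obtain ⟨c, hc⟩ := h.mem e he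
  exact ⟨c, by rw [IsScalarTower.algebraMap_apply κ C K, hc]; rfl⟩

theorem indep_lift (h : GenericOver κ₀ κ H μ k) :
    AlgebraicIndependent κ₀ fun e : FreeEdge H => liftEdge K μ e.1 :=
  h.indep.map' (f := IsScalarTower.toAlgHom κ₀ C K) (algebraMap C K).injective

variable [CharZero K] {u : K} {ρ : ℕ → Fin 3 → K}

theorem isAlgebraic (h : GenericOver κ₀ κ H μ k) (hu : Transcendental κ u)
    (hρ : ρ ∈ sectionSet H (liftEdge K μ) u) (w : ℕ) (i : Fin 3) :
    IsAlgebraic (Algebra.adjoin κ {u}) (ρ w i) :=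
  hρ.1.section_isAlgebraic_adjoin h.pre h.algebraMap_base hρ.2
    (fun e => h.mem_lift e.2.1) h.indep_lift hu w i

theorem isAlgebraic_self [CharZero C] {a : C} {ρ : ℕ → Fin 3 → C} (h : GenericOver κ₀ κ H μ k)
    (hu : Transcendental κ a) (hρ : ρ ∈ sectionSet H μ a) (w : ℕ) (i : Fin 3) :
    IsAlgebraic (Algebra.adjoin κ {a}) (ρ w i) :=
  hρ.1.section_isAlgebraic_adjoin h.pre h.base hρ.2
    (fun e => h.mem _ e.2.1) h.indep hu w i

theorem finite_sectionSet (h : GenericOver κ₀ κ H μ k) (hu : Transcendental κ u) :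
    (sectionSet H (liftEdge K μ) u).Finite :=
  h.pre.finite_section h.algebraMap_base
    (h.indep_lift.option_of_transcendental (fun e => h.mem_lift e.2.1) hu)

variable [LinearOrderedCommGroupWithZero Γ] {v : Valuation K Γ} {a : C} [IsAlgClosed κ]
  [IsAlgClosed C] [IsAlgClosed K]

theorem _root_.IsAlgebraic.bil {R F : Type*} [CommRing R] [Field F] [Algebra R F] [IsDomain R]
    [FaithfulSMul R F] {p q : Fin 3 → F} (hp : ∀ i, IsAlgebraic R (p i))
    (hq : ∀ i, IsAlgebraic R (q i)) : IsAlgebraic R (bil p q) := by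
  have h2 : IsAlgebraic R (2 : F) := by
    have := isAlgebraic_algebraMap (R := R) (A := F) 2
    rwa [map_ofNat] at this
  exact (((hp 1).mul (hq 1)).sub ((h2.mul (hp 0)).mul (hq 2))).sub ((h2.mul (hp 2)).mul (hq 0))

theorem exists_residue (h : GenericOver κ₀ κ H μ k) (hu : Transcendental C u)
    (ha : HasResidue v u a) (hv : TrivialOn C v) (hat : Transcendental κ a)
    (hρ : ρ ∈ sectionSet H (liftEdge K μ) u) :
    ∃ ρ' ∈ sectionSet H μ a, ∀ w i, HasResidue v (ρ w i) (ρ' w i) := by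
  have huκ : Transcendental κ u := hu.of_tower_top κ
  have hal := h.isAlgebraic huκ hρ
  choose ρ' hρ' using fun w i => ha.exists_residue hv hu (hal w i).adjoin_tower
    (ha.le_one_of_isAlgebraic hv hat (hal w i))
  have hb (w x) : HasResidue v (bil (ρ w) (ρ x)) (bil (ρ' w) (ρ' x)) :=
    HasResidue.bil hv (hρ' w) (hρ' x)
  refine ⟨ρ', ⟨⟨fun w hw => ?_, ?_, ?_, fun w hw => ?_, fun x w hxw => ?_⟩, ?_⟩, hρ'⟩
  · ext i
    refine (hρ' w i).unique hv ?_
    rw [hρ.1.off w hw]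
    simpa using HasResidue.const v (0 : C)
  · ext i
    refine (hρ' 1 i).unique hv ?_
    rw [hρ.1.one, ← map_basePoint_apply (algebraMap C K)]
    exact HasResidue.const v _
  · ext i
    refine (hρ' 2 i).unique hv ?_
    rw [hρ.1.two, liftEdge, ← map_secondPoint_apply (algebraMap C K)]
    exact HasResidue.const v _
  · refine (hb w w).unique hv ?_
    rw [hρ.1.sph w hw]
    simpa using HasResidue.const v (1 : C)
  · refine (hb x w).unique hv ?_
    rw [hρ.1.edge x w hxw]
    exact HasResidue.const v _
  · have := (hb 0 1).add (hb 0 2)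
    rw [hρ.2] at this
    exact this.unique hv ha

theorem eq_of_residue (h : GenericOver κ₀ κ H μ k) (hu : Transcendental C u)
    (ha : HasResidue v u a) (hv : TrivialOn C v) (hat : Transcendental κ a)
    (hρ : ρ ∈ sectionSet H (liftEdge K μ) u) {ρ' : ℕ → Fin 3 → K}
    (hρ' : ρ' ∈ sectionSet H (liftEdge K μ) u) {r : ℕ → Fin 3 → C}
    (hr : ∀ w i, HasResidue v (ρ w i) (r w i)) (hr' : ∀ w i, HasResidue v (ρ' w i) (r w i)) :
    ρ = ρ' := by
  have huκ : Transcendental κ u := hu.of_tower_top κ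
  ext w i
  rw [← sub_eq_zero]
  refine ha.eq_zero_of_isAlgebraic hv hat
    ((h.isAlgebraic huκ hρ w i).sub (h.isAlgebraic huκ hρ' w i)) ?_
  have := (hr w i).sub (hr' w i)
  rwa [sub_self, HasResidue, map_zero, sub_zero] at this

theorem exists_lift (h : GenericOver κ₀ κ H μ k) [CharZero C] (hu : Transcendental C u)
    (ha : HasResidue v u a) (hv : TrivialOn C v) (hat : Transcendental κ a)
    {r : ℕ → Fin 3 → C} (hr : r ∈ sectionSet H μ a) :
    ∃ ρ ∈ sectionSet H (liftEdge K μ) u, ∀ w i, HasResidue v (ρ w i) (r w i) := by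
  obtain ⟨φ, hφ, hsurj⟩ := ha.exists_ringHom hv hat hu
  choose ρ hρ using fun w i => hsurj _ (h.isAlgebraic_self hat hr w i)
  have huW : u ∈ algebraicClosure (IntermediateField.adjoin κ {u}) K :=
      mem_algebraicClosure_iff.2 (isAlgebraic_algebraMap
      (⟨u, IntermediateField.mem_adjoin_simple_self κ u⟩ : IntermediateField.adjoin κ {u}))
  have hκW (x : κ) : algebraMap κ K x ∈ algebraicClosure (IntermediateField.adjoin κ {u}) K :=
    mem_algebraicClosure_iff.2
      (isAlgebraic_algebraMap (algebraMap κ (IntermediateField.adjoin κ {u}) x))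
  have hμW (e) (he : e ∈ H.E) : ∃ y : algebraicClosure (IntermediateField.adjoin κ {u}) K,
      (y : K) = liftEdge K μ e := by
    obtain ⟨c, hc⟩ := h.mem_lift (K := K) he
    exact ⟨⟨_, hκW c⟩, hc⟩
  classical
  let ν : Finset ℕ → algebraicClosure (IntermediateField.adjoin κ {u}) K :=
      fun e => if he : e ∈ H.E then (hμW e he).choose else 0
  have hν (e) (he : e ∈ H.E) : (ν e : K) = liftEdge K μ e := by
    simp only [ν, dif_pos he]; exact (hμW e he).choose_spec
  have hν' (e) (he : e ∈ H.E) : φ (ν e) = μ e := by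
    refine (hφ _).unique hv ?_
    rw [hν e he]
    exact HasResidue.const v _
  have h1 : IsSol H ν ρ := by
    rw [← isSol_map_iff φ]
    have : (fun w i => φ (ρ w i)) = r := by ext w i; exact hρ w i
    rw [this]
    exact hr.1.congr h.pre.mem fun e he => (hν' e he).symm
  have h2 : bil (ρ 0) (ρ 1) + bil (ρ 0) (ρ 2) = ⟨u, huW⟩ := by
    apply φ.injective
    rw [map_add, map_bil, map_bil]
    simp only [hρ]
    rw [(hφ ⟨u, huW⟩).unique hv ha]
    exact hr.2
  refine ⟨fun w i => (ρ w i : K), ⟨?_, ?_⟩, fun w i => hρ w i ▸ hφ _⟩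
  · exact ((isSol_map_iff (algebraicClosure (IntermediateField.adjoin κ {u}) K).val.toRingHom).2
        h1).congr h.pre.mem hν
  · have := congrArg (algebraicClosure (IntermediateField.adjoin κ {u}) K).val h2
    rw [map_add, map_bil, map_bil] at this
    exact this

end GenericOver

/-- A realization mapped to an extension field. -/
def liftReal {C : Type*} (K : Type*) [Field C] [Field K] [Algebra C K] (r : ℕ → Fin 3 → C) :
    ℕ → Fin 3 → K := fun w i => algebraMap C K (r w i)

section lift

variable {C K : Type*} [Field C] [Field K] [Algebra C K] {H : GeoGraph} {μ : Finset ℕ → C}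
  {r : ℕ → Fin 3 → C}

theorem bil_liftReal (w x : ℕ) :
    bil (liftReal K r w) (liftReal K r x) = algebraMap C K (bil (r w) (r x)) :=
  (map_bil (algebraMap C K) _ _).symm

theorem pairing_liftReal (c : ℕ × Finset ℕ) :
    pairing (liftReal K r) c = algebraMap C K (pairing r c) := by
  simp only [pairing, map_sum, bil_liftReal]

theorem IsSol.liftReal (h : IsSol H μ r) : IsSol H (liftEdge K μ) (liftReal K r) :=
  (isSol_map_iff (algebraMap C K)).2 h

end lift

section exact

variable {κ₀ κ C K Γ : Type*} [Field κ₀] [Field κ] [Field C] [Field K] [Algebra κ₀ κ]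
  [Algebra κ₀ C] [Algebra κ C] [Algebra C K] [Algebra κ₀ K] [Algebra κ K]
  [IsScalarTower κ₀ κ C] [IsScalarTower κ₀ C K] [IsScalarTower κ₀ κ K] [IsScalarTower κ C K]
  {H : GeoGraph} {μ : Finset ℕ → C} {k : κ₀} [CharZero κ₀] [CharZero C] [CharZero K]
  [LinearOrderedCommGroupWithZero Γ] {v : Valuation K Γ} {a : C} {u : K}
  {ρ : ℕ → Fin 3 → K} {r : ℕ → Fin 3 → C}

theorem GenericOver.diagonal_sub_le (h : GenericOver κ₀ κ H μ k)
    (ha : HasResidue v u a) (hv : TrivialOn C v) (hat : Transcendental κ a)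
    (hρ : ρ ∈ sectionSet H (liftEdge K μ) u) (hr : r ∈ sectionSet H μ a)
    (hρr : ∀ w i, HasResidue v (ρ w i) (r w i)) :
    v (bil (ρ 0) (ρ 2) - algebraMap C K (bil (r 0) (r 2))) ≤ v (u - algebraMap C K a) := by
  have hc : IsConf H.V (algebraMap κ₀ K k) ρ := h.algebraMap_base (K := K) ▸ hρ.1.conf
  have hc' : IsConf H.V (algebraMap κ₀ K k) (liftReal K r) :=
    h.algebraMap_base (K := K) ▸ hr.1.liftReal.conf
  have hind : AlgebraicIndependent κ₀ fun o : Option (FreeEdge H) => pairing r (sectionPair o) := by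
    rw [funext (hr.1.pairing_sectionPair hr.2)]
    exact h.indep.option_of_transcendental (fun e => h.mem _ e.2.1) hat
  have hg : GaussIndep κ₀ v fun o : Option (FreeEdge H) => pairing (liftReal K r) (sectionPair o) :=
      by
    simp only [pairing_liftReal]
    exact hv.gaussIndep hind
  have key := hc.pairing_sub_le hc' h.pre.one_mem h.pre.two_mem h.pre.card_section hg ha
    (d := (0, {2})) (fun o => by
      rw [pairing_liftReal, hρ.1.pairing_sectionPair hρ.2, hr.1.pairing_sectionPair hr.2]
      cases o with
      | none => exact le_rfl
      | some e => simp [liftEdge]) (by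
      rw [pairing_liftReal]
      simp only [pairing, Finset.sum_singleton]
      exact HasResidue.bil hv (hρr 0) (hρr 2))
  rw [pairing_liftReal] at key
  simpa [pairing] using key

end exact

/-- Generic edge data on a graph with a calligraphic split, where the data of the two parts are
defined over `κ₁` and `κ₂`. -/
structure GenericSplit (κ₀ κ₁ κ₂ : Type*) {C : Type*} [Field κ₀] [Field κ₁] [Field κ₂] [Field C]
    [Algebra κ₀ C] [Algebra κ₁ C] [Algebra κ₂ C] (G H₁ H₂ : GeoGraph) (μ : Finset ℕ → C)
    (k : κ₀) : Prop where
  fst : GenericOver κ₀ κ₁ H₁ μ k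
  snd : GenericOver κ₀ κ₂ H₂ μ k
  indep_fst : AlgebraicIndependent κ₂ fun e : FreeEdge H₁ => μ e.1
  indep_snd : AlgebraicIndependent κ₁ fun e : FreeEdge H₂ => μ e.1
  split : IsSplit G H₁ H₂
  tight : G.E.card = 2 * G.V.card - 3
  indep : AlgebraicIndependent κ₀ fun e : FreeEdge G => μ e.1

/-- Glue realizations of the two parts of a split. -/
def glue {F : Type*} (H : GeoGraph) (ρ ρ' : ℕ → Fin 3 → F) : ℕ → Fin 3 → F :=
  fun w => if w ∈ H.V then ρ w else ρ' w

namespace IsSplit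

variable {G H₁ H₂ : GeoGraph} {F : Type*} [Field F] {μ : Finset ℕ → F} {ρ ρ' : ℕ → Fin 3 → F}

theorem mem_iff (h : IsSplit G H₁ H₂) {w : ℕ} : w ∈ G.V ↔ w ∈ H₁.V ∨ w ∈ H₂.V := by
  rw [h.1, Finset.mem_union]

theorem eq_of_mem (h : IsSplit G H₁ H₂) {w : ℕ} (h1 : w ∈ H₁.V) (h2 : w ∈ H₂.V) :
    w = 0 ∨ w = 1 ∨ w = 2 := by
  have : w ∈ H₁.V ∩ H₂.V := Finset.mem_inter.2 ⟨h1, h2⟩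
  rw [h.2.2.1] at this
  simpa using this

theorem mem_edge_iff (h : IsSplit G H₁ H₂) {e : Finset ℕ} : e ∈ G.E ↔ e ∈ H₁.E ∨ e ∈ H₂.E := by
  rw [h.2.1, Finset.mem_union]

theorem glue_eq_right (h : IsSplit G H₁ H₂) (hρ : ρ 1 = ρ' 1) (hρ' : ρ 2 = ρ' 2) {w : ℕ}
    (hw : w ∈ H₂.V) (h0 : w ≠ 0) : glue H₁ ρ ρ' w = ρ' w := by
  unfold glue
  split_ifs with h1
  · rcases h.eq_of_mem h1 hw with rfl | rfl | rfl
    · exact absurd rfl h0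
    · exact hρ
    · exact hρ'
  · rfl

theorem isConf_glue (h : IsSplit G H₁ H₂) (hH : PreCalligraph H₁) (h1 : IsSol H₁ μ ρ)
    (h2 : IsSol H₂ μ ρ') : IsConf G.V (μ {1, 2}) (glue H₁ ρ ρ') := by
  refine ⟨fun w hw => ?_, ?_, ?_, fun w hw => ?_⟩
  · rw [h.mem_iff, not_or] at hw
    rw [glue, if_neg hw.1, h2.off w hw.2]
  · rw [glue, if_pos hH.one_mem, h1.one]
  · rw [glue, if_pos hH.two_mem, h1.two]
  · rw [h.mem_iff] at hw
    unfold glue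
    split_ifs with hw'
    · exact h1.sph w hw'
    · exact h2.sph w (hw.resolve_left hw')

theorem glue_edge_left (h1 : IsSol H₁ μ ρ) {x w : ℕ} (hxw : {x, w} ∈ H₁.E) :
    bil (glue H₁ ρ ρ' x) (glue H₁ ρ ρ' w) = μ {x, w} := by
  have hV := H₁.edge_sub _ hxw
  rw [glue, glue, if_pos (hV (by simp)), if_pos (hV (by simp)), h1.edge x w hxw]

theorem glue_edge_right (h : IsSplit G H₁ H₂) (h1 : IsSol H₁ μ ρ)
    (h2 : IsSol H₂ μ ρ') {x w : ℕ} (hxw : {x, w} ∈ H₂.E) (hx : x ≠ 0) (hw : w ≠ 0) :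
    bil (glue H₁ ρ ρ' x) (glue H₁ ρ ρ' w) = μ {x, w} := by
  have hV := H₂.edge_sub _ hxw
  have e1 : ρ 1 = ρ' 1 := h1.one.trans h2.one.symm
  have e2 : ρ 2 = ρ' 2 := h1.two.trans h2.two.symm
  rw [h.glue_eq_right e1 e2 (hV (by simp)) hx, h.glue_eq_right e1 e2 (hV (by simp)) hw,
    h2.edge x w hxw]

theorem isSol_glue (h : IsSplit G H₁ H₂) (hH : PreCalligraph H₁) (h1 : IsSol H₁ μ ρ)
    (h2 : IsSol H₂ μ ρ') (h0 : ρ 0 = ρ' 0) : IsSol G μ (glue H₁ ρ ρ') := by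
  have hc := h.isConf_glue hH h1 h2
  refine ⟨hc.off, hc.one, hc.two, hc.sph, fun x w hxw => ?_⟩
  rcases h.mem_edge_iff.1 hxw with hxw | hxw
  · exact glue_edge_left h1 hxw
  · have hV := H₂.edge_sub _ hxw
    have e (y : ℕ) (hy : y ∈ H₂.V) : glue H₁ ρ ρ' y = ρ' y := by
      by_cases hy0 : y = 0
      · subst hy0
        rw [glue, if_pos hH.zero_mem, h0]
      · exact h.glue_eq_right (h1.one.trans h2.one.symm) (h1.two.trans h2.two.symm) hy hy0
    rw [e x (hV (by simp)), e w (hV (by simp)), h2.edge x w hxw]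

end IsSplit

section bound

variable {C K Γ : Type*} [Field C] [Field K] [Algebra C K] [LinearOrderedCommGroupWithZero Γ]
  {v : Valuation K Γ}

theorem valuation_bil_le (hv : TrivialOn C v) {p q : Fin 3 → K} {ε : Γ} (hp : ∀ i, v (p i) ≤ ε)
    (hq : ∀ i, v (q i) ≤ 1) : v (bil p q) ≤ ε := by
  have h2 : v 2 ≤ 1 := by simpa only [map_ofNat] using hv.le_one 2
  have h (i j) : v (p i * q j) ≤ ε := by rw [map_mul]; exact mul_le_of_le_of_le_one (hp i) (hq j)
  have h' (i j) : v (2 * p i * q j) ≤ ε := by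
    rw [mul_assoc, map_mul]; exact mul_le_of_le_one_of_le h2 (h i j)
  exact (v.map_sub _ _).trans (max_le ((v.map_sub _ _).trans (max_le (h 1 1) (h' 0 2))) (h' 2 0))

theorem sub_coord_le [CharZero C] [CharZero K] (hv : TrivialOn C v) {p q : Fin 3 → K}
    {r : Fin 3 → C} {k : C} (hp : bil p p = 1) (hq : bil q q = 1) (hpr : ∀ i,
        HasResidue v (p i) (r i))
    (hqr : ∀ i, HasResidue v (q i) (r i)) (hr : (k - 1) * r 0 ≠ (k + 1) * r 2) {ε : Γ}
    (h1 : v (bil p basePoint - bil q basePoint) ≤ ε)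
    (h2 : v (bil p (secondPoint (algebraMap C K k)) - bil q (secondPoint (algebraMap C K k))) ≤ ε)
    (i : Fin 3) : v (p i - q i) ≤ ε := by
  set κ := algebraMap C K k with hκ
  have hp1 (i) : v (p i) ≤ 1 := (hpr i).le_one hv
  have hq1 (i) : v (q i) ≤ 1 := (hqr i).le_one hv
  have c1 (x : K) (hx : v x ≤ 1) {y : K} (hy : v y ≤ ε) : v (x * y) ≤ ε := by
    rw [map_mul]; exact mul_le_of_le_one_of_le hx hy
  have hk : v κ ≤ 1 := hv.le_one k
  have hkm : v (κ - 1) ≤ 1 := by have := hv.le_one (k - 1); rwa [map_sub, map_one] at this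
  have hkp : v (κ + 1) ≤ 1 := by have := hv.le_one (k + 1); rwa [map_add, map_one] at this
  rw [bil_basePoint, bil_basePoint] at h1
  rw [bil_secondPoint, bil_secondPoint] at h2
  have hL : v ((κ - 1) * (p 0 - q 0) + (κ + 1) * (p 2 - q 2)) ≤ ε := by
    have : (κ - 1) * (p 0 - q 0) + (κ + 1) * (p 2 - q 2) = κ * (p 1 - q 1) -
        (κ * p 1 - (κ - 1) * p 0 - (κ + 1) * p 2 - (κ * q 1 - (κ - 1) * q 0 - (κ + 1) * q 2)) := by
      ring
    rw [this]
    exact (v.map_sub _ _).trans (max_le (c1 _ hk h1) h2)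
  have h4 : v 4 = 1 := by
    have := hv 4 (by norm_num)
    rwa [map_ofNat] at this
  have hM : v (p 0 * (p 2 - q 2) + q 2 * (p 0 - q 0)) ≤ ε := by
    have e : 4 * (p 0 * (p 2 - q 2) + q 2 * (p 0 - q 0)) = (p 1 + q 1) * (p 1 - q 1) := by
      unfold bil at hp hq
      linear_combination hq - hp
    have : v (4 * (p 0 * (p 2 - q 2) + q 2 * (p 0 - q 0))) ≤ ε := by
      rw [e]
      exact c1 _ ((v.map_add _ _).trans (max_le (hp1 1) (hq1 1))) h1
    rwa [map_mul, h4, one_mul] at this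
  have hD : v ((κ - 1) * p 0 - (κ + 1) * q 2) = 1 := by
    have ck := HasResidue.const v k
    have c1 := HasResidue.const v (1 : C)
    rw [map_one] at c1
    exact (((ck.sub c1).mul hv (hpr 0)).sub ((ck.add c1).mul hv (hqr 2))).eq_one hv (sub_ne_zero.2
        hr)
  have h0' : v (p 0 - q 0) ≤ ε := by
    have e : ((κ - 1) * p 0 - (κ + 1) * q 2) * (p 0 - q 0) =
        p 0 * ((κ - 1) * (p 0 - q 0) + (κ + 1) * (p 2 - q 2)) -
        (κ + 1) * (p 0 * (p 2 - q 2) + q 2 * (p 0 - q 0)) := by ring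
    have := congrArg v e
    rw [map_mul, hD, one_mul] at this
    rw [this]
    exact (v.map_sub _ _).trans (max_le (c1 _ (hp1 0) hL) (c1 _ hkp hM))
  have h2' : v (p 2 - q 2) ≤ ε := by
    have e : ((κ - 1) * p 0 - (κ + 1) * q 2) * (p 2 - q 2) =
        (κ - 1) * (p 0 * (p 2 - q 2) + q 2 * (p 0 - q 0)) -
        q 2 * ((κ - 1) * (p 0 - q 0) + (κ + 1) * (p 2 - q 2)) := by ring
    have := congrArg v e
    rw [map_mul, hD, one_mul] at this
    rw [this]
    exact (v.map_sub _ _).trans (max_le (c1 _ hkm hM) (c1 _ (hq1 2) hL))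
  fin_cases i
  · exact h0'
  · exact h1
  · exact h2'

end bound

section exact

variable {κ₀ κ₁ κ₂ C K Γ : Type*} [Field κ₀] [Field κ₁] [Field κ₂] [Field C] [Field K]
  [Algebra κ₀ C] [Algebra κ₁ C] [Algebra κ₂ C] [Algebra C K] [Algebra κ₀ K]
  [IsScalarTower κ₀ C K]
  {G H₁ H₂ : GeoGraph} {μ : Finset ℕ → C} {k : κ₀} [CharZero κ₀] [CharZero C] [CharZero K]
  [LinearOrderedCommGroupWithZero Γ] {v : Valuation K Γ} {a : C} {u : K}
  {ρ₁ ρ₂ : ℕ → Fin 3 → K} {r₁ r₂ : ℕ → Fin 3 → C}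

theorem GenericSplit.le_diagonal_sub (h : GenericSplit κ₀ κ₁ κ₂ G H₁ H₂ μ k) (hv : TrivialOn C v)
    (hρ₁ : ρ₁ ∈ sectionSet H₁ (liftEdge K μ) u) (hρ₂ : ρ₂ ∈ sectionSet H₂ (liftEdge K μ) u)
    (hr₁ : r₁ ∈ sectionSet H₁ μ a) (hr₂ : r₂ ∈ sectionSet H₂ μ a)
    (h₁ : ∀ w i, HasResidue v (ρ₁ w i) (r₁ w i)) (h₂ : ∀ w i, HasResidue v (ρ₂ w i) (r₂ w i))
    (h0 : r₁ 0 = r₂ 0) :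
    v (u - algebraMap C K a) ≤ v (bil (ρ₁ 0) (ρ₁ 2) - bil (ρ₂ 0) (ρ₂ 2)) := by
  set ε := v (bil (ρ₁ 0) (ρ₁ 2) - bil (ρ₂ 0) (ρ₂ 2)) with hεdef
  have hkC : algebraMap κ₀ C k = μ {1, 2} := h.fst.base
  have hkK : algebraMap κ₀ K k = liftEdge K μ {1, 2} := by
    rw [IsScalarTower.algebraMap_apply κ₀ C K, hkC]; rfl
  have h12 : {1, 2} ∈ G.E := h.split.mem_edge_iff.2 (Or.inl h.fst.pre.mem)
  have hV : 0 ∈ G.V := h.split.mem_iff.2 (Or.inl h.fst.pre.zero_mem)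
  have hV1 : 1 ∈ G.V := h.split.mem_iff.2 (Or.inl h.fst.pre.one_mem)
  have hV2 : 2 ∈ G.V := h.split.mem_iff.2 (Or.inl h.fst.pre.two_mem)
  have hε : ε < 1 := by
    have e1 := HasResidue.bil hv (h₁ 0) (h₁ 2)
    have e2 := HasResidue.bil hv (h₂ 0) (h₂ 2)
    have e3 : r₁ 2 = r₂ 2 := hr₁.1.two.trans hr₂.1.two.symm
    have := e1.sub e2
    rw [h0, e3, sub_self, HasResidue, map_zero, sub_zero] at this
    exact this
  have hglue : IsSol G μ (glue H₁ r₁ r₂) := h.split.isSol_glue h.fst.pre hr₁.1 hr₂.1 h0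
  have hc : IsConf G.V (algebraMap κ₀ K k) (glue H₁ ρ₁ ρ₂) :=
    hkK ▸ h.split.isConf_glue h.fst.pre hρ₁.1 hρ₂.1
  have hc' : IsConf G.V (algebraMap κ₀ K k) (liftReal K (glue H₁ r₁ r₂)) :=
    hkK ▸ hglue.liftReal.conf
  have hg : GaussIndep κ₀ v fun e : FreeEdge G =>
      pairing (liftReal K (glue H₁ r₁ r₂)) (edgePair e) := by
    simp only [pairing_liftReal, hglue.pairing_edgePair]
    exact hv.gaussIndep h.indep
  have g0 : glue H₁ r₁ r₂ 0 = r₁ 0 := if_pos h.fst.pre.zero_mem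
  have hgen := hglue.ne_of_generic h12 h.tight hkC h.fst.ne h.indep hV
  rw [g0, hkC] at hgen
  have hδ : ∀ i, v (ρ₁ 0 i - ρ₂ 0 i) ≤ ε := by
    refine sub_coord_le hv (hρ₁.1.sph 0 h.fst.pre.zero_mem) (hρ₂.1.sph 0 h.snd.pre.zero_mem)
      (h₁ 0) (fun i => by rw [h0]; exact h₂ 0 i) hgen ?_ ?_
    · have e1 := hρ₁.2
      have e2 := hρ₂.2
      have : bil (ρ₁ 0) basePoint - bil (ρ₂ 0) basePoint =
          -(bil (ρ₁ 0) (ρ₁ 2) - bil (ρ₂ 0) (ρ₂ 2)) := by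
        rw [← hρ₁.1.one]
        have e3 : ρ₁ 1 = ρ₂ 1 := hρ₁.1.one.trans hρ₂.1.one.symm
        rw [← e3] at e2
        linear_combination e1 - e2
      rw [this, Valuation.map_neg]
    · have e1 : ρ₁ 2 = secondPoint (algebraMap C K (μ {1, 2})) := hρ₁.1.two
      have e2 : ρ₂ 2 = secondPoint (algebraMap C K (μ {1, 2})) := hρ₂.1.two
      rw [hεdef, e1, e2]
  have edge0 (w : ℕ) (hw : {0, w} ∈ H₂.E) :
      v (bil (glue H₁ ρ₁ ρ₂ 0) (glue H₁ ρ₁ ρ₂ w) - liftEdge K μ {0, w}) ≤ ε := by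
    have hw0 : w ≠ 0 := by
      rintro rfl
      have := H₂.edge_two _ hw
      simp at this
    have hwV : w ∈ H₂.V := H₂.edge_sub _ hw (by simp)
    rw [h.split.glue_eq_right (hρ₁.1.one.trans hρ₂.1.one.symm) (hρ₁.1.two.trans hρ₂.1.two.symm)
      hwV hw0, ← hρ₂.1.edge 0 w hw, glue, if_pos h.fst.pre.zero_mem]
    have : bil (ρ₁ 0) (ρ₂ w) - bil (ρ₂ 0) (ρ₂ w) = bil (fun i => ρ₁ 0 i - ρ₂ 0 i) (ρ₂ w) := by
      simp only [bil]; ring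
    rw [this]
    exact valuation_bil_le hv hδ fun i => (h₂ w i).le_one hv
  have edge (x w : ℕ) (hxw : {x, w} ∈ G.E) :
      v (bil (glue H₁ ρ₁ ρ₂ x) (glue H₁ ρ₁ ρ₂ w) - liftEdge K μ {x, w}) ≤ ε := by
    rcases h.split.mem_edge_iff.1 hxw with hxw | hxw
    · rw [IsSplit.glue_edge_left hρ₁.1 hxw, sub_self, map_zero]
      exact zero_le
    · by_cases hx : x = 0
      · subst hx
        exact edge0 w hxw
      · by_cases hw : w = 0
        · subst hw
          rw [Finset.pair_comm] at hxw ⊢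
          rw [bil_comm]
          exact edge0 x hxw
        · rw [h.split.glue_edge_right hρ₁.1 hρ₂.1 hxw hx hw, sub_self, map_zero]
          exact zero_le
  have pu : pairing (glue H₁ ρ₁ ρ₂) (0, {1, 2}) = u := by
    rw [pairing_diagonals, glue, glue, glue, if_pos h.fst.pre.zero_mem, if_pos h.fst.pre.one_mem,
      if_pos h.fst.pre.two_mem, hρ₁.2]
  have pa : pairing (liftReal K (glue H₁ r₁ r₂)) (0, {1, 2}) = algebraMap C K a := by
    rw [pairing_liftReal, pairing_diagonals, glue, glue, glue, if_pos h.fst.pre.zero_mem,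
      if_pos h.fst.pre.one_mem, if_pos h.fst.pre.two_mem, hr₁.2]
  have key := hc.pairing_sub_le hc' hV1 hV2 (G.card_freeEdge_of_tight h12 h.tight) hg hε
    (d := (0, {1, 2})) (fun e => by
      rw [pairing_liftReal, hglue.pairing_edgePair]
      have hs := (G.exists_edgePair e).choose_spec
      have := edge _ _ (hs ▸ e.2.1)
      rw [← hs] at this
      simpa only [pairing, edgePair, Finset.sum_singleton, liftEdge] using this) (by
      rw [pu, pa]
      have := (HasResidue.bil hv (h₁ 0) (h₁ 1)).add (HasResidue.bil hv (h₁ 0) (h₁ 2))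
      rwa [hρ₁.2, hr₁.2] at this)
  rwa [pu, pa] at key

end exact

section reflection

variable {F : Type*} [Field F]

/-- The reflection of the quadric fixing `basePoint` and `secondPoint k`. -/
def reflect (k : F) (p : Fin 3 → F) : Fin 3 → F :=
  ![(k + 1) / (k - 1) * p 2, p 1, (k - 1) / (k + 1) * p 0]

theorem reflect_zero (k : F) : reflect k 0 = 0 := by
  ext i; fin_cases i <;> simp [reflect]

theorem reflect_basePoint (k : F) : reflect k basePoint = basePoint := by
  ext i; fin_cases i <;> simp [reflect, basePoint]

variable {k : F} {p q : Fin 3 → F}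

theorem reflect_secondPoint (h1 : k - 1 ≠ 0) (h2 : k + 1 ≠ 0) : reflect k (secondPoint k) =
    secondPoint k := by
  ext i; fin_cases i <;> simp [reflect, secondPoint] <;> field_simp

theorem reflect_reflect (h1 : k - 1 ≠ 0) (h2 : k + 1 ≠ 0) (p : Fin 3 → F) : reflect k (reflect k p)
    = p := by
  ext i; fin_cases i <;> simp [reflect] <;> field_simp

theorem bil_reflect (h1 : k - 1 ≠ 0) (h2 : k + 1 ≠ 0) (p q : Fin 3 → F) : bil (reflect k p) (reflect
    k q) = bil p q := by
  simp [bil, reflect]; field_simp; ring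

theorem eq_or_eq_reflect (h1 : k - 1 ≠ 0) (h2 : k + 1 ≠ 0) [CharZero F] (hp : bil p p = 1) (hq : bil
    q q = 1)
    (h : bil p basePoint = bil q basePoint) (h' : bil p (secondPoint k) = bil q (secondPoint k)) :
    p = q ∨ p = reflect k q := by
  rw [bil_basePoint, bil_basePoint] at h
  rw [bil_secondPoint, bil_secondPoint, h] at h'
  have hm : p 0 * p 2 = q 0 * q 2 := by
    have : 4 * (p 0 * p 2) = 4 * (q 0 * q 2) := by
      unfold bil at hp hq; rw [h] at hp; linear_combination hq - hp
    exact mul_left_cancel₀ (by norm_num : (4 : F) ≠ 0) this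
  have key : (k - 1) * (p 0 - q 0) * ((k - 1) * p 0 - (k + 1) * q 2) = 0 := by
    linear_combination -(k - 1) * p 0 * h' - (k - 1) * (k + 1) * hm
  rcases mul_eq_zero.1 key with h3 | h3
  · left
    have h3 : p 0 = q 0 := by
      have := (mul_eq_zero.1 h3).resolve_left h1
      linear_combination this
    have h4 : (k + 1) * p 2 = (k + 1) * q 2 := by rw [h3] at h'; linear_combination -h'
    ext i; fin_cases i
    exacts [h3, h, mul_left_cancel₀ h2 h4]
  · right
    ext i; fin_cases i
    · simp [reflect]; field_simp; linear_combination h3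
    · exact h
    · simp [reflect]; field_simp; linear_combination -h' - h3

theorem reflect_eq_self_iff (h1 : k - 1 ≠ 0) (h2 : k + 1 ≠ 0) : reflect k p = p ↔ (k - 1) * p 0 = (k
    + 1) * p 2 := by
  constructor
  · intro h
    have := congrFun h 0
    simp [reflect] at this
    field_simp at this
    linear_combination -this
  · intro h
    ext i; fin_cases i
    · simp [reflect]; field_simp; linear_combination -h
    · rfl
    · simp [reflect]; field_simp; linear_combination h

theorem IsSol.reflect (h1 : k - 1 ≠ 0) (h2 : k + 1 ≠ 0) {H : GeoGraph} {μ : Finset ℕ → F} {ρ : ℕ →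
    Fin 3 → F} (h : IsSol H μ ρ)
    (hk : μ {1, 2} = k) : IsSol H μ fun w => reflect k (ρ w) where
  off w hw := by rw [h.off w hw, reflect_zero]
  one := by rw [h.one, reflect_basePoint]
  two := by rw [h.two, hk, reflect_secondPoint h1 h2]
  sph w hw := by rw [bil_reflect h1 h2, h.sph w hw]
  edge u w huw := by rw [bil_reflect h1 h2, h.edge u w huw]

end reflection

section matching

variable {F : Type*} [Field F] {G H₁ H₂ : GeoGraph} {μ : Finset ℕ → F} {k : F}

/-- Pairs of realizations of two graphs which agree on both diagonals at `0`. -/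
def matchingSet (H₁ H₂ : GeoGraph) (μ : Finset ℕ → F) :
    Set ((ℕ → Fin 3 → F) × (ℕ → Fin 3 → F)) :=
  {c | IsSol H₁ μ c.1 ∧ IsSol H₂ μ c.2 ∧ bil (c.1 0) (c.1 1) = bil (c.2 0) (c.2 1) ∧
    bil (c.1 0) (c.1 2) = bil (c.2 0) (c.2 2)}

/-- Restriction of a realization to a subgraph. -/
def restrict (H : GeoGraph) (ρ : ℕ → Fin 3 → F) : ℕ → Fin 3 → F :=
  fun w => if w ∈ H.V then ρ w else 0

theorem IsSol.restrict {H : GeoGraph} {ρ : ℕ → Fin 3 → F} (h : IsSol G μ ρ)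
    (hH : PreCalligraph H) (hV : H.V ⊆ G.V) (hE : H.E ⊆ G.E) : IsSol H μ (restrict H ρ) where
  off w hw := by rw [_root_.restrict, if_neg hw]
  one := by rw [_root_.restrict, if_pos hH.one_mem, h.one]
  two := by rw [_root_.restrict, if_pos hH.two_mem, h.two]
  sph w hw := by rw [_root_.restrict, if_pos hw, h.sph w (hV hw)]
  edge u w huw := by
    have := H.edge_sub _ huw
    rw [_root_.restrict, _root_.restrict, if_pos (this (by simp)), if_pos (this (by simp)),
      h.edge u w (hE huw)]

/-- A matching pair is a realization of the union together with a choice of a reflection. -/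
noncomputable def matchOf (H₁ H₂ : GeoGraph) (k : F) (g : (ℕ → Fin 3 → F) × Bool) :
    (ℕ → Fin 3 → F) × (ℕ → Fin 3 → F) :=
  (restrict H₁ g.1, bif g.2 then fun w => reflect k (restrict H₂ g.1 w) else restrict H₂ g.1)

theorem matchingSet_eq [CharZero F] (h : IsSplit G H₁ H₂) (hH₁ : PreCalligraph H₁)
    (hH₂ : PreCalligraph H₂) (h1 : k - 1 ≠ 0) (h2 : k + 1 ≠ 0) (hk : μ {1, 2} = k) :
    matchingSet H₁ H₂ μ = matchOf H₁ H₂ k '' {g | IsSol G μ g.1} := by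
  have hV1 : H₁.V ⊆ G.V := h.1 ▸ Finset.subset_union_left
  have hV2 : H₂.V ⊆ G.V := h.1 ▸ Finset.subset_union_right
  have hE1 : H₁.E ⊆ G.E := h.2.1 ▸ Finset.subset_union_left
  have hE2 : H₂.E ⊆ G.E := h.2.1 ▸ Finset.subset_union_right
  have res1 (ρ ρ' : ℕ → Fin 3 → F) (hρ : IsSol H₁ μ ρ) : restrict H₁ (glue H₁ ρ ρ') = ρ := by
    ext1 w
    by_cases hw : w ∈ H₁.V
    · rw [restrict, if_pos hw, glue, if_pos hw]
    · rw [restrict, if_neg hw, hρ.off w hw]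
  have res2 (ρ ρ' : ℕ → Fin 3 → F) (hρ : IsSol H₁ μ ρ) (hρ' : IsSol H₂ μ ρ') (h0 : ρ 0 = ρ' 0) :
      restrict H₂ (glue H₁ ρ ρ') = ρ' := by
    ext1 w
    by_cases hw : w ∈ H₂.V
    · rw [restrict, if_pos hw]
      by_cases hw0 : w = 0
      · subst hw0; rw [glue, if_pos hH₁.zero_mem, h0]
      · exact h.glue_eq_right (hρ.one.trans hρ'.one.symm) (hρ.two.trans hρ'.two.symm) hw hw0
    · rw [restrict, if_neg hw, hρ'.off w hw]
  ext c
  constructor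
  · rintro ⟨c1, c2, hs, ht⟩
    rw [c1.one, c2.one] at hs
    rw [c1.two, c2.two, hk] at ht
    rcases eq_or_eq_reflect h1 h2 (c1.sph 0 hH₁.zero_mem) (c2.sph 0 hH₂.zero_mem) hs ht with h0 | h0
    · refine ⟨(glue H₁ c.1 c.2, false), h.isSol_glue hH₁ c1 c2 h0, ?_⟩
      simp [matchOf, res1 _ _ c1, res2 _ _ c1 c2 h0]
    · refine ⟨(glue H₁ c.1 fun w => reflect k (c.2 w), true),
        h.isSol_glue hH₁ c1 (c2.reflect h1 h2 hk) h0, ?_⟩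
      simp [matchOf, res1 _ _ c1, res2 _ _ c1 (c2.reflect h1 h2 hk) h0, reflect_reflect h1 h2]
  · rintro ⟨⟨g, b⟩, hg, rfl⟩
    have hg : IsSol G μ g := hg
    have r1 := hg.restrict hH₁ hV1 hE1
    have r2 := hg.restrict hH₂ hV2 hE2
    have e0 : restrict H₁ g 0 = restrict H₂ g 0 := by
      rw [restrict, restrict, if_pos hH₁.zero_mem, if_pos hH₂.zero_mem]
    have e1 := r1.one.trans r2.one.symm
    have e2 := r1.two.trans r2.two.symm
    cases b
    · exact ⟨r1, r2, by simp [matchOf, e0, e1], by simp [matchOf, e0, e2]⟩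
    · refine ⟨r1, r2.reflect h1 h2 hk, ?_, ?_⟩
      · simp only [matchOf, cond_true]
        rw [bil_reflect h1 h2, e0, e1]
      · simp only [matchOf, cond_true]
        rw [bil_reflect h1 h2, e0, e2]

theorem injOn_matchOf (h : IsSplit G H₁ H₂) (hH₁ : PreCalligraph H₁)
    (hH₂ : PreCalligraph H₂) (h1 : k - 1 ≠ 0) (h2 : k + 1 ≠ 0)
    (hgen : ∀ ρ, IsSol G μ ρ → (k - 1) * ρ 0 0 ≠ (k + 1) * ρ 0 2) :
    Set.InjOn (matchOf H₁ H₂ k) {g : (ℕ → Fin 3 → F) × Bool | IsSol G μ g.1} := by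
  rintro ⟨g, b⟩ hg ⟨g', b'⟩ hg' he
  have hg : IsSol G μ g := hg
  have hg' : IsSol G μ g' := hg'
  have e1 : restrict H₁ g = restrict H₁ g' := congrArg Prod.fst he
  have eV1 (w) (hw : w ∈ H₁.V) : g w = g' w := by
    have := congrFun e1 w
    rwa [restrict, restrict, if_pos hw, if_pos hw] at this
  have r0 (ρ : ℕ → Fin 3 → F) : restrict H₂ ρ 0 = ρ 0 := by rw [restrict, if_pos hH₂.zero_mem]
  have hne (ρ) (hρ : IsSol G μ ρ) : reflect k (ρ 0) ≠ ρ 0 := fun h =>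
    hgen ρ hρ ((reflect_eq_self_iff h1 h2).1 h)
  have e2 := congrArg Prod.snd he
  simp only [matchOf] at e2
  have e20 := congrFun e2 0
  have main (hr : restrict H₂ g = restrict H₂ g') : g = g' := by
    ext1 w
    by_cases hw1 : w ∈ H₁.V
    · exact eV1 w hw1
    · by_cases hw2 : w ∈ H₂.V
      · have := congrFun hr w
        rwa [restrict, restrict, if_pos hw2, if_pos hw2] at this
      · have : w ∉ G.V := by rw [h.mem_iff]; tauto
        rw [hg.off w this, hg'.off w this]
  have e0 := eV1 0 hH₁.zero_mem
  cases b <;> cases b' <;> simp only [cond_true, cond_false, r0] at e2 e20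
  · rw [main e2]
  · exact absurd (e20.symm.trans e0) (hne g' hg')
  · exact absurd (e20.trans e0.symm) (hne g hg)
  · rw [main]
    ext1 w
    have := congrArg (reflect k) (congrFun e2 w)
    rwa [reflect_reflect h1 h2, reflect_reflect h1 h2] at this

theorem finite_matchingSet [CharZero F] (h : IsSplit G H₁ H₂) (hH₁ : PreCalligraph H₁)
    (hH₂ : PreCalligraph H₂) (h1 : k - 1 ≠ 0) (h2 : k + 1 ≠ 0) (hk : μ {1, 2} = k)
    (hfin : {ρ | IsSol G μ ρ}.Finite) : (matchingSet H₁ H₂ μ).Finite := by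
  rw [matchingSet_eq h hH₁ hH₂ h1 h2 hk]
  refine Set.Finite.image _ ((hfin.prod (Set.finite_univ (α :=
      Bool))).subset fun g hg => ⟨hg, trivial⟩)

theorem ncard_matchingSet [CharZero F] (h : IsSplit G H₁ H₂) (hH₁ : PreCalligraph H₁)
    (hH₂ : PreCalligraph H₂) (h1 : k - 1 ≠ 0) (h2 : k + 1 ≠ 0) (hk : μ {1, 2} = k)
    (hgen : ∀ ρ, IsSol G μ ρ → (k - 1) * ρ 0 0 ≠ (k + 1) * ρ 0 2) :
    (matchingSet H₁ H₂ μ).ncard = 2 * {ρ | IsSol G μ ρ}.ncard := by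
  rw [matchingSet_eq h hH₁ hH₂ h1 h2 hk, (injOn_matchOf h hH₁ hH₂ h1 h2 hgen).ncard_image]
  have : {g : (ℕ → Fin 3 → F) × Bool | IsSol G μ g.1} = {ρ | IsSol G μ ρ} ×ˢ Set.univ := by
    ext; simp
  rw [this, Set.ncard_prod, Set.ncard_univ]
  simp [mul_comm]

end matching

section infinity

variable {κ₀ C K Γ : Type*} [Field κ₀] [Field C] [Field K]
  [Algebra κ₀ C] [Algebra C K] [Algebra κ₀ K] [IsScalarTower κ₀ C K] [CharZero κ₀] [CharZero K]
  [LinearOrderedCommGroupWithZero Γ] {v : Valuation K Γ} {u : K}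
  {H : GeoGraph} {μ : Finset ℕ → C} {k : κ₀} {ρ : ℕ → Fin 3 → K}

theorem IsSol.weak_types (hρ : IsSol H (liftEdge K μ) ρ) (hH : PreCalligraph H)
    (hi : AlgebraicIndependent κ₀ fun e : FreeEdge H => μ e.1) (hk : algebraMap κ₀ C k = μ {1, 2})
    (hk1 : k ^ 2 ≠ 1) (hv : TrivialOn C v)
    (hu : bil (ρ 0) (ρ 1) + bil (ρ 0) (ρ 2) = u) (h1 : 1 < v u) :
    (v (bil (ρ 0) (ρ 1)) = v u ∧ v (bil (ρ 0) (ρ 2)) = v u) ∨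
    (v (bil (ρ 0) (ρ 1)) = 1 ∧ v (bil (ρ 0) (ρ 2)) = v u) ∨
    (v (bil (ρ 0) (ρ 1)) = v u ∧ v (bil (ρ 0) (ρ 2)) = 1) := by
  have hkK : algebraMap κ₀ K k = liftEdge K μ {1, 2} := by
    rw [IsScalarTower.algebraMap_apply κ₀ C K, hk]; rfl
  rcases hρ.place_types hH (hv.gaussIndep hi) hkK hk1 hu h1 with h | ⟨h, h'⟩ | ⟨h, h'⟩
  · exact Or.inl ⟨by simpa using h 1 0 (by simp), by simpa using h 0 1 (by simp)⟩
  · exact Or.inr (Or.inl ⟨by simpa using h' 0, h⟩)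
  · exact Or.inr (Or.inr ⟨h, by simpa using h' 0⟩)

end infinity

namespace GenericSplit

variable {κ₀ κ₁ κ₂ C K Γ : Type*} [Field κ₀] [Field κ₁] [Field κ₂] [Field C] [Field K]
  [Algebra κ₀ κ₁] [Algebra κ₀ κ₂]
  [Algebra κ₀ C] [Algebra κ₁ C] [Algebra κ₂ C] [Algebra C K] [Algebra κ₀ K] [Algebra κ₁ K]
  [Algebra κ₂ K] [IsScalarTower κ₀ κ₁ C] [IsScalarTower κ₀ κ₂ C] [IsScalarTower κ₀ κ₁ K]
  [IsScalarTower κ₀ κ₂ K]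
  [IsScalarTower κ₀ C K] [IsScalarTower κ₁ C K] [IsScalarTower κ₂ C K]
  {G H₁ H₂ : GeoGraph} {μ : Finset ℕ → C} {k : κ₀} [CharZero κ₀] [CharZero κ₁] [CharZero κ₂]
  [CharZero C] [CharZero K]
  [IsAlgClosed κ₁] [IsAlgClosed κ₂] [IsAlgClosed C] [IsAlgClosed K]
  [LinearOrderedCommGroupWithZero Γ] {v : Valuation K Γ} {a : C} {u : K}
  {ρ₁ ρ₂ : ℕ → Fin 3 → K} {r₁ r₂ : ℕ → Fin 3 → C}

theorem valuation_sub_infinity (h : GenericSplit κ₀ κ₁ κ₂ G H₁ H₂ μ k) (hv : TrivialOn C v)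
    (hu : Transcendental C u) (h1 : 1 < v u) (hρ₁ : ρ₁ ∈ sectionSet H₁ (liftEdge K μ) u)
    (hρ₂ : ρ₂ ∈ sectionSet H₂ (liftEdge K μ) u) :
    v (bil (ρ₁ 0) (ρ₁ 2) - bil (ρ₂ 0) (ρ₂ 2)) =
      if v (bil (ρ₁ 0) (ρ₁ 1)) ≤ 1 ∧ v (bil (ρ₂ 0) (ρ₂ 1)) ≤ 1 ∨
        v (bil (ρ₁ 0) (ρ₁ 2)) ≤ 1 ∧ v (bil (ρ₂ 0) (ρ₂ 2)) ≤ 1 then 1 else v u := by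
  have hv₂ : TrivialOn κ₂ v := hv.tower
  have hk2 : algebraMap κ₂ K (algebraMap κ₀ κ₂ k) = liftEdge K μ {1, 2} := by
    rw [← IsScalarTower.algebraMap_apply, h.snd.algebraMap_base]
  have hk1 : (algebraMap κ₀ κ₂ k) ^ 2 ≠ 1 := by
    rw [← map_pow, Ne, ← map_one (algebraMap κ₀ κ₂), (algebraMap κ₀ κ₂).injective.eq_iff]
    exact h.snd.ne
  have hu2 : Transcendental κ₂ u := hu.of_tower_top κ₂
  refine valuation_sub_at_infinity hv₂ hu2 h1 hρ₁.2 hρ₂.2 ?_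
    (hρ₁.1.place_types h.fst.pre (hv.gaussIndep h.indep_fst) hk2 hk1 hρ₁.2 h1)
    (hρ₂.1.weak_types h.snd.pre h.snd.indep h.snd.base h.snd.ne hv hρ₂.2 h1)
  exact IsAlgebraic.bil (h.snd.isAlgebraic hu2 hρ₂ 0) (h.snd.isAlgebraic hu2 hρ₂ 2)

/-- The product of the differences of the diagonals. -/
noncomputable def resultant (S₁ S₂ : Finset (ℕ → Fin 3 → K)) : K :=
  ∏ p ∈ S₁ ×ˢ S₂, (bil (p.1 0) (p.1 2) - bil (p.2 0) (p.2 2))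

open Classical in
/-- The number of realizations whose diagonal `{0, i}` is finite at a place. -/
noncomputable def finiteCount (v : Valuation K Γ) (S : Finset (ℕ → Fin 3 → K)) (i : ℕ) : ℕ :=
  (S.filter fun ρ => v (bil (ρ 0) (ρ i)) ≤ 1).card

theorem valuation_resultant_infinity (h : GenericSplit κ₀ κ₁ κ₂ G H₁ H₂ μ k) (hv : TrivialOn C v)
    (hu : Transcendental C u) (h1 : 1 < v u) {S₁ S₂ : Finset (ℕ → Fin 3 → K)}
    (hS₁ : ∀ ρ ∈ S₁, ρ ∈ sectionSet H₁ (liftEdge K μ) u)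
    (hS₂ : ∀ ρ ∈ S₂, ρ ∈ sectionSet H₂ (liftEdge K μ) u) :
    v (resultant S₁ S₂) = v u ^ ((S₁.card * S₂.card : ℤ) -
      finiteCount v S₁ 1 * finiteCount v S₂ 1 - finiteCount v S₁ 2 * finiteCount v S₂ 2) := by
  classical
  set P : (ℕ → Fin 3 → K) × (ℕ → Fin 3 → K) → Prop := fun p =>
    v (bil (p.1 0) (p.1 1)) ≤ 1 ∧ v (bil (p.2 0) (p.2 1)) ≤ 1 with hP
  set Q : (ℕ → Fin 3 → K) × (ℕ → Fin 3 → K) → Prop := fun p =>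
    v (bil (p.1 0) (p.1 2)) ≤ 1 ∧ v (bil (p.2 0) (p.2 2)) ≤ 1 with hQ
  have hprod : v (resultant S₁ S₂) = ∏ p ∈ S₁ ×ˢ S₂, if P p ∨ Q p then 1 else v u := by
    rw [resultant, map_prod]
    refine Finset.prod_congr rfl fun p hp => ?_
    rw [Finset.mem_product] at hp
    exact h.valuation_sub_infinity hv hu h1 (hS₁ _ hp.1) (hS₂ _ hp.2)
  have hdisj : Disjoint ((S₁ ×ˢ S₂).filter P) ((S₁ ×ˢ S₂).filter Q) := by
    rw [Finset.disjoint_filter]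
    intro p hp hPp hQp
    rw [Finset.mem_product] at hp
    have := (hS₁ _ hp.1).2
    rw [← this] at h1
    exact h1.not_ge ((v.map_add _ _).trans (max_le hPp.1 hQp.1))
  have hcard : (((S₁ ×ˢ S₂).filter fun p => ¬ (P p ∨ Q p)).card : ℤ) =
      (S₁.card * S₂.card : ℤ) - finiteCount v S₁ 1 * finiteCount v S₂ 1 -
        finiteCount v S₁ 2 * finiteCount v S₂ 2 := by
    have e1 := Finset.card_filter_add_card_filter_not (s := S₁ ×ˢ S₂) (fun p => P p ∨ Q p)
    rw [Finset.filter_or, Finset.card_union_of_disjoint hdisj, Finset.card_product] at e1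
    have e2 : ((S₁ ×ˢ S₂).filter P).card = finiteCount v S₁ 1 * finiteCount v S₂ 1 := by
      rw [finiteCount, finiteCount, ← Finset.card_product, ← Finset.filter_product]
    have e3 : ((S₁ ×ˢ S₂).filter Q).card = finiteCount v S₁ 2 * finiteCount v S₂ 2 := by
      rw [finiteCount, finiteCount, ← Finset.card_product, ← Finset.filter_product]
    rw [e2, e3] at e1
    have e1 := congrArg (Nat.cast : ℕ → ℤ) e1
    push_cast at e1
    linear_combination e1
  rw [hprod, Finset.prod_ite, Finset.prod_const_one, one_mul, Finset.prod_const, ← hcard,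
    zpow_natCast]

end GenericSplit

theorem IsSplit.symm {G H₁ H₂ : GeoGraph} (h : IsSplit G H₁ H₂) : IsSplit G H₂ H₁ :=
  ⟨by rw [h.1, Finset.union_comm], by rw [h.2.1, Finset.union_comm],
    by rw [Finset.inter_comm, h.2.2.1], by rw [Finset.inter_comm, h.2.2.2]⟩

namespace GenericSplit

variable {κ₀ κ₁ κ₂ C K Γ : Type*} [Field κ₀] [Field κ₁] [Field κ₂] [Field C] [Field K]
  [Algebra κ₀ κ₁] [Algebra κ₀ κ₂]
  [Algebra κ₀ C] [Algebra κ₁ C] [Algebra κ₂ C] [Algebra C K] [Algebra κ₀ K] [Algebra κ₁ K]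
  [Algebra κ₂ K] [IsScalarTower κ₀ κ₁ C] [IsScalarTower κ₀ κ₂ C] [IsScalarTower κ₀ κ₁ K]
  [IsScalarTower κ₀ κ₂ K]
  [IsScalarTower κ₀ C K] [IsScalarTower κ₁ C K] [IsScalarTower κ₂ C K]
  {G H₁ H₂ : GeoGraph} {μ : Finset ℕ → C} {k : κ₀} [CharZero κ₀] [CharZero κ₁] [CharZero κ₂]
  [CharZero C] [CharZero K]
  [IsAlgClosed κ₁] [IsAlgClosed κ₂] [IsAlgClosed C] [IsAlgClosed K]
  [LinearOrderedCommGroupWithZero Γ] {v : Valuation K Γ} {a : C} {u : K}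
  {ρ₁ ρ₂ : ℕ → Fin 3 → K} {r₁ r₂ : ℕ → Fin 3 → C}

theorem symm {κ₀ κ₁ κ₂ C : Type*} [Field κ₀] [Field κ₁] [Field κ₂] [Field C]
    [Algebra κ₀ C] [Algebra κ₁ C] [Algebra κ₂ C] {G H₁ H₂ : GeoGraph} {μ : Finset ℕ → C} {k : κ₀}
    (h : GenericSplit κ₀ κ₁ κ₂ G H₁ H₂ μ k) : GenericSplit κ₀ κ₂ κ₁ G H₂ H₁ μ k :=
  ⟨h.snd, h.fst, h.indep_snd, h.indep_fst, h.split.symm, h.tight, h.indep⟩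

theorem diagonal_le_one {κ C : Type*} [Field κ] [Field C] [Algebra κ₀ C] [Algebra κ C]
    [Algebra C K] [IsScalarTower κ₀ C K] {H : GeoGraph}
    {μ : Finset ℕ → C} {ρ : ℕ → Fin 3 → K} (h : GenericOver κ₀ κ H μ k)
    (hv : TrivialOn C v) (hu : v u ≤ 1) (hρ : ρ ∈ sectionSet H (liftEdge K μ) u) :
    v (bil (ρ 0) (ρ 2)) ≤ 1 := by
  have hkK : algebraMap κ₀ K k = liftEdge K μ {1, 2} := by
    rw [IsScalarTower.algebraMap_apply κ₀ C K, h.base]; rfl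
  exact (hρ.1.diagonals_le_one h.pre (hv.gaussIndep h.indep) hkK h.ne hρ.2 hu).2

theorem ne_one_map {κ₀ κ : Type*} [Field κ₀] [Field κ] [Algebra κ₀ κ] {k : κ₀} (h : k ^ 2 ≠ 1) :
    (algebraMap κ₀ κ k) ^ 2 ≠ 1 := by
  rw [← map_pow, Ne, ← map_one (algebraMap κ₀ κ), (algebraMap κ₀ κ).injective.eq_iff]
  exact h

theorem valuation_sub_special (h : GenericSplit κ₀ κ₁ κ₂ G H₁ H₂ μ k) (hv : TrivialOn C v)
    (hu : Transcendental C u) (ha : HasResidue v u a) (hat : ¬ Transcendental κ₁ a)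
    (hρ₁ : ρ₁ ∈ sectionSet H₁ (liftEdge K μ) u) (hρ₂ : ρ₂ ∈ sectionSet H₂ (liftEdge K μ) u) :
    v (bil (ρ₁ 0) (ρ₁ 2) - bil (ρ₂ 0) (ρ₂ 2)) = 1 := by
  obtain ⟨a, rfl⟩ := (not_not.1 hat : IsAlgebraic κ₁ a).exists_algebraMap_eq
  have hu1 : v u ≤ 1 := ha.le_one hv
  have l1 := diagonal_le_one h.fst hv hu1 hρ₁
  have l2 := diagonal_le_one h.snd hv hu1 hρ₂
  have hu' : Transcendental κ₁ u := hu.of_tower_top κ₁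
  have ha' : HasResidue v u a := by
    unfold HasResidue at *
    rwa [← IsScalarTower.algebraMap_apply] at ha
  have hk2 : algebraMap κ₁ K (algebraMap κ₀ κ₁ k) = liftEdge K μ {1, 2} := by
    rw [← IsScalarTower.algebraMap_apply, h.snd.algebraMap_base]
  have := hρ₂.1.valuation_sub_at_special h.snd.pre (hv.gaussIndep h.indep_snd) hk2
    (ne_one_map h.fst.ne) hu' ha' hρ₂.2
    (IsAlgebraic.bil (h.fst.isAlgebraic hu' hρ₁ 0) (h.fst.isAlgebraic hu' hρ₁ 2)) l1
  rw [Valuation.map_sub_swap] at this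
  exact le_antisymm ((v.map_sub _ _).trans (max_le l1 l2)) (not_lt.1 this)

theorem transcendental_of_mem_matchingSet (h : GenericSplit κ₀ κ₁ κ₂ G H₁ H₂ μ k)
    {c : (ℕ → Fin 3 → C) × (ℕ → Fin 3 → C)} (hc : c ∈ matchingSet H₁ H₂ μ) :
    Transcendental κ₁ (bil (c.1 0) (c.1 1) + bil (c.1 0) (c.1 2)) := by
  classical
  obtain ⟨h1, h2, hs, ht⟩ := hc
  intro hat
  obtain ⟨a, ha⟩ := hat.exists_algebraMap_eq
  choose m hm using fun e : FreeEdge H₁ => h.fst.mem e.1 e.2.1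
  have hi : AlgebraicIndependent κ₀ m := by
    have := h.fst.indep
    rw [← funext hm] at this
    exact AlgebraicIndependent.of_comp (IsScalarTower.toAlgHom κ₀ κ₁ C) this
  obtain ⟨α, β, hα, hβ⟩ := h1.isAlgebraic_diagonals h.fst.pre hm hi h.fst.base h.fst.ne ha.symm
  have hk : algebraMap κ₁ C (algebraMap κ₀ κ₁ k) = μ {1, 2} := by
    rw [← IsScalarTower.algebraMap_apply, h.snd.base]
  refine h2.place_finite (v := (1 : Valuation C (WithZero (Multiplicative ℤ)))) h.snd.pre
    (.of_algebraicIndependent h.indep_snd fun y _ hy => Valuation.one_apply_of_ne_zero hy) hk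
    (ne_one_map h.fst.ne) (α := α) (β := β) ?_ ?_
  · rw [HasResidue, ← hs, hα, sub_self, map_zero]; exact zero_lt_one
  · rw [HasResidue, ← ht, hβ, sub_self, map_zero]; exact zero_lt_one

theorem base_sub_ne (h : GenericOver κ₀ κ₁ H₁ μ k) :
    μ {1, 2} - 1 ≠ 0 ∧ μ {1, 2} + 1 ≠ 0 := by
  have : (μ {1, 2}) ^ 2 ≠ 1 := h.base ▸ ne_one_map h.ne
  exact ⟨fun h => this (by linear_combination (μ {1, 2} + 1) * h),
    fun h => this (by linear_combination (μ {1, 2} - 1) * h)⟩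

theorem valuation_sub_match (h : GenericSplit κ₀ κ₁ κ₂ G H₁ H₂ μ k) (hv : TrivialOn C v)
    (ha : HasResidue v u a) (hat₁ : Transcendental κ₁ a) (hat₂ : Transcendental κ₂ a)
    (hρ₁ : ρ₁ ∈ sectionSet H₁ (liftEdge K μ) u) (hρ₂ : ρ₂ ∈ sectionSet H₂ (liftEdge K μ) u)
    (hr₁ : r₁ ∈ sectionSet H₁ μ a) (hr₂ : r₂ ∈ sectionSet H₂ μ a)
    (h₁ : ∀ w i, HasResidue v (ρ₁ w i) (r₁ w i)) (h₂ : ∀ w i, HasResidue v (ρ₂ w i) (r₂ w i))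
    (ht : bil (r₁ 0) (r₁ 2) = bil (r₂ 0) (r₂ 2)) :
    v (bil (ρ₁ 0) (ρ₁ 2) - bil (ρ₂ 0) (ρ₂ 2)) = v (u - algebraMap C K a) := by
  apply le_antisymm
  · have e : bil (ρ₁ 0) (ρ₁ 2) - bil (ρ₂ 0) (ρ₂ 2) =
        (bil (ρ₁ 0) (ρ₁ 2) - algebraMap C K (bil (r₁ 0) (r₁ 2))) -
        (bil (ρ₂ 0) (ρ₂ 2) - algebraMap C K (bil (r₂ 0) (r₂ 2))) := by rw [ht]; ring
    rw [e]
    exact (v.map_sub _ _).trans (max_le (h.fst.diagonal_sub_le ha hv hat₁ hρ₁ hr₁ h₁)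
      (h.snd.diagonal_sub_le ha hv hat₂ hρ₂ hr₂ h₂))
  · obtain ⟨n1, n2⟩ := base_sub_ne h.fst
    have hs : bil (r₁ 0) (r₁ 1) = bil (r₂ 0) (r₂ 1) := by
      linear_combination hr₁.2 - hr₂.2 - ht
    rw [hr₁.1.one, hr₂.1.one] at hs
    rw [hr₁.1.two, hr₂.1.two] at ht
    rcases eq_or_eq_reflect n1 n2 (hr₁.1.sph 0 h.fst.pre.zero_mem)
      (hr₂.1.sph 0 h.snd.pre.zero_mem) hs ht with h0 | h0
    · exact h.le_diagonal_sub hv hρ₁ hρ₂ hr₁ hr₂ h₁ h₂ h0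
    · have m1 : liftEdge K μ {1, 2} - 1 ≠ 0 := by
        have := (map_ne_zero (algebraMap C K)).2 n1
        rwa [map_sub, map_one] at this
      have m2 : liftEdge K μ {1, 2} + 1 ≠ 0 := by
        have := (map_ne_zero (algebraMap C K)).2 n2
        rwa [map_add, map_one] at this
      have hρ₂' : (fun w => reflect (liftEdge K μ {1, 2}) (ρ₂ w)) ∈
          sectionSet H₂ (liftEdge K μ) u :=
        ⟨hρ₂.1.reflect m1 m2 rfl, by simpa only [bil_reflect m1 m2] using hρ₂.2⟩
      have hr₂' : (fun w => reflect (μ {1, 2}) (r₂ w)) ∈ sectionSet H₂ μ a :=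
        ⟨hr₂.1.reflect n1 n2 rfl, by simpa only [bil_reflect n1 n2] using hr₂.2⟩
      have := h.le_diagonal_sub hv hρ₁ hρ₂' hr₁ hr₂' h₁ (fun w i => ?_) h0
      · simpa only [bil_reflect m1 m2] using this
      · have c0 : HasResidue v ((liftEdge K μ {1, 2} + 1) / (liftEdge K μ {1, 2} - 1))
            ((μ {1, 2} + 1) / (μ {1, 2} - 1)) := by
          have := HasResidue.const v ((μ {1, 2} + 1) / (μ {1, 2} - 1))
          simpa only [liftEdge, map_div₀, map_add, map_sub, map_one] using this
        have c2 : HasResidue v ((liftEdge K μ {1, 2} - 1) / (liftEdge K μ {1, 2} + 1))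
            ((μ {1, 2} - 1) / (μ {1, 2} + 1)) := by
          have := HasResidue.const v ((μ {1, 2} - 1) / (μ {1, 2} + 1))
          simpa only [liftEdge, map_div₀, map_add, map_sub, map_one] using this
        fin_cases i
        · exact c0.mul hv (h₂ w 2)
        · exact h₂ w 1
        · exact c2.mul hv (h₂ w 0)

end GenericSplit

namespace GenericSplit

variable {κ₀ κ₁ κ₂ C K Γ : Type*} [Field κ₀] [Field κ₁] [Field κ₂] [Field C] [Field K]
  [Algebra κ₀ κ₁] [Algebra κ₀ κ₂]
  [Algebra κ₀ C] [Algebra κ₁ C] [Algebra κ₂ C] [Algebra C K] [Algebra κ₀ K] [Algebra κ₁ K]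
  [Algebra κ₂ K] [IsScalarTower κ₀ κ₁ C] [IsScalarTower κ₀ κ₂ C] [IsScalarTower κ₀ κ₁ K]
  [IsScalarTower κ₀ κ₂ K]
  [IsScalarTower κ₀ C K] [IsScalarTower κ₁ C K] [IsScalarTower κ₂ C K]
  {G H₁ H₂ : GeoGraph} {μ : Finset ℕ → C} {k : κ₀} [CharZero κ₀] [CharZero κ₁] [CharZero κ₂]
  [CharZero C] [CharZero K]
  [IsAlgClosed κ₁] [IsAlgClosed κ₂] [IsAlgClosed C] [IsAlgClosed K]
  [LinearOrderedCommGroupWithZero Γ] {v : Valuation K Γ} {a : C} {u : K}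
  {S₁ S₂ : Finset (ℕ → Fin 3 → K)} {M : Finset ((ℕ → Fin 3 → C) × (ℕ → Fin 3 → C))}

/-- The polynomial in `u` whose roots are the sums of the diagonals of the pairs in `M`. -/
noncomputable def matchProd (u : K) (M : Finset ((ℕ → Fin 3 → C) × (ℕ → Fin 3 → C))) : K :=
  ∏ c ∈ M, (u - algebraMap C K (bil (c.1 0) (c.1 1) + bil (c.1 0) (c.1 2)))

open Classical in
theorem valuation_matchProd (hv : TrivialOn C v) (ha : HasResidue v u a) :
    v (matchProd u M) = v (u - algebraMap C K a) ^
      (M.filter fun c => bil (c.1 0) (c.1 1) + bil (c.1 0) (c.1 2) = a).card := by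
  rw [matchProd, map_prod, ← Finset.prod_filter_mul_prod_filter_not M
    (fun c => bil (c.1 0) (c.1 1) + bil (c.1 0) (c.1 2) = a)]
  rw [Finset.prod_congr rfl (g := fun _ => v (u - algebraMap C K a)), Finset.prod_const,
    Finset.prod_congr rfl (g := fun _ => 1), Finset.prod_const_one, mul_one]
  · intro c hc
    exact (ha.sub (HasResidue.const v _)).eq_one hv
      (sub_ne_zero.2 fun h => (Finset.mem_filter.1 hc).2 h.symm)
  · intro c hc
    rw [(Finset.mem_filter.1 hc).2]

open Classical in
theorem valuation_resultant_residue (h : GenericSplit κ₀ κ₁ κ₂ G H₁ H₂ μ k) (hv : TrivialOn C v)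
    (hu : Transcendental C u) (ha : HasResidue v u a) (hat₁ : Transcendental κ₁ a)
    (hat₂ : Transcendental κ₂ a)
    (hS₁ : ∀ ρ, ρ ∈ S₁ ↔ ρ ∈ sectionSet H₁ (liftEdge K μ) u)
    (hS₂ : ∀ ρ, ρ ∈ S₂ ↔ ρ ∈ sectionSet H₂ (liftEdge K μ) u)
    (hM : ∀ c, c ∈ M ↔ c ∈ matchingSet H₁ H₂ μ) :
    v (resultant S₁ S₂) = v (u - algebraMap C K a) ^
      (M.filter fun c => bil (c.1 0) (c.1 1) + bil (c.1 0) (c.1 2) = a).card := by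
  choose! f₁ hf₁ hf₁' using fun ρ (hρ : ρ ∈ sectionSet H₁ (liftEdge K μ) u) =>
    h.fst.exists_residue hu ha hv hat₁ hρ
  choose! f₂ hf₂ hf₂' using fun ρ (hρ : ρ ∈ sectionSet H₂ (liftEdge K μ) u) =>
    h.snd.exists_residue hu ha hv hat₂ hρ
  have hcard : (M.filter fun c => bil (c.1 0) (c.1 1) + bil (c.1 0) (c.1 2) = a).card =
      ((S₁ ×ˢ S₂).filter fun p => bil (f₁ p.1 0) (f₁ p.1 2) = bil (f₂ p.2 0) (f₂ p.2 2)).card := by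
    symm
    refine Finset.card_bij (fun p _ => (f₁ p.1, f₂ p.2)) ?_ ?_ ?_
    · intro p hp
      obtain ⟨hp, he⟩ := Finset.mem_filter.1 hp
      rw [Finset.mem_product, hS₁, hS₂] at hp
      have m1 := hf₁ _ hp.1
      have m2 := hf₂ _ hp.2
      rw [Finset.mem_filter, hM]
      refine ⟨⟨m1.1, m2.1, ?_, he⟩, m1.2⟩
      linear_combination m1.2 - m2.2 - he
    · intro p hp q hq he
      have hp := (Finset.mem_filter.1 hp).1
      have hq := (Finset.mem_filter.1 hq).1
      rw [Finset.mem_product, hS₁, hS₂] at hp hq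
      rw [Prod.mk.injEq] at he
      refine Prod.ext ?_ ?_
      · exact h.fst.eq_of_residue hu ha hv hat₁ hp.1 hq.1 (hf₁' _ hp.1) (he.1 ▸ hf₁' _ hq.1)
      · exact h.snd.eq_of_residue hu ha hv hat₂ hp.2 hq.2 (hf₂' _ hp.2) (he.2 ▸ hf₂' _ hq.2)
    · intro c hc
      obtain ⟨hc, hca⟩ := Finset.mem_filter.1 hc
      obtain ⟨c1, c2, hs, ht⟩ := (hM c).1 hc
      obtain ⟨ρ₁, hρ₁, h₁⟩ := h.fst.exists_lift hu ha hv hat₁ (r := c.1) ⟨c1, hca⟩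
      obtain ⟨ρ₂, hρ₂, h₂⟩ := h.snd.exists_lift hu ha hv hat₂ (r :=
          c.2) ⟨c2, by rw [← hs, ← ht, hca]⟩
      have e1 : f₁ ρ₁ = c.1 := funext fun w => funext fun i => (hf₁' _ hρ₁ w i).unique hv (h₁ w i)
      have e2 : f₂ ρ₂ = c.2 := funext fun w => funext fun i => (hf₂' _ hρ₂ w i).unique hv (h₂ w i)
      refine ⟨(ρ₁, ρ₂), ?_, Prod.ext e1 e2⟩
      rw [Finset.mem_filter, Finset.mem_product, hS₁, hS₂]
      exact ⟨⟨hρ₁, hρ₂⟩, by simp only [e1, e2, ht]⟩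
  rw [hcard, resultant, map_prod, ← Finset.prod_filter_mul_prod_filter_not (S₁ ×ˢ S₂)
    (fun p => bil (f₁ p.1 0) (f₁ p.1 2) = bil (f₂ p.2 0) (f₂ p.2 2))]
  rw [Finset.prod_congr rfl (g := fun _ => v (u - algebraMap C K a)), Finset.prod_const,
    Finset.prod_congr rfl (g := fun _ => 1), Finset.prod_const_one, mul_one]
  · intro p hp
    obtain ⟨hp, he⟩ := Finset.mem_filter.1 hp
    rw [Finset.mem_product, hS₁, hS₂] at hp
    exact ((HasResidue.bil hv (hf₁' _ hp.1 0) (hf₁' _ hp.1 2)).sub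
      (HasResidue.bil hv (hf₂' _ hp.2 0) (hf₂' _ hp.2 2))).eq_one hv (sub_ne_zero.2 he)
  · intro p hp
    obtain ⟨hp, he⟩ := Finset.mem_filter.1 hp
    rw [Finset.mem_product, hS₁, hS₂] at hp
    exact h.valuation_sub_match hv ha hat₁ hat₂ hp.1 hp.2 (hf₁ _ hp.1) (hf₂ _ hp.2)
      (hf₁' _ hp.1) (hf₂' _ hp.2) he

theorem valuation_resultant_finite (h : GenericSplit κ₀ κ₁ κ₂ G H₁ H₂ μ k) (hv : TrivialOn C v)
    (hu : Transcendental C u) (ha : HasResidue v u a)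
    (hS₁ : ∀ ρ, ρ ∈ S₁ ↔ ρ ∈ sectionSet H₁ (liftEdge K μ) u)
    (hS₂ : ∀ ρ, ρ ∈ S₂ ↔ ρ ∈ sectionSet H₂ (liftEdge K μ) u)
    (hM : ∀ c, c ∈ M ↔ c ∈ matchingSet H₁ H₂ μ) :
    v (resultant S₁ S₂) = v (matchProd u M) := by
  classical
  rw [valuation_matchProd hv ha]
  have special (h1 : ∀ p ∈ S₁ ×ˢ S₂, v (bil (p.1 0) (p.1 2) - bil (p.2 0) (p.2 2)) = 1)
      (h2 : ∀ c ∈ M, bil (c.1 0) (c.1 1) + bil (c.1 0) (c.1 2) ≠ a) :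
      v (resultant S₁ S₂) = v (u - algebraMap C K a) ^
        (M.filter fun c => bil (c.1 0) (c.1 1) + bil (c.1 0) (c.1 2) = a).card := by
    rw [resultant, map_prod, Finset.prod_congr rfl h1, Finset.prod_const_one,
      Finset.filter_false_of_mem h2, Finset.card_empty, pow_zero]
  by_cases hat₁ : Transcendental κ₁ a
  · by_cases hat₂ : Transcendental κ₂ a
    · exact h.valuation_resultant_residue hv hu ha hat₁ hat₂ hS₁ hS₂ hM
    · refine special (fun p hp => ?_) fun c hc he => hat₂ ?_
      · rw [Finset.mem_product, hS₁, hS₂] at hp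
        rw [Valuation.map_sub_swap]
        exact h.symm.valuation_sub_special hv hu ha hat₂ hp.2 hp.1
      · obtain ⟨c1, c2, hs, ht⟩ := (hM c).1 hc
        have := h.symm.transcendental_of_mem_matchingSet (c :=
            (c.2, c.1)) ⟨c2, c1, hs.symm, ht.symm⟩
        rwa [← he, hs, ht]
  · refine special (fun p hp => ?_) fun c hc he => hat₁ ?_
    · rw [Finset.mem_product, hS₁, hS₂] at hp
      exact h.valuation_sub_special hv hu ha hat₁ hp.1 hp.2
    · rw [← he]
      exact h.transcendental_of_mem_matchingSet ((hM c).1 hc)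

end GenericSplit

section action

variable {C K : Type*} [Field C] [Field K] [Algebra (RatFunc C) K] [Algebra C K]
  [IsScalarTower C (RatFunc C) K] {H : GeoGraph} {μ : Finset ℕ → C}

/-- The action of an automorphism on tuples of points. -/
def realizationEquiv (σ : K ≃+* K) : (ℕ → Fin 3 → K) ≃ (ℕ → Fin 3 → K) :=
  .arrowCongr (.refl ℕ) (.arrowCongr (.refl (Fin 3)) σ.toEquiv)

theorem bil_realizationEquiv (σ : K ≃+* K) (ρ : ℕ → Fin 3 → K) (x y : ℕ) :
    bil (realizationEquiv σ ρ x) (realizationEquiv σ ρ y) = σ (bil (ρ x) (ρ y)) :=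
  (map_bil σ _ _).symm

theorem mem_sectionSet_realizationEquiv (σ : K ≃+* K) {ν : Finset ℕ → K} {u : K}
    {ρ : ℕ → Fin 3 → K} : realizationEquiv σ ρ ∈ sectionSet H (fun e => σ (ν e)) (σ u) ↔
      ρ ∈ sectionSet H ν u := by
  have e1 : IsSol H (fun e => σ (ν e)) (realizationEquiv σ ρ) ↔ IsSol H ν ρ :=
    isSol_map_iff (σ : K →+* K)
  rw [sectionSet, sectionSet, Set.mem_ofPred_eq, Set.mem_ofPred_eq, e1, bil_realizationEquiv,
    bil_realizationEquiv, ← map_add, σ.injective.eq_iff]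

theorem algEquiv_algebraMap (σ : K ≃ₐ[RatFunc C] K) (c : C) :
    σ (algebraMap C K c) = algebraMap C K c := by
  rw [IsScalarTower.algebraMap_apply C (RatFunc C) K, σ.commutes]

theorem realizationEquiv_mem_iff {S : Finset (ℕ → Fin 3 → K)}
    (hS : ∀ ρ, ρ ∈ S ↔ ρ ∈ sectionSet H (liftEdge K μ) (ratGen C K)) (σ : K ≃ₐ[RatFunc C] K)
    (ρ : ℕ → Fin 3 → K) : realizationEquiv (σ : K ≃+* K) ρ ∈ S ↔ ρ ∈ S := by
  rw [hS, hS]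
  have e1 : liftEdge K μ = fun e => (σ : K ≃+* K) (liftEdge K μ e) :=
    funext fun e => (algEquiv_algebraMap σ _).symm
  have e2 : (σ : K ≃+* K) (ratGen C K) = ratGen C K := σ.commutes _
  conv_lhs => rw [e1, ← e2]
  exact mem_sectionSet_realizationEquiv _

theorem prod_diagonal_fixed {S : Finset (ℕ → Fin 3 → K)}
    (hS : ∀ ρ, ρ ∈ S ↔ ρ ∈ sectionSet H (liftEdge K μ) (ratGen C K)) (σ : K ≃ₐ[RatFunc C] K)
    (i : ℕ) : σ (∏ ρ ∈ S, bil (ρ 0) (ρ i)) = ∏ ρ ∈ S, bil (ρ 0) (ρ i) := by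
  rw [map_prod]
  refine Finset.prod_equiv (realizationEquiv (σ : K ≃+* K))
    (fun ρ => (realizationEquiv_mem_iff hS σ ρ).symm) fun ρ _ => ?_
  rw [bil_realizationEquiv]; rfl

theorem resultant_fixed {H₁ H₂ : GeoGraph} {S₁ S₂ : Finset (ℕ → Fin 3 → K)}
    (hS₁ : ∀ ρ, ρ ∈ S₁ ↔ ρ ∈ sectionSet H₁ (liftEdge K μ) (ratGen C K))
    (hS₂ : ∀ ρ, ρ ∈ S₂ ↔ ρ ∈ sectionSet H₂ (liftEdge K μ) (ratGen C K)) (σ : K ≃ₐ[RatFunc C] K) :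
    σ (GenericSplit.resultant S₁ S₂) = GenericSplit.resultant S₁ S₂ := by
  rw [GenericSplit.resultant, map_prod]
  refine Finset.prod_equiv ((realizationEquiv (σ : K ≃+* K)).prodCongr
    (realizationEquiv (σ : K ≃+* K))) (fun p => ?_) fun p _ => ?_
  · rw [Finset.mem_product, Finset.mem_product]
    exact (and_congr (realizationEquiv_mem_iff hS₁ σ _) (realizationEquiv_mem_iff hS₂ σ _)).symm
  · simp only [Equiv.prodCongr_apply, Prod.map_fst, Prod.map_snd, bil_realizationEquiv, map_sub]
    rfl

theorem matchProd_fixed (M : Finset ((ℕ → Fin 3 → C) × (ℕ → Fin 3 → C)))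
    (σ : K ≃ₐ[RatFunc C] K) :
    σ (GenericSplit.matchProd (ratGen C K) M) = GenericSplit.matchProd (ratGen C K) M := by
  rw [GenericSplit.matchProd, map_prod]
  refine Finset.prod_congr rfl fun c _ => ?_
  rw [map_sub, algEquiv_algebraMap]
  exact congrArg (· - _) (σ.commutes _)

theorem valuation_matchProd_infinity {Γ : Type*} [LinearOrderedCommGroupWithZero Γ]
    {v : Valuation K Γ} (hv : TrivialOn C v) {u : K} (h1 : 1 < v u)
    (M : Finset ((ℕ → Fin 3 → C) × (ℕ → Fin 3 → C))) :
    v (GenericSplit.matchProd u M) = v u ^ (M.card : ℤ) := by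
  rw [GenericSplit.matchProd, map_prod, Finset.prod_congr rfl (g := fun _ => v u),
    Finset.prod_const, zpow_natCast]
  intro c _
  exact Valuation.map_sub_eq_of_lt_left _ ((hv.le_one _).trans_lt h1)

end action

namespace GenericSplit

variable {κ₀ κ₁ κ₂ C K : Type*} [Field κ₀] [Field κ₁] [Field κ₂] [Field C] [Field K]
  [Algebra κ₀ κ₁] [Algebra κ₀ κ₂]
  [Algebra κ₀ C] [Algebra κ₁ C] [Algebra κ₂ C] [Algebra C K] [Algebra κ₀ K] [Algebra κ₁ K]
  [Algebra κ₂ K] [IsScalarTower κ₀ κ₁ C] [IsScalarTower κ₀ κ₂ C] [IsScalarTower κ₀ κ₁ K]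
  [IsScalarTower κ₀ κ₂ K]
  [IsScalarTower κ₀ C K] [IsScalarTower κ₁ C K] [IsScalarTower κ₂ C K]
  {G H₁ H₂ : GeoGraph} {μ : Finset ℕ → C} {k : κ₀} [CharZero κ₀] [CharZero κ₁] [CharZero κ₂]
  [CharZero C] [CharZero K]
  [IsAlgClosed κ₁] [IsAlgClosed κ₂] [IsAlgClosed C] [IsAlgClosed K]
  [Algebra (RatFunc C) K] [IsScalarTower C (RatFunc C) K] [Algebra.IsAlgebraic (RatFunc C) K]

theorem finite_isSol (h : GenericSplit κ₀ κ₁ κ₂ G H₁ H₂ μ k) : {ρ | IsSol G μ ρ}.Finite :=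
  G.finite_isSol (h.split.mem_edge_iff.2 (Or.inl h.fst.pre.mem)) h.tight h.fst.base h.indep

theorem finite_matchingSet (h : GenericSplit κ₀ κ₁ κ₂ G H₁ H₂ μ k) :
    (matchingSet H₁ H₂ μ).Finite :=
  _root_.finite_matchingSet h.split h.fst.pre h.snd.pre (base_sub_ne h.fst).1 (base_sub_ne h.fst).2
    rfl h.finite_isSol

theorem ncard_matchingSet (h : GenericSplit κ₀ κ₁ κ₂ G H₁ H₂ μ k) :
    (matchingSet H₁ H₂ μ).ncard = 2 * {ρ | IsSol G μ ρ}.ncard := by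
  refine _root_.ncard_matchingSet h.split h.fst.pre h.snd.pre (base_sub_ne h.fst).1
    (base_sub_ne h.fst).2 rfl fun ρ hρ => ?_
  rw [← h.fst.base]
  exact hρ.ne_of_generic (h.split.mem_edge_iff.2 (Or.inl h.fst.pre.mem)) h.tight h.fst.base
    h.fst.ne h.indep (h.split.mem_iff.2 (Or.inl h.fst.pre.zero_mem))

/-- The number of realizations in terms of the intersection data of the two parts. -/
theorem card_formula (h : GenericSplit κ₀ κ₁ κ₂ G H₁ H₂ μ k) {A : ValuationSubring K}
    (hA : TrivialOn C A.valuation) (h1 : 1 < A.valuation (ratGen C K))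
    {S₁ S₂ : Finset (ℕ → Fin 3 → K)}
    (hS₁ : ∀ ρ, ρ ∈ S₁ ↔ ρ ∈ sectionSet H₁ (liftEdge K μ) (ratGen C K))
    (hS₂ : ∀ ρ, ρ ∈ S₂ ↔ ρ ∈ sectionSet H₂ (liftEdge K μ) (ratGen C K)) :
    (2 * {ρ | IsSol G μ ρ}.ncard : ℤ) = S₁.card * S₂.card -
      finiteCount A.valuation S₁ 1 * finiteCount A.valuation S₂ 1 -
      finiteCount A.valuation S₁ 2 * finiteCount A.valuation S₂ 2 := by
  have hu := transcendental_ratGen C K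
  set M := h.finite_matchingSet.toFinset with hMdef
  have hM : ∀ c, c ∈ M ↔ c ∈ matchingSet H₁ H₂ μ := fun c => Set.Finite.mem_toFinset _
  have hMc : (M.card : ℤ) = 2 * {ρ | IsSol G μ ρ}.ncard := by
    rw [hMdef, ← Set.ncard_eq_toFinset_card _ h.finite_matchingSet, h.ncard_matchingSet]; push_cast;
        rfl
  have hQ0 : matchProd (ratGen C K) M ≠ 0 := by
    rw [matchProd, Finset.prod_ne_zero_iff]
    intro c _ h0
    rw [sub_eq_zero] at h0
    exact hu (h0 ▸ isAlgebraic_algebraMap _)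
  obtain ⟨f, hf⟩ := exists_algebraMap_ratFunc_eq (C := C)
    (y := resultant S₁ S₂ / matchProd (ratGen C K) M) fun σ => by
      rw [map_div₀, resultant_fixed hS₁ hS₂, matchProd_fixed]
  obtain ⟨c, hc, hfc⟩ := exists_algebraMap_eq_of_forall_place (K := K) f fun a => by
    obtain ⟨B, hB, hlt⟩ := exists_valuationSubring_lt_one (κ := C)
      (y := ratGen C K - algebraMap C K a) (fun h => hu (by
        simpa using h.add (isAlgebraic_algebraMap a)))
    refine ⟨B, hB, hlt, ?_⟩
    rw [hf, map_div₀, h.valuation_resultant_finite hB hu hlt hS₁ hS₂ hM, div_self]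
    exact (map_ne_zero _).2 hQ0
  have key : A.valuation (resultant S₁ S₂) = A.valuation (matchProd (ratGen C K) M) := by
    rw [hf, div_eq_iff hQ0] at hfc
    rw [hfc, map_mul, hA c hc, one_mul]
  rw [h.valuation_resultant_infinity hA hu h1 (fun ρ => (hS₁ ρ).1) (fun ρ => (hS₂ ρ).1),
    valuation_matchProd_infinity hA h1] at key
  rw [← hMc]
  exact (zpow_right_injective₀ (zero_lt_one.trans h1) h1.ne' key).symm

end GenericSplit

namespace GenericOver

variable {κ₀ κ C K : Type*} [Field κ₀] [Field κ] [Field C] [Field K] [Algebra κ₀ κ]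
  [Algebra κ₀ C] [Algebra κ C] [Algebra C K] [Algebra κ₀ K] [Algebra κ K]
  [IsScalarTower κ₀ κ C] [IsScalarTower κ₀ C K] [IsScalarTower κ₀ κ K] [IsScalarTower κ C K]
  [CharZero κ₀] [CharZero κ] [CharZero C] [CharZero K]
  {H : GeoGraph} {μ : Finset ℕ → C} {k : κ₀} {u : K} {S : Finset (ℕ → Fin 3 → K)}

theorem base_sub_lift_ne (h : GenericOver κ₀ κ H μ k) :
    liftEdge K μ {1, 2} - 1 ≠ 0 ∧ liftEdge K μ {1, 2} + 1 ≠ 0 := by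
  rw [← h.algebraMap_base]
  constructor <;> intro h0 <;> apply h.ne <;> apply (algebraMap κ₀ K).injective <;>
    rw [map_pow, map_one]
  · linear_combination (algebraMap κ₀ K k + 1) * h0
  · linear_combination (algebraMap κ₀ K k - 1) * h0

/-- A family of realizations in a section which is closed under reflection is even. -/
theorem even_card (h : GenericOver κ₀ κ H μ k) (hu : Transcendental κ u)
    (hS : ∀ ρ ∈ S, ρ ∈ sectionSet H (liftEdge K μ) u)
    (hr : ∀ ρ ∈ S, (fun w => reflect (liftEdge K μ {1, 2}) (ρ w)) ∈ S) : Even S.card := by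
  obtain ⟨h1, h2⟩ := h.base_sub_lift_ne (K := K)
  have : (S.card : ZMod 2) = 0 := by
    rw [Finset.card_eq_sum_ones, Nat.cast_sum]
    refine Finset.sum_involution (fun ρ _ w => reflect (liftEdge K μ {1, 2}) (ρ w))
      (fun _ _ => by decide) (fun ρ hρ _ h0 => ?_) hr
      fun ρ _ => funext fun w => reflect_reflect h1 h2 _
    refine (hS ρ hρ).1.section_ne_of_generic h.pre h.algebraMap_base (hS ρ hρ).2
      (h.indep_lift.option_of_transcendental (fun e => h.mem_lift e.2.1) hu) h.ne ?_
    rw [h.algebraMap_base]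
    exact (reflect_eq_self_iff h1 h2).1 (congrFun h0 0)
  exact even_iff_two_dvd.2 ((ZMod.natCast_eq_zero_iff _ _).1 this)

theorem reflect_mem (h : GenericOver κ₀ κ H μ k)
    {ρ : ℕ → Fin 3 → K} (hρ : ρ ∈ sectionSet H (liftEdge K μ) u) :
    (fun w => reflect (liftEdge K μ {1, 2}) (ρ w)) ∈ sectionSet H (liftEdge K μ) u := by
  obtain ⟨h1, h2⟩ := h.base_sub_lift_ne (K := K)
  exact ⟨hρ.1.reflect h1 h2 rfl, by simpa only [bil_reflect h1 h2] using hρ.2⟩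

theorem even_card_section (h : GenericOver κ₀ κ H μ k) (hu : Transcendental κ u)
    (hS : ∀ ρ, ρ ∈ S ↔ ρ ∈ sectionSet H (liftEdge K μ) u) : Even S.card :=
  h.even_card hu (fun ρ hρ => (hS ρ).1 hρ) fun ρ hρ => (hS _).2 (h.reflect_mem ((hS ρ).1 hρ))

theorem even_finiteCount {Γ : Type*} [LinearOrderedCommGroupWithZero Γ] {v : Valuation K Γ}
    (h : GenericOver κ₀ κ H μ k) (hu : Transcendental κ u)
    (hS : ∀ ρ, ρ ∈ S ↔ ρ ∈ sectionSet H (liftEdge K μ) u) (i : ℕ) :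
    Even (GenericSplit.finiteCount v S i) := by
  classical
  obtain ⟨h1, h2⟩ := h.base_sub_lift_ne (K := K)
  refine h.even_card hu (fun ρ hρ => (hS ρ).1 (Finset.mem_filter.1 hρ).1) fun ρ hρ => ?_
  rw [Finset.mem_filter] at hρ ⊢
  refine ⟨(hS _).2 (h.reflect_mem ((hS ρ).1 hρ.1)), ?_⟩
  rw [bil_reflect h1 h2]
  exact hρ.2

variable [Algebra (RatFunc C) K] [IsScalarTower C (RatFunc C) K] [Algebra.IsAlgebraic (RatFunc C) K]
  [IsAlgClosed C] [IsAlgClosed K]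

open GenericSplit in
/-- The number of realizations with a finite diagonal does not depend on the place. -/
theorem finiteCount_eq (h : GenericOver κ₀ κ H μ k)
    (hS : ∀ ρ, ρ ∈ S ↔ ρ ∈ sectionSet H (liftEdge K μ) (ratGen C K)) {A B : ValuationSubring K}
    (hA : TrivialOn C A.valuation) (hA1 : 1 < A.valuation (ratGen C K))
    (hB : TrivialOn C B.valuation) (hB1 : 1 < B.valuation (ratGen C K)) {i : ℕ}
    (hi : i = 1 ∨ i = 2) : finiteCount A.valuation S i = finiteCount B.valuation S i := by
  classical
  have key : ∀ D : ValuationSubring K, TrivialOn C D.valuation → 1 < D.valuation (ratGen C K) →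
      D.valuation (∏ ρ ∈ S, bil (ρ 0) (ρ i)) =
        D.valuation (ratGen C K) ^ ((S.card : ℤ) - finiteCount D.valuation S i) := by
    intro D hD hD1
    have ht : ∀ ρ ∈ S, D.valuation (bil (ρ 0) (ρ i)) =
        if D.valuation (bil (ρ 0) (ρ i)) ≤ 1 then 1 else D.valuation (ratGen C K) := by
      intro ρ hρ
      have hρ' := (hS ρ).1 hρ
      have := hρ'.1.weak_types h.pre h.indep h.base h.ne hD hρ'.2 hD1
      rcases hi with rfl | rfl <;> rcases this with ⟨h1, h2⟩ | ⟨h1, h2⟩ | ⟨h1, h2⟩ <;>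
        first
        | rw [h1, if_neg hD1.not_ge]
        | rw [h2, if_neg hD1.not_ge]
        | rw [h1, if_pos le_rfl]
        | rw [h2, if_pos le_rfl]
    rw [map_prod, Finset.prod_congr rfl ht, Finset.prod_ite, Finset.prod_const_one, one_mul,
      Finset.prod_const, ← zpow_natCast]
    congr 1
    rw [finiteCount, ← Finset.card_filter_add_card_filter_not (s := S)
      (fun ρ => D.valuation (bil (ρ 0) (ρ i)) ≤ 1)]
    push_cast; ring
  obtain ⟨f, hf⟩ := exists_algebraMap_ratFunc_eq (C := C) (y := ∏ ρ ∈ S, bil (ρ 0) (ρ i))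
    fun σ => prod_diagonal_fixed hS σ i
  have hf0 : f ≠ 0 := by
    rintro rfl
    have h1 := key A hA hA1
    rw [← hf, map_zero, map_zero] at h1
    exact zpow_ne_zero _ (zero_lt_one.trans hA1).ne' h1.symm
  obtain ⟨n, hn⟩ := exists_degree (K := K) f hf0
  have inj : ∀ D : ValuationSubring K, TrivialOn C D.valuation → 1 < D.valuation (ratGen C K) →
      (S.card : ℤ) - finiteCount D.valuation S i = n := by
    intro D hD hD1
    have h1 := key D hD hD1
    rw [← hf, hn D hD hD1] at h1
    exact (zpow_right_injective₀ (zero_lt_one.trans hD1) hD1.ne' h1).symm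
  have := inj A hA hA1
  have := inj B hB hB1
  omega

end GenericOver

section automorphism

theorem IsTranscendenceBasis.exists_ringEquiv {R K ι : Type*} [CommRing R] [IsDomain R] [Field K]
    [Algebra R K] [IsAlgClosed K] {v w : ι → K} (hv : IsTranscendenceBasis R v)
    (hw : IsTranscendenceBasis R w) : ∃ θ : K ≃+* K, ∀ i, θ (v i) = w i := by
  let := IsAlgClosed.isAlgClosure_of_transcendence_basis v hv
  let := IsAlgClosed.isAlgClosure_of_transcendence_basis w hw
  refine ⟨IsAlgClosure.equivOfEquiv K K
    (hv.1.aevalEquiv.symm.trans hw.1.aevalEquiv).toRingEquiv, fun i => ?_⟩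
  have h1 : v i = algebraMap (Algebra.adjoin R (Set.range v)) K
      (hv.1.aevalEquiv (MvPolynomial.X i)) := by simp
  have h2 : w i = algebraMap (Algebra.adjoin R (Set.range w)) K
      (hw.1.aevalEquiv (MvPolynomial.X i)) := by simp
  rw [h1, IsAlgClosure.equivOfEquiv_algebraMap, h2]
  simp

/-- Finite algebraically independent families in an algebraically closed field are conjugate. -/
theorem AlgebraicIndependent.exists_ringEquiv.{u, v, w} {R : Type w} {K : Type u} {η : Type v}
    [Field R] [Field K] [Algebra R K]
    [IsAlgClosed K] [Finite η] {x y : η → K} (hx : AlgebraicIndependent R x)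
    (hy : AlgebraicIndependent R y) : ∃ θ : K ≃+* K, ∀ i, θ (x i) = y i := by
  have ext : ∀ {z : η → K}, AlgebraicIndependent R z → ∃ B : Set K,
      IsTranscendenceBasis R (Sum.elim z ((↑) : B → K)) := by
    intro z hz
    obtain ⟨t, ht, htb⟩ := exists_isTranscendenceBasis_superset hz.coe_range
    classical
    refine ⟨(t \ Set.range z : Set K), (isTranscendenceBasis_equiv' (((Equiv.ofInjective z
        hz.injective).sumCongr
      (.refl _)).trans (Equiv.Set.sumDiffSubset ht)) (g := Sum.elim z Subtype.val) ?_).2 htb⟩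
    funext i
    rcases i with i | i <;> simp
  obtain ⟨B, hB⟩ := ext hx
  obtain ⟨D, hD⟩ := ext hy
  obtain ⟨e⟩ : Nonempty (B ≃ D) := by
    rw [← Cardinal.eq, ← Cardinal.lift_inj.{u, v}]
    have h1 := hB.cardinalMk_eq hD
    have := Fintype.ofFinite η
    rw [Cardinal.mk_sum, Cardinal.mk_sum, Cardinal.mk_fintype η, Cardinal.lift_natCast,
      add_comm, add_comm (Fintype.card η : Cardinal)] at h1
    exact (Cardinal.add_nat_inj _).1 h1
  have hD' := (hD.comp_equiv (Equiv.sumCongr (Equiv.refl η) e))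
  obtain ⟨θ, hθ⟩ := hB.exists_ringEquiv hD'
  exact ⟨θ, fun i => hθ (Sum.inl i)⟩

end automorphism

section counts

variable {C K : Type*} [Field C] [Field K] [Algebra C K] [Algebra (RatFunc C) K]
  [IsScalarTower C (RatFunc C) K] {H : GeoGraph} {μ ν : Finset ℕ → C}

/-- The intersection data of the realization curve of `H`: the number of realizations in a generic
section by the sum of the diagonals, and the numbers of those that have a finite diagonal at
infinity. -/
def HasCounts (K : Type*) {C : Type*} [Field C] [Field K] [Algebra C K] [Algebra (RatFunc C) K]
    (H : GeoGraph) (μ : Finset ℕ → C) (c : ℕ × ℕ × ℕ) : Prop :=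
  ∀ (S : Finset (ℕ → Fin 3 → K)) (A : ValuationSubring K),
    (∀ ρ, ρ ∈ S ↔ ρ ∈ sectionSet H (liftEdge K μ) (ratGen C K)) → TrivialOn C A.valuation →
    1 < A.valuation (ratGen C K) → S.card = c.1 ∧ GenericSplit.finiteCount A.valuation S 1 = c.2.1 ∧
      GenericSplit.finiteCount A.valuation S 2 = c.2.2

theorem exists_ringEquiv_extending [IsAlgClosed K] [Algebra.IsAlgebraic (RatFunc C) K]
    (θ : C ≃+* C) : ∃ Θ : K ≃+* K, (∀ c, Θ (algebraMap C K c) = algebraMap C K (θ c)) ∧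
      Θ (ratGen C K) = ratGen C K := by
  have : IsAlgClosure (RatFunc C) K := ⟨inferInstance, inferInstance⟩
  let e : RatFunc C ≃+* RatFunc C :=
    IsFractionRing.ringEquivOfRingEquiv (Polynomial.mapEquiv θ)
  have he (p : Polynomial C) : e (algebraMap _ _ p) = algebraMap _ _ (p.map (θ : C →+* C)) :=
    IsFractionRing.ringEquivOfRingEquiv_algebraMap _ _
  refine ⟨IsAlgClosure.equivOfEquiv K K e, fun c => ?_, ?_⟩
  · rw [IsScalarTower.algebraMap_apply C (RatFunc C) K, IsAlgClosure.equivOfEquiv_algebraMap,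
      IsScalarTower.algebraMap_apply C (RatFunc C) K]
    congr 1
    have := he (Polynomial.C c)
    rw [Polynomial.map_C] at this
    simpa using this
  · rw [ratGen, IsAlgClosure.equivOfEquiv_algebraMap]
    congr 1
    have := he Polynomial.X
    rw [Polynomial.map_X] at this
    simpa using this

theorem ValuationSubring.valuation_comap_le_one_iff (A : ValuationSubring K) (Θ : K ≃+* K) (x : K) :
    (A.comap (Θ : K →+* K)).valuation x ≤ 1 ↔ A.valuation (Θ x) ≤ 1 := by
  rw [ValuationSubring.valuation_le_one_iff, ValuationSubring.valuation_le_one_iff,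
    ValuationSubring.mem_comap]; rfl

theorem TrivialOn.of_le_one {κ F Γ : Type*} [Field κ] [Field F] [Algebra κ F]
    [LinearOrderedCommGroupWithZero Γ] {v : Valuation F Γ}
    (h : ∀ c : κ, v (algebraMap κ F c) ≤ 1) : TrivialOn κ v := by
  intro c hc
  refine le_antisymm (h c) ?_
  have h1 := h c⁻¹
  rw [map_inv₀, map_inv₀] at h1
  have h0 : 0 < v (algebraMap κ F c) := zero_lt_iff.2 (by simpa using hc)
  exact (inv_le_one₀ h0).1 h1

open GenericSplit in
theorem HasCounts.of_ringEquiv [IsAlgClosed K] [Algebra.IsAlgebraic (RatFunc C) K]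
    {c : ℕ × ℕ × ℕ} (hc : HasCounts K H μ c) (h12 : {1, 2} ∈ H.E) (θ : C ≃+* C)
    (hθ : ∀ e ∈ H.E, θ (μ e) = ν e) : HasCounts K H ν c := by
  classical
  intro S A hS hA hA1
  obtain ⟨Θ, hΘ, hΘu⟩ := exists_ringEquiv_extending (K := K) θ
  let T : Finset (ℕ → Fin 3 → K) := S.map (realizationEquiv Θ).symm.toEmbedding
  have hTS : S = T.map (realizationEquiv Θ).toEmbedding := by
    ext ρ; simp [T]
  have hcount (i : ℕ) : finiteCount A.valuation S i =
      finiteCount (A.comap (Θ : K →+* K)).valuation T i := by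
    rw [finiteCount, finiteCount, hTS, Finset.filter_map, Finset.card_map]
    congr 1
    refine Finset.filter_congr fun ρ _ => ?_
    rw [ValuationSubring.valuation_comap_le_one_iff, ← bil_realizationEquiv]
    rfl
  have hcard : S.card = T.card := (Finset.card_map _).symm
  rw [hcount, hcount, hcard]
  refine hc T _ (fun ρ => ?_) (.of_le_one fun a => ?_) ?_
  · have h1 : ρ ∈ T ↔ realizationEquiv Θ ρ ∈ S := by
      rw [hTS]; simp
    rw [h1, hS]
    rw [← mem_sectionSet_realizationEquiv Θ (ρ := ρ), hΘu]
    refine and_congr ⟨fun h => h.congr h12 fun e he => ?_, fun h => h.congr h12 fun e he => ?_⟩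
        Iff.rfl
    · rw [liftEdge, liftEdge, hΘ, hθ e he]
    · rw [liftEdge, liftEdge, hΘ, hθ e he]
  · rw [ValuationSubring.valuation_comap_le_one_iff, hΘ]
    exact hA.le_one _
  · rw [← not_le, ValuationSubring.valuation_comap_le_one_iff, hΘu, not_le]
    exact hA1

/-- The intersection data do not depend on the generic edge data. -/
theorem HasCounts.of_algebraicIndependent [IsAlgClosed C] [IsAlgClosed K]
    [Algebra.IsAlgebraic (RatFunc C) K] {R : Type*} [Field R] [Algebra R C] {c : ℕ × ℕ × ℕ}
    (hc : HasCounts K H μ c) (h12 : {1, 2} ∈ H.E)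
    (hμ : AlgebraicIndependent R fun e : H.E => μ e.1)
    (hν : AlgebraicIndependent R fun e : H.E => ν e.1) : HasCounts K H ν c := by
  obtain ⟨θ, hθ⟩ := hμ.exists_ringEquiv hν
  exact hc.of_ringEquiv h12 θ fun e he => hθ ⟨e, he⟩

variable [IsAlgClosed K] [IsAlgClosed C] [Algebra.IsAlgebraic (RatFunc C) K] [CharZero C]
  [CharZero K]

variable (C K) in
theorem exists_place_at_infinity :
    ∃ A : ValuationSubring K, TrivialOn C A.valuation ∧ 1 < A.valuation (ratGen C K) := by
  have hu : Transcendental C (ratGen C K)⁻¹ := fun h =>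
    transcendental_ratGen C K (inv_inv (ratGen C K) ▸ h.inv)
  obtain ⟨A, hA, h1⟩ := exists_valuationSubring_lt_one hu
  refine ⟨A, hA, ?_⟩
  rw [map_inv₀] at h1
  refine (inv_lt_one₀ (zero_lt_iff.2 ?_)).1 h1
  rw [Valuation.ne_zero_iff]
  rintro h0
  exact transcendental_ratGen C K (h0 ▸ isAlgebraic_zero)

theorem GenericOver.exists_hasCounts {κ₀ κ : Type*} [Field κ₀] [Field κ] [Algebra κ₀ κ]
    [Algebra κ₀ C] [Algebra κ C] [Algebra κ₀ K] [Algebra κ K]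
    [IsScalarTower κ₀ κ C] [IsScalarTower κ₀ C K] [IsScalarTower κ₀ κ K] [IsScalarTower κ C K]
    [CharZero κ₀] [CharZero κ] {k : κ₀} (h : GenericOver κ₀ κ H μ k) :
    ∃ a b c : ℕ, HasCounts K H μ (2 * a, 2 * b, 2 * c) := by
  have hu : Transcendental κ (ratGen C K) := (transcendental_ratGen C K).of_tower_top κ
  obtain ⟨A, hA, hA1⟩ := exists_place_at_infinity C K
  have hS : ∀ ρ, ρ ∈ (h.finite_sectionSet hu).toFinset ↔
    ρ ∈ sectionSet H (liftEdge K μ) (ratGen C K) := fun ρ => Set.Finite.mem_toFinset _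
  obtain ⟨a, ha⟩ := h.even_card_section hu hS
  obtain ⟨b, hb⟩ := h.even_finiteCount (v := A.valuation) hu hS 1
  obtain ⟨c, hc⟩ := h.even_finiteCount (v := A.valuation) hu hS 2
  refine ⟨a, b, c, fun T B hT hB hB1 => ?_⟩
  have e : T = (h.finite_sectionSet hu).toFinset := by
    ext ρ; rw [hT, hS]
  rw [e, h.finiteCount_eq hS hB hB1 hA hA1 (Or.inl rfl),
    h.finiteCount_eq hS hB hB1 hA hA1 (Or.inr rfl)]
  dsimp only
  omega

end counts

section quadrics

variable {F : Type*} [Field F]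

/-- A multiple of the vector product for `bil`. -/
def normal (p q : Fin 3 → F) : Fin 3 → F :=
  ![-(p 0 * q 1 - p 1 * q 0) / 2, p 2 * q 0 - p 0 * q 2, -(p 1 * q 2 - p 2 * q 1) / 2]

theorem bil_combination (a b c d : F) (p q n x : Fin 3 → F) :
    bil (fun i => d * (a * p i + b * q i - c * n i)) x =
      d * (a * bil p x + b * bil q x - c * bil n x) := by
  simp [bil]; ring

variable [CharZero F]

theorem bil_normal_left (p q : Fin 3 → F) : bil p (normal p q) = 0 := by
  simp [bil, normal]; ring

theorem bil_normal_right (p q : Fin 3 → F) : bil q (normal p q) = 0 := by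
  simp [bil, normal]; ring

theorem bil_normal_normal (p q : Fin 3 → F) :
    bil (normal p q) (normal p q) = -(bil p p * bil q q - bil p q ^ 2) / 4 := by
  simp [bil, normal]; ring

theorem expansion (x p q : Fin 3 → F) (i : Fin 3) :
    (bil p p * bil q q - bil p q ^ 2) * x i = (bil x p * bil q q - bil x q * bil p q) * p i +
      (bil x q * bil p p - bil x p * bil p q) * q i - 4 * bil x (normal p q) * normal p q i := by
  fin_cases i <;> simp [bil, normal] <;> ring

theorem gram (x p q : Fin 3 → F) :
    4 * bil x (normal p q) ^ 2 = -((bil p p * bil q q - bil p q ^ 2) * bil x x -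
      (bil x p ^ 2 * bil q q - 2 * bil x p * bil x q * bil p q + bil x q ^ 2 * bil p p)) := by
  simp [bil, normal]; ring

/-- A generic line in the polar sense meets the unit quadric in two points. -/
theorem exists_two_points [IsAlgClosed F] {p q : Fin 3 → F} {m n : F}
    (hD : bil p p * bil q q - bil p q ^ 2 ≠ 0)
    (hG : bil p p * bil q q - bil p q ^ 2 - (m ^ 2 * bil q q - 2 * m * n * bil p q +
      n ^ 2 * bil p p) ≠ 0) :
    ∃ f : Bool → Fin 3 → F, f.Injective ∧
      ∀ x, (∃ b, f b = x) ↔ bil x x = 1 ∧ bil x p = m ∧ bil x q = n := by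
  obtain ⟨r, hr⟩ := IsAlgClosed.exists_pow_nat_eq (-(bil p p * bil q q - bil p q ^ 2 -
    (m ^ 2 * bil q q - 2 * m * n * bil p q + n ^ 2 * bil p p)) / 4) two_pos
  set D := bil p p * bil q q - bil p q ^ 2 with hDdef
  have hr0 : r ≠ 0 := by
    rintro rfl
    apply hG
    linear_combination 4 * hr
  let g : F → Fin 3 → F := fun z i => D⁻¹ * ((m * bil q q - n * bil p q) * p i +
    (n * bil p p - m * bil p q) * q i - 4 * z * normal p q i)
  have hg1 (z : F) : bil (g z) p = m := by
    simp only [g]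
    rw [bil_combination, bil_comm (normal p q), bil_normal_left, bil_comm q p]
    field_simp
    rw [hDdef]; ring
  have hg2 (z : F) : bil (g z) q = n := by
    simp only [g]
    rw [bil_combination, bil_comm (normal p q), bil_normal_right]
    field_simp
    rw [hDdef]; ring
  have hg3 (z : F) : bil (g z) (normal p q) = z := by
    simp only [g]
    rw [bil_combination, bil_normal_left, bil_normal_right, bil_normal_normal, ← hDdef]
    field_simp
    ring
  have hg (z : F) (hz : z ^ 2 = r ^ 2) (x : Fin 3 → F) :
      x = g z ↔ bil x x = 1 ∧ bil x p = m ∧ bil x q = n ∧ bil x (normal p q) = z := by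
    constructor
    · rintro rfl
      refine ⟨?_, hg1 z, hg2 z, hg3 z⟩
      have := gram (g z) p q
      rw [hg1, hg2, hg3, hz, hr, ← hDdef] at this
      apply mul_left_cancel₀ hD
      linear_combination this
    · rintro ⟨-, h1, h2, h3⟩
      ext i
      apply mul_left_cancel₀ hD
      rw [expansion x p q i, h1, h2, h3]
      simp only [g]
      field_simp
  refine ⟨fun b => g (if b then r else -r), fun b b' h => ?_, fun x => ⟨?_, ?_⟩⟩
  · have h1 := congrArg (fun y => bil y (normal p q)) h
    simp only [hg3] at h1
    have h2 : r ≠ -r := fun h => hr0 (by linear_combination (1 / 2 : F) * h)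
    cases b <;> cases b' <;> simp_all
  · rintro ⟨b, rfl⟩
    have := (hg (if b then r else -r) (by split_ifs <;> ring) _).1 rfl
    exact ⟨this.1, this.2.1, this.2.2.1⟩
  · rintro ⟨h1, h2, h3⟩
    have h4 : bil x (normal p q) ^ 2 = r ^ 2 := by
      have := gram x p q
      rw [h1, h2, h3, ← hDdef] at this
      rw [hr]
      linear_combination this / 4
    rcases sq_eq_sq_iff_eq_or_eq_neg.1 h4 with h | h
    · exact ⟨true, ((hg r rfl x).2 ⟨h1, h2, h3, h⟩).symm⟩
    · exact ⟨false, ((hg (-r) (by ring) x).2 ⟨h1, h2, h3, h⟩).symm⟩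

/-- Two points on the unit quadric which have finite products with two independent points have a
finite product. -/
theorem valuation_bil_le_one_of_polar {Γ : Type*} [LinearOrderedCommGroupWithZero Γ] {v : Valuation
    F Γ}
    {p q x y : Fin 3 → F} (hD : v (bil p p * bil q q - bil p q ^ 2) = 1) (hpp : v (bil p p) ≤ 1)
    (hqq : v (bil q q) ≤ 1) (hpq : v (bil p q) ≤ 1) (hxx : v (bil x x) ≤ 1) (hxp : v (bil x p) ≤ 1)
    (hxq : v (bil x q) ≤ 1) (hyy : v (bil y y) ≤ 1) (hyp : v (bil y p) ≤ 1)
    (hyq : v (bil y q) ≤ 1) : v (bil x y) ≤ 1 := by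
  have h2 : (2 : F) ∈ v.integer := natCast_mem v.integer 2
  have key (z : Fin 3 → F) (hzz : bil z z ∈ v.integer) (hzp : bil z p ∈ v.integer)
      (hzq : bil z q ∈ v.integer) : 2 * bil z (normal p q) ∈ v.integer := by
    have h1 : (2 * bil z (normal p q)) ^ 2 ∈ v.integer := by
      rw [mul_pow, show (2 : F) ^ 2 = 4 by norm_num, gram z p q]
      exact neg_mem (sub_mem (mul_mem (sub_mem (mul_mem hpp hqq) (pow_mem hpq 2)) hzz)
        (add_mem (sub_mem (mul_mem (pow_mem hzp 2) hqq) (mul_mem (mul_mem (mul_mem h2 hzp) hzq)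
            hpq))
          (mul_mem (pow_mem hzq 2) hpp)))
    rw [Valuation.mem_integer_iff, map_pow] at h1
    exact (pow_le_one_iff two_ne_zero).1 h1
  have h := bil_combination (bil x p * bil q q - bil x q * bil p q)
    (bil x q * bil p p - bil x p * bil p q) (4 * bil x (normal p q)) 1 p q (normal p q) y
  have e : (fun i => 1 * ((bil x p * bil q q - bil x q * bil p q) * p i +
      (bil x q * bil p p - bil x p * bil p q) * q i - 4 * bil x (normal p q) * normal p q i)) =
      fun i => (bil p p * bil q q - bil p q ^ 2) * (1 * x i + 0 * x i - 0 * x i) := by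
    funext i
    rw [one_mul, ← expansion x p q i]; ring
  rw [e, bil_combination] at h
  have h' : (bil p p * bil q q - bil p q ^ 2) * bil x y =
      (bil x p * bil q q - bil x q * bil p q) * bil y p +
      (bil x q * bil p p - bil x p * bil p q) * bil y q -
      (2 * bil x (normal p q)) * (2 * bil y (normal p q)) := by
    rw [bil_comm y p, bil_comm y q, bil_comm y]
    linear_combination h
  have h3 : (bil p p * bil q q - bil p q ^ 2) * bil x y ∈ v.integer := by
    rw [h']
    exact sub_mem (add_mem (mul_mem (sub_mem (mul_mem hxp hqq) (mul_mem hxq hpq)) hyp)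
      (mul_mem (sub_mem (mul_mem hxq hpp) (mul_mem hxp hpq)) hyq))
      (mul_mem (key x hxx hxp hxq) (key y hyy hyp hyq))
  rw [Valuation.mem_integer_iff, map_mul, hD, one_mul] at h3
  exact h3

end quadrics

theorem Finset.card_eq_of_mem_iff_exists {ι α : Type*} [Fintype ι] {g : ι → α}
    (hg : g.Injective) {S : Finset α} (hS : ∀ x, x ∈ S ↔ ∃ i, g i = x) :
    S.card = Fintype.card ι := by
  classical
  have : S = Finset.univ.image g := by ext x; simp [hS]
  rw [this, Finset.card_image_of_injective _ hg, Finset.card_univ]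

theorem Transcendental.quadratic_ne_zero {C K : Type*} [Field C] [Field K] [Algebra C K] {u : K}
    (hu : Transcendental C u) {a : C} (ha : a ≠ 0) (b c : C) :
    algebraMap C K a * u ^ 2 + algebraMap C K b * u + algebraMap C K c ≠ 0 := by
  intro h
  have h0 : Polynomial.C a * Polynomial.X ^ 2 + Polynomial.C b * Polynomial.X +
      Polynomial.C c = 0 := by
    refine (transcendental_iff.1 hu) _ ?_
    simpa using h
  have := congrArg (Polynomial.coeff · 2) h0
  simp at this
  exact ha this

section base

variable {F : Type*} [Field F] [CharZero F]

theorem bil_basePoint_basePoint : bil (basePoint : Fin 3 → F) basePoint = 1 := by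
  simp [bil, basePoint]

theorem bil_secondPoint_secondPoint (k : F) : bil (secondPoint k) (secondPoint k) = 1 := by
  simp [bil, secondPoint]; ring

theorem bil_basePoint_secondPoint (k : F) : bil basePoint (secondPoint k) = k := by
  simp [bil, secondPoint, basePoint]

theorem exists_two_points_of_base [IsAlgClosed F] {k m n : F} (hk : 1 - k ^ 2 ≠ 0)
    (hG : 1 - k ^ 2 - (m ^ 2 - 2 * m * n * k + n ^ 2) ≠ 0) :
    ∃ f : Bool → Fin 3 → F, f.Injective ∧
      ∀ x, (∃ b, f b = x) ↔ bil x x = 1 ∧ bil x basePoint = m ∧ bil x (secondPoint k) = n := by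
  apply exists_two_points <;> rw [bil_basePoint_basePoint, bil_secondPoint_secondPoint,
    bil_basePoint_secondPoint]
  · simpa using hk
  · simpa using hG

/-- The realization that puts the vertices `0` and `3` at given points. -/
def tuple (k : F) (p q : Fin 3 → F) (w : ℕ) : Fin 3 → F :=
  if w = 0 then p else if w = 1 then basePoint else if w = 2 then secondPoint k else
    if w = 3 then q else 0

theorem Finset.pair_eq_pair_nat {a b c d : ℕ} (h : ({a, b} : Finset ℕ) = {c, d}) :
    a = c ∧ b = d ∨ a = d ∧ b = c := by
  have := congrArg (fun s : Finset ℕ => (s : Set ℕ)) h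
  simpa [Set.pair_eq_pair_iff] using this

theorem isSol_wing_iff {H : GeoGraph} {ν : Finset ℕ → F} {ρ : ℕ → Fin 3 → F} {i : ℕ}
    (hi : i = 1 ∨ i = 2) (hV : H.V = {0, 1, 2}) (hE : H.E = {{1, 2}, {0, i}}) :
    IsSol H ν ρ ↔ tuple (ν {1, 2}) (ρ 0) 0 = ρ ∧ bil (ρ 0) (ρ 0) = 1 ∧
      bil (ρ 0) (if i = 1 then basePoint else secondPoint (ν {1, 2})) = ν {0, i} := by
  constructor
  · intro h
    refine ⟨?_, h.sph 0 (by simp [hV]), ?_⟩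
    · funext w
      simp only [tuple]
      split_ifs with h0 h1 h2
      · rw [h0]
      · rw [h1, h.one]
      · rw [h2, h.two]
      · exact (h.off w (by simp [hV, h0, h1, h2])).symm
      · exact (h.off w (by simp [hV, h0, h1, h2])).symm
    · rw [← h.edge 0 i (by simp [hE])]
      rcases hi with rfl | rfl
      · rw [if_pos rfl, h.one]
      · rw [if_neg (by decide), h.two]
  · rintro ⟨h, hp, hm⟩
    have h1 : ρ 1 = basePoint := by rw [← h]; simp [tuple]
    have h2 : ρ 2 = secondPoint (ν {1, 2}) := by rw [← h]; simp [tuple]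
    refine ⟨fun w hw => ?_, h1, h2, fun w hw => ?_, fun x w hxw => ?_⟩
    · rw [← h]
      simp [hV] at hw
      simp [tuple, hw]
    · simp only [hV, Finset.mem_insert, Finset.mem_singleton] at hw
      rcases hw with rfl | rfl | rfl
      · exact hp
      · rw [h1, bil_basePoint_basePoint]
      · rw [h2, bil_secondPoint_secondPoint]
    · have hm' : bil (ρ 0) (ρ i) = ν {0, i} := by
        rw [← hm]
        rcases hi with rfl | rfl
        · rw [if_pos rfl, h1]
        · rw [if_neg (by decide), h2]
      have h12 : bil (ρ 1) (ρ 2) = ν {1, 2} := by rw [h1, h2, bil_basePoint_secondPoint]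
      simp only [hE, Finset.mem_insert, Finset.mem_singleton] at hxw
      rcases hxw with h | h <;> rw [h] <;>
        obtain ⟨rfl, rfl⟩ | ⟨rfl, rfl⟩ := Finset.pair_eq_pair_nat h
      · exact h12
      · rw [bil_comm]; exact h12
      · exact hm'
      · rw [bil_comm]; exact hm'

theorem isSol_tripod_iff {H : GeoGraph} {ν : Finset ℕ → F} {ρ : ℕ → Fin 3 → F}
    (hV : H.V = {0, 1, 2, 3}) (hE : H.E = {{1, 2}, {0, 3}, {1, 3}, {2, 3}}) :
    IsSol H ν ρ ↔ tuple (ν {1, 2}) (ρ 0) (ρ 3) = ρ ∧ bil (ρ 0) (ρ 0) = 1 ∧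
      bil (ρ 0) (ρ 3) = ν {0, 3} ∧ bil (ρ 3) (ρ 3) = 1 ∧ bil (ρ 3) basePoint = ν {1, 3} ∧
      bil (ρ 3) (secondPoint (ν {1, 2})) = ν {2, 3} := by
  constructor
  · intro h
    refine ⟨?_, h.sph 0 (by simp [hV]), h.edge 0 3 (by simp [hE]), h.sph 3 (by simp [hV]), ?_, ?_⟩
    · funext w
      simp only [tuple]
      split_ifs with h0 h1 h2 h3
      · rw [h0]
      · rw [h1, h.one]
      · rw [h2, h.two]
      · rw [h3]
      · exact (h.off w (by simp [hV, h0, h1, h2, h3])).symm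
    · rw [← h.edge 1 3 (by simp [hE]), h.one, bil_comm]
    · rw [← h.edge 2 3 (by simp [hE]), h.two, bil_comm]
  · rintro ⟨h, hp, hm, hq, hq1, hq2⟩
    have h1 : ρ 1 = basePoint := by rw [← h]; simp [tuple]
    have h2 : ρ 2 = secondPoint (ν {1, 2}) := by rw [← h]; simp [tuple]
    refine ⟨fun w hw => ?_, h1, h2, fun w hw => ?_, fun x w hxw => ?_⟩
    · rw [← h]
      simp [hV] at hw
      simp [tuple, hw]
    · simp only [hV, Finset.mem_insert, Finset.mem_singleton] at hw
      rcases hw with rfl | rfl | rfl | rfl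
      · exact hp
      · rw [h1, bil_basePoint_basePoint]
      · rw [h2, bil_secondPoint_secondPoint]
      · exact hq
    · have h12 : bil (ρ 1) (ρ 2) = ν {1, 2} := by rw [h1, h2, bil_basePoint_secondPoint]
      rw [← h1, bil_comm] at hq1
      rw [← h2, bil_comm] at hq2
      simp only [hE, Finset.mem_insert, Finset.mem_singleton] at hxw
      rcases hxw with h | h | h | h <;> rw [h] <;>
        obtain ⟨rfl, rfl⟩ | ⟨rfl, rfl⟩ := Finset.pair_eq_pair_nat h <;>
        first | assumption | (rw [bil_comm]; assumption)

end base

section finiteCount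

variable {K : Type*} [Field K] {Γ : Type*} [LinearOrderedCommGroupWithZero Γ] {v : Valuation K Γ}
  {S : Finset (ℕ → Fin 3 → K)} {i : ℕ}

theorem GenericSplit.finiteCount_eq_card (h : ∀ ρ ∈ S, v (bil (ρ 0) (ρ i)) ≤ 1) :
    finiteCount v S i = S.card := by
  classical
  rw [finiteCount, Finset.filter_true_of_mem h]

theorem GenericSplit.finiteCount_eq_zero (h : ∀ ρ ∈ S, 1 < v (bil (ρ 0) (ρ i))) :
    finiteCount v S i = 0 := by
  classical
  rw [finiteCount, Finset.filter_false_of_mem fun ρ hρ => (h ρ hρ).not_ge, Finset.card_empty]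

end finiteCount

namespace GenericOver

variable {κ₀ κ C K : Type*} [Field κ₀] [Field κ] [Field C] [Field K] [Algebra κ₀ κ]
  [Algebra κ₀ C] [Algebra κ C] [Algebra C K] [Algebra κ₀ K] [Algebra κ K]
  [IsScalarTower κ₀ κ C] [IsScalarTower κ₀ C K] [IsScalarTower κ₀ κ K] [IsScalarTower κ C K]
  [CharZero κ₀] [CharZero κ] [CharZero C] [CharZero K]
  [Algebra (RatFunc C) K] [IsScalarTower C (RatFunc C) K] [IsAlgClosed K]
  {H : GeoGraph} {μ : Finset ℕ → C} {k : κ₀}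

theorem one_sub_base_sq_ne (h : GenericOver κ₀ κ H μ k) : 1 - liftEdge K μ {1, 2} ^ 2 ≠ 0 := by
  obtain ⟨h1, h2⟩ := h.base_sub_lift_ne (K := K)
  intro h0
  exact mul_ne_zero h1 h2 (by linear_combination -h0)

open GenericSplit

theorem card_section_wing (h : GenericOver κ₀ κ H μ k) {i : ℕ} (hi : i = 1 ∨ i = 2)
    (hV : H.V = {0, 1, 2}) (hE : H.E = {{1, 2}, {0, i}}) {S : Finset (ℕ → Fin 3 → K)}
    (hS : ∀ ρ, ρ ∈ S ↔ ρ ∈ sectionSet H (liftEdge K μ) (ratGen C K)) : S.card = 2 := by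
  set u := ratGen C K with hu
  set k' := liftEdge K μ {1, 2} with hk'
  set m := liftEdge K μ {0, i} with hm
  obtain ⟨f, hf, hfx⟩ := exists_two_points_of_base (k := k')
    (m := if i = 1 then m else u - m) (n := if i = 1 then u - m else m) h.one_sub_base_sq_ne (by
      have := (transcendental_ratGen C K).quadratic_ne_zero (a := -1) (by simp)
        (2 * (1 + μ {1, 2}) * μ {0, i})
        (1 - μ {1, 2} ^ 2 - 2 * (1 + μ {1, 2}) * μ {0, i} ^ 2)
      intro h0
      apply this
      simp only [map_neg, map_one, map_mul, map_add, map_sub, map_pow, map_ofNat]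
      change -1 * u ^ 2 + 2 * (1 + k') * m * u + (1 - k' ^ 2 - 2 * (1 + k') * m ^ 2) = 0
      rcases hi with rfl | rfl
      · rw [if_pos rfl, if_pos rfl] at h0
        linear_combination h0
      · rw [if_neg (by decide), if_neg (by decide)] at h0
        linear_combination h0)
  rw [← Fintype.card_bool]
  refine Finset.card_eq_of_mem_iff_exists (g := fun b => tuple k' (f b) 0)
    (fun a b hab => hf (by simpa [tuple] using congrFun hab 0)) fun ρ => ?_
  rw [hS, sectionSet, Set.mem_ofPred_eq, isSol_wing_iff hi hV hE]
  constructor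
  · rintro ⟨⟨h1, h2, h3⟩, h4⟩
    have e1 : ρ 1 = basePoint := by rw [← h1]; simp [tuple]
    have e2 : ρ 2 = secondPoint k' := by rw [← h1]; simp [tuple, hk']
    rw [e1, e2] at h4
    obtain ⟨b, hb⟩ := (hfx (ρ 0)).2 ⟨h2, by
      rcases hi with rfl | rfl
      · rw [if_pos rfl] at h3 ⊢; exact h3
      · rw [if_neg (by decide)] at h3 ⊢; linear_combination h4 - h3, by
      rcases hi with rfl | rfl
      · rw [if_pos rfl] at h3 ⊢; linear_combination h4 - h3
      · rw [if_neg (by decide)] at h3 ⊢; exact h3⟩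
    exact ⟨b, by rw [hb]; exact h1⟩
  · rintro ⟨b, rfl⟩
    obtain ⟨h1, h2, h3⟩ := (hfx (f b)).1 ⟨b, rfl⟩
    have e0 : tuple k' (f b) 0 0 = f b := by simp [tuple]
    have e1 : tuple k' (f b) 0 1 = basePoint := by simp [tuple]
    have e2 : tuple k' (f b) 0 2 = secondPoint k' := by simp [tuple]
    rw [e0, e1, e2, h2, h3]
    refine ⟨⟨rfl, h1, ?_⟩, ?_⟩ <;> rcases hi with rfl | rfl <;> simp [h2, h3, hm, ← hk']

theorem hasCounts_left (h : GenericOver κ₀ κ H μ k) (hV : H.V = {0, 1, 2})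
    (hE : H.E = {{1, 2}, {0, 1}}) : HasCounts K H μ (2 * 1, 2 * 1, 2 * 0) := by
  intro S A hS hA hA1
  have hc := h.card_section_wing (Or.inl rfl) hV hE hS
  have hs : ∀ ρ ∈ S, A.valuation (bil (ρ 0) (ρ 1)) ≤ 1 := fun ρ hρ => by
    rw [((hS ρ).1 hρ).1.edge 0 1 (by simp [hE])]
    exact hA.le_one _
  refine ⟨hc, by rw [finiteCount_eq_card hs, hc], finiteCount_eq_zero fun ρ hρ => ?_⟩
  rw [← ((hS ρ).1 hρ).2] at hA1
  by_contra! hcon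
  exact hA1.not_ge ((A.valuation.map_add _ _).trans (max_le (hs ρ hρ) hcon))

theorem hasCounts_right (h : GenericOver κ₀ κ H μ k) (hV : H.V = {0, 1, 2})
    (hE : H.E = {{1, 2}, {0, 2}}) : HasCounts K H μ (2 * 1, 2 * 0, 2 * 1) := by
  intro S A hS hA hA1
  have hc := h.card_section_wing (Or.inr rfl) hV hE hS
  have hs : ∀ ρ ∈ S, A.valuation (bil (ρ 0) (ρ 2)) ≤ 1 := fun ρ hρ => by
    rw [((hS ρ).1 hρ).1.edge 0 2 (by simp [hE])]
    exact hA.le_one _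
  refine ⟨hc, finiteCount_eq_zero fun ρ hρ => ?_, by rw [finiteCount_eq_card hs, hc]⟩
  rw [← ((hS ρ).1 hρ).2] at hA1
  by_contra! hcon
  exact hA1.not_ge ((A.valuation.map_add _ _).trans (max_le hcon (hs ρ hρ)))

end GenericOver

namespace GenericOver

variable {κ₀ κ C K : Type*} [Field κ₀] [Field κ] [Field C] [Field K] [Algebra κ₀ κ]
  [Algebra κ₀ C] [Algebra κ C] [Algebra C K] [Algebra κ₀ K] [Algebra κ K]
  [IsScalarTower κ₀ κ C] [IsScalarTower κ₀ C K] [IsScalarTower κ₀ κ K] [IsScalarTower κ C K]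
  [CharZero κ₀] [CharZero κ] [CharZero C] [CharZero K]
  [Algebra (RatFunc C) K] [IsScalarTower C (RatFunc C) K] [IsAlgClosed K]
  {H : GeoGraph} {μ : Finset ℕ → C} {k : κ₀}

/-- A polynomial in the free edge data does not vanish if it does not vanish at the origin. -/
theorem aeval_ne_zero (h : GenericOver κ₀ κ H μ k) (P : MvPolynomial (FreeEdge H) κ₀)
    (hP : MvPolynomial.eval 0 P ≠ 0) : MvPolynomial.aeval (fun e : FreeEdge H => μ e.1) P ≠ 0 := by
  intro h0
  rw [h.indep (h0.trans (map_zero _).symm)] at hP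
  exact hP (map_zero _)

open GenericSplit MvPolynomial

theorem hasCounts_tripod (h : GenericOver κ₀ κ H μ k) (hV : H.V = {0, 1, 2, 3})
    (hE : H.E = {{1, 2}, {0, 3}, {1, 3}, {2, 3}}) : HasCounts K H μ (2 * 2, 2 * 0, 2 * 0) := by
  set u := ratGen C K with hu
  set k' := liftEdge K μ {1, 2} with hk'
  have hk0 : 1 - k ^ 2 ≠ 0 := fun h0 => h.ne (by linear_combination -h0)
  have hk1 : 2 + 2 * k ≠ 0 := fun h0 => hk0 (by linear_combination (1 - k) / 2 * h0)
  have hinj := (algebraMap C K).injective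
  have hb : algebraMap κ₀ C k = μ {1, 2} := h.base
  let e1 : FreeEdge H := ⟨{1, 3}, by simp [hE], by decide⟩
  let e2 : FreeEdge H := ⟨{2, 3}, by simp [hE], by decide⟩
  have hG : 1 - k' ^ 2 - (liftEdge K μ {1, 3} ^ 2 - 2 * liftEdge K μ {1, 3} *
      liftEdge K μ {2, 3} * k' + liftEdge K μ {2, 3} ^ 2) ≠ 0 := by
    have := h.aeval_ne_zero (.C (1 - k ^ 2) - (X e1 ^ 2 - 2 * X e1 * X e2 * .C k + X e2 ^ 2))
      (by simpa using hk0)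
    intro h0
    apply this
    apply hinj
    simp [hb, e1, e2, map_ofNat]
    exact h0
  have hD2 : 2 + 2 * k' - (liftEdge K μ {1, 3} + liftEdge K μ {2, 3}) ^ 2 ≠ 0 := by
    have := h.aeval_ne_zero (.C (2 + 2 * k) - (X e1 + X e2) ^ 2) (by simpa using hk1)
    intro h0
    apply this
    apply hinj
    simp [hb, e1, e2, map_ofNat]
    exact h0
  have hT (e' : FreeEdge H) : 1 - μ e'.1 ^ 2 ≠ 0 := by
    have := h.aeval_ne_zero (.C 1 - X e' ^ 2) (by simp)
    simpa using this
  obtain ⟨f, hf, hfx⟩ := exists_two_points_of_base h.one_sub_base_sq_ne hG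
  let s : Fin 3 → K := fun i => basePoint i + secondPoint k' i
  have hs (x : Fin 3 → K) : bil x s = bil x basePoint + bil x (secondPoint k') := by
    simp [bil, s]; ring
  have hss : bil s s = 2 + 2 * k' := by
    rw [hs, bil_comm s, bil_comm s, hs, hs, bil_basePoint_basePoint, bil_secondPoint_secondPoint,
      bil_comm (secondPoint k'), bil_basePoint_secondPoint]
    ring
  have hg (b : Bool) : ∃ g : Bool → Fin 3 → K, g.Injective ∧ ∀ x, (∃ b', g b' = x) ↔
      bil x x = 1 ∧ bil x (f b) = liftEdge K μ {0, 3} ∧ bil x s = u := by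
    obtain ⟨h1, h2, h3⟩ := (hfx (f b)).1 ⟨b, rfl⟩
    apply exists_two_points <;> rw [h1, hss, hs, h2, h3]
    · rw [one_mul]; exact hD2
    · have := (transcendental_ratGen C K).quadratic_ne_zero (a := -1) (by simp)
        (2 * μ {0, 3} * (μ {1, 3} + μ {2, 3}))
        (2 + 2 * μ {1, 2} - (μ {1, 3} + μ {2, 3}) ^ 2 - μ {0, 3} ^ 2 * (2 + 2 * μ {1, 2}))
      intro h0
      apply this
      simp only [map_neg, map_one, map_mul, map_add, map_sub, map_pow, map_ofNat]
      rw [← h0]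
      simp only [k', liftEdge, u]
      ring
  choose g hginj hgx using hg
  have hcard (S : Finset (ℕ → Fin 3 → K))
      (hS : ∀ ρ, ρ ∈ S ↔ ρ ∈ sectionSet H (liftEdge K μ) u) : S.card = 4 := by
    have : Fintype.card (Bool × Bool) = 4 := by decide
    rw [← this]
    refine Finset.card_eq_of_mem_iff_exists (g := fun b => tuple k' (g b.1 b.2) (f b.1))
      (fun a b hab => ?_) fun ρ => ?_
    · have h3 : f a.1 = f b.1 := by simpa [tuple] using congrFun hab 3
      have h0 : g a.1 a.2 = g b.1 b.2 := by simpa [tuple] using congrFun hab 0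
      have h1 := hf h3
      rw [h1] at h0
      exact Prod.ext h1 (hginj _ h0)
    · rw [hS, sectionSet, Set.mem_ofPred_eq, isSol_tripod_iff hV hE]
      constructor
      · rintro ⟨⟨ht, h1, h2, h3, h4, h5⟩, h6⟩
        have e1 : ρ 1 = basePoint := by rw [← ht]; simp [tuple]
        have e2 : ρ 2 = secondPoint k' := by rw [← ht]; simp [tuple, hk']
        rw [e1, e2, ← hs] at h6
        obtain ⟨b, hb⟩ := (hfx (ρ 3)).2 ⟨h3, h4, h5⟩
        obtain ⟨b', hb'⟩ := (hgx b (ρ 0)).2 ⟨h1, by rw [hb, h2], h6⟩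
        exact ⟨(b, b'), by rw [hb, hb']; exact ht⟩
      · rintro ⟨⟨b, b'⟩, rfl⟩
        obtain ⟨h1, h2, h3⟩ := (hfx (f b)).1 ⟨b, rfl⟩
        obtain ⟨h4, h5, h6⟩ := (hgx b (g b b')).1 ⟨b', rfl⟩
        have e0 : tuple k' (g b b') (f b) 0 = g b b' := by simp [tuple]
        have e1 : tuple k' (g b b') (f b) 1 = basePoint := by simp [tuple]
        have e2 : tuple k' (g b b') (f b) 2 = secondPoint k' := by simp [tuple]
        have e3 : tuple k' (g b b') (f b) 3 = f b := by simp [tuple]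
        dsimp only
        rw [e0, e1, e2, e3, ← hs]
        exact ⟨⟨rfl, h4, h5, h1, h2, h3⟩, h6⟩
  intro S A hS hA hA1
  have key {ρ : ℕ → Fin 3 → K} (hρ : ρ ∈ S) {i j : ℕ} (hij : i = 1 ∧ j = 2 ∨ i = 2 ∧ j = 1)
      (hle : A.valuation (bil (ρ 0) (ρ i)) ≤ 1) : A.valuation (bil (ρ 0) (ρ j)) ≤ 1 := by
    have hsol := ((hS ρ).1 hρ).1
    have hle' (e : Finset ℕ) : A.valuation (liftEdge K μ e) ≤ 1 := hA.le_one _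
    have hi3 : bil (ρ i) (ρ 3) = liftEdge K μ {i, 3} := hsol.edge i 3 (by
      rcases hij with ⟨rfl, rfl⟩ | ⟨rfl, rfl⟩ <;> simp [hE])
    have hj3 : bil (ρ j) (ρ 3) = liftEdge K μ {j, 3} := hsol.edge j 3 (by
      rcases hij with ⟨rfl, rfl⟩ | ⟨rfl, rfl⟩ <;> simp [hE])
    have hji : bil (ρ j) (ρ i) = liftEdge K μ {j, i} := hsol.edge j i (by
      rcases hij with ⟨rfl, rfl⟩ | ⟨rfl, rfl⟩ <;> simp [hE, Finset.pair_comm])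
    have h03 : bil (ρ 0) (ρ 3) = liftEdge K μ {0, 3} := hsol.edge 0 3 (by simp [hE])
    have hV' (w : ℕ) (hw : w ∈ H.V) : A.valuation (bil (ρ w) (ρ w)) ≤ 1 := by
      rw [hsol.sph w hw, map_one]
    have hmem : i ∈ H.V ∧ j ∈ H.V := by
      rcases hij with ⟨rfl, rfl⟩ | ⟨rfl, rfl⟩ <;> simp [hV]
    refine valuation_bil_le_one_of_polar (p := ρ i) (q := ρ 3) ?_ (hV' _ hmem.1)
      (hV' 3 (by simp [hV])) (hi3 ▸ hle' _) (hV' 0 (by simp [hV])) hle (h03 ▸ hle' _)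
      (hV' _ hmem.2) (hji ▸ hle' _) (hj3 ▸ hle' _)
    rw [hsol.sph _ hmem.1, hsol.sph 3 (by simp [hV]), hi3]
    have := hA (1 - μ {i, 3} ^ 2) (by
      rcases hij with ⟨rfl, rfl⟩ | ⟨rfl, rfl⟩
      · exact hT e1
      · exact hT e2)
    simpa [liftEdge] using this
  have hno {ρ : ℕ → Fin 3 → K} (hρ : ρ ∈ S) (h1 : A.valuation (bil (ρ 0) (ρ 1)) ≤ 1)
      (h2 : A.valuation (bil (ρ 0) (ρ 2)) ≤ 1) : False := by
    rw [← ((hS ρ).1 hρ).2] at hA1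
    exact hA1.not_ge ((A.valuation.map_add _ _).trans (max_le h1 h2))
  refine ⟨hcard S hS, finiteCount_eq_zero fun ρ hρ => ?_, finiteCount_eq_zero fun ρ hρ => ?_⟩
  · by_contra! hcon
    exact hno hρ hcon (key hρ (Or.inl ⟨rfl, rfl⟩) hcon)
  · by_contra! hcon
    exact hno hρ (key hρ (Or.inr ⟨rfl, rfl⟩) hcon) hcon

end GenericOver

open scoped IntermediateField.algebraAdjoinAdjoin in
theorem AlgebraicIndependent.adjoin_field_of_disjoint {ι R C : Type*} [Field R] [Field C]
    [Algebra R C] {x : ι → C} (hx : AlgebraicIndependent R x) {s t : Set ι} (h : Disjoint s t) :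
    AlgebraicIndependent (IntermediateField.adjoin R (x '' s)) fun i : t => x i :=
  (hx.adjoin_of_disjoint h).extendScalars _

section fields

variable (R : Type*) {C : Type*} [Field R] [Field C] [Algebra R C]

/-- The field generated by the inner product of the vertices `1` and `2`. -/
abbrev baseField (μ : Finset ℕ → C) : IntermediateField R C :=
  IntermediateField.adjoin R {μ {1, 2}}

/-- The field generated by the edge data of `H`. -/
abbrev edgeField (H : GeoGraph) (μ : Finset ℕ → C) : IntermediateField (baseField R μ) C :=
  IntermediateField.adjoin (baseField R μ) (Set.range fun e : FreeEdge H => μ e.1)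

/-- The algebraic closure of the field generated by the edge data of `H`. -/
abbrev partField (H : GeoGraph) (μ : Finset ℕ → C) : IntermediateField (edgeField R H μ) C :=
  algebraicClosure (edgeField R H μ) C

instance (H : GeoGraph) (μ : Finset ℕ → C) :
    IsScalarTower (baseField R μ) (partField R H μ) C := .of_algebraMap_eq fun _ => rfl

instance (H : GeoGraph) (μ : Finset ℕ → C) (K : Type*) [Field K] [Algebra C K] :
    IsScalarTower (baseField R μ) (partField R H μ) K := .of_algebraMap_eq fun _ => rfl

instance [IsAlgClosed C] (H : GeoGraph) (μ : Finset ℕ → C) : IsAlgClosed (partField R H μ) :=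
  IsAlgClosure.isAlgClosed (edgeField R H μ)

variable {R} {H H' G : GeoGraph} {μ : Finset ℕ → C}

theorem AlgebraicIndependent.freeEdge (h : AlgebraicIndependent R fun e : G.E => μ e.1)
    (h12 : {1, 2} ∈ G.E) : AlgebraicIndependent (baseField R μ) fun e : FreeEdge G => μ e.1 := by
  have := h.adjoin_field_of_disjoint (s := {⟨{1, 2}, h12⟩}) (t := {⟨{1, 2}, h12⟩}ᶜ)
    disjoint_compl_right
  rw [Set.image_singleton] at this
  exact this.comp (fun e : FreeEdge G => ⟨⟨e.1, e.2.1⟩, fun h => e.2.2 (congrArg Subtype.val h)⟩)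
    fun a b hab => by simpa [Subtype.ext_iff] using hab

theorem AlgebraicIndependent.freeEdge_part
    (h : AlgebraicIndependent (baseField R μ) fun e : FreeEdge G => μ e.1) (hH : H.E ⊆ G.E)
    (hH' : H'.E ⊆ G.E) (hd : H.E ∩ H'.E = {{1, 2}}) :
    AlgebraicIndependent (partField R H' μ) fun e : FreeEdge H => μ e.1 := by
  have := h.adjoin_field_of_disjoint (s := {e | e.1 ∈ H'.E}) (t := {e | e.1 ∈ H.E}) (by
    rw [Set.disjoint_left]
    intro e h1 h2
    have : e.1 ∈ H.E ∩ H'.E := Finset.mem_inter.2 ⟨h2, h1⟩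
    rw [hd, Finset.mem_singleton] at this
    exact e.2.2 this)
  have e : (fun e : FreeEdge G => μ e.1) '' {e | e.1 ∈ H'.E} =
      Set.range fun e : FreeEdge H' => μ e.1 := by
    ext c
    constructor
    · rintro ⟨e, he, rfl⟩
      exact ⟨⟨e.1, he, e.2.2⟩, rfl⟩
    · rintro ⟨e, rfl⟩
      exact ⟨⟨e.1, hH' e.2.1, e.2.2⟩, e.2.1, rfl⟩
  rw [e] at this
  have h2 : AlgebraicIndependent (edgeField R H' μ) fun e : FreeEdge H => μ e.1 :=
    this.comp (fun e : FreeEdge H => ⟨⟨e.1, hH e.2.1, e.2.2⟩, e.2.1⟩)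
      fun a b hab => by simpa [Subtype.ext_iff] using hab
  exact h2.algebraicClosure

theorem genericOver_partField (h : AlgebraicIndependent R fun e : H.E => μ e.1)
    (hH : PreCalligraph H) : GenericOver (baseField R μ) (partField R H μ) H μ
      ⟨μ {1, 2}, IntermediateField.mem_adjoin_simple_self R _⟩ where
  pre := hH
  base := rfl
  ne hk := by
    have ht : Transcendental R (μ {1, 2}) := h.transcendental ⟨{1, 2}, hH.mem⟩
    have hk' : μ {1, 2} ^ 2 = 1 := congrArg Subtype.val hk
    refine ht (IsAlgebraic.of_pow two_pos ?_)
    rw [hk']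
    exact isAlgebraic_one
  mem e he := by
    by_cases h12 : e = {1, 2}
    · subst h12
      exact ⟨algebraMap (baseField R μ) _ ⟨μ {1, 2}, IntermediateField.mem_adjoin_simple_self R _⟩,
          rfl⟩
    · exact ⟨algebraMap (edgeField R H μ) _ ⟨μ e, IntermediateField.subset_adjoin _ _
        ⟨⟨e, he, h12⟩, rfl⟩⟩, rfl⟩
  indep := h.freeEdge hH.mem

theorem AlgebraicIndependent.edge_mono (h : AlgebraicIndependent R fun e : G.E => μ e.1)
    (hH : H.E ⊆ G.E) : AlgebraicIndependent R fun e : H.E => μ e.1 :=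
  h.comp (fun e : H.E => (⟨e.1, hH e.2⟩ : G.E)) fun _ _ hab =>
    Subtype.ext (congrArg (fun e : G.E => e.1) hab)

theorem genericSplit_partField {H₁ H₂ : GeoGraph} (h : AlgebraicIndependent R fun e : G.E => μ e.1)
    (h₁ : PreCalligraph H₁) (h₂ : PreCalligraph H₂) (hs : IsSplit G H₁ H₂)
    (ht : G.E.card = 2 * G.V.card - 3) :
    GenericSplit (baseField R μ) (partField R H₁ μ) (partField R H₂ μ) G H₁ H₂ μ
      ⟨μ {1, 2}, IntermediateField.mem_adjoin_simple_self R _⟩ := by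
  have hs₁ : H₁.E ⊆ G.E := hs.2.1 ▸ Finset.subset_union_left
  have hs₂ : H₂.E ⊆ G.E := hs.2.1 ▸ Finset.subset_union_right
  have hf := h.freeEdge (hs₁ h₁.mem)
  exact
    { fst := genericOver_partField (h.edge_mono hs₁) h₁
      snd := genericOver_partField (h.edge_mono hs₂) h₂
      indep_fst := hf.freeEdge_part hs₁ hs₂ hs.2.2.2
      indep_snd := hf.freeEdge_part hs₂ hs₁ (by rw [Finset.inter_comm]; exact hs.2.2.2)
      split := hs
      tight := ht
      indep := hf }

end fields

section counts

variable {R C : Type*} [Field R] [Field C] [Algebra R C] [CharZero C] [IsAlgClosed C]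
  {H G H₁ H₂ : GeoGraph} {μ : Finset ℕ → C}

/-- Half of the intersection data of a calligraph with generic edge data. -/
theorem exists_hasCounts_of_algebraicIndependent
    (h : AlgebraicIndependent R fun e : H.E => μ e.1) (hH : PreCalligraph H) :
    ∃ a b c : ℕ, HasCounts (AlgebraicClosure (RatFunc C)) H μ (2 * a, 2 * b, 2 * c) :=
  have : CharZero R := (algebraMap R C).charZero_iff (algebraMap R C).injective |>.2 inferInstance
  (genericOver_partField h hH).exists_hasCounts

end counts

theorem Complex.exists_algebraicIndependent (η : Type*) [Countable η] :
    ∃ μ : η → ℂ, AlgebraicIndependent ℚ μ := by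
  obtain ⟨ι, x, hx⟩ := exists_isTranscendenceBasis' ℚ ℂ
  have h := IsAlgClosed.cardinal_eq_cardinal_transcendence_basis_of_aleph0_lt' x hx
    (by rw [Cardinal.mkRat]) (by rw [Cardinal.mk_complex]; exact Cardinal.aleph0_lt_continuum)
  have : Infinite ι := by
    rw [Cardinal.infinite_iff, ← h, Cardinal.mk_complex]
    exact Cardinal.aleph0_le_continuum
  obtain ⟨f, hf⟩ := exists_injective_nat η
  exact ⟨fun e => x (Infinite.natEmbedding ι (f e)),
    hx.1.comp _ ((Infinite.natEmbedding ι).injective.comp hf)⟩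

section counts

variable {κ₀ κ C K : Type*} [Field κ₀] [Field κ] [Field C] [Field K] [Algebra κ₀ κ]
  [Algebra κ₀ C] [Algebra κ C] [Algebra C K] [Algebra κ₀ K] [Algebra κ K]
  [IsScalarTower κ₀ κ C] [IsScalarTower κ₀ C K] [IsScalarTower κ₀ κ K] [IsScalarTower κ C K]
  [CharZero C] [CharZero K]
  [Algebra (RatFunc C) K] [IsScalarTower C (RatFunc C) K] [Algebra.IsAlgebraic (RatFunc C) K]
  [IsAlgClosed K] [IsAlgClosed C] {H : GeoGraph} {μ : Finset ℕ → C} {k : κ₀}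

theorem GenericOver.hasCounts_unique (h : GenericOver κ₀ κ H μ k) {c c' : ℕ × ℕ × ℕ}
    (hc : HasCounts K H μ c) (hc' : HasCounts K H μ c') : c = c' := by
  obtain ⟨A, hA, hA1⟩ := exists_place_at_infinity C K
  have hS : ∀ ρ, ρ ∈ (h.finite_sectionSet (K := K)
      ((transcendental_ratGen C K).of_tower_top κ)).toFinset ↔
      ρ ∈ sectionSet H (liftEdge K μ) (ratGen C K) := fun ρ => Set.Finite.mem_toFinset _
  obtain ⟨h1, h2, h3⟩ := hc _ A hS hA hA1
  obtain ⟨h1', h2', h3'⟩ := hc' _ A hS hA hA1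
  exact Prod.ext (h1.symm.trans h1') (Prod.ext (h2.symm.trans h2') (h3.symm.trans h3'))

end counts

/-- The intersection data of a calligraph with arbitrary generic edge data. -/
def GeoGraph.HasGenericCounts (H : GeoGraph) (c : ℕ × ℕ × ℕ) : Prop :=
  ∀ μ : Finset ℕ → ℂ, AlgebraicIndependent ℚ (fun e : H.E => μ e.1) →
    HasCounts (AlgebraicClosure (RatFunc ℂ)) H μ (2 * c.1, 2 * c.2.1, 2 * c.2.2)

namespace PreCalligraph

variable {H : GeoGraph}

theorem exists_hasGenericCounts (hH : PreCalligraph H) : ∃ c, H.HasGenericCounts c := by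
  obtain ⟨μ, hμ⟩ := Complex.exists_algebraicIndependent H.E
  classical
  let ν : Finset ℕ → ℂ := fun e => if h : e ∈ H.E then μ ⟨e, h⟩ else 0
  have hν : AlgebraicIndependent ℚ fun e : H.E => ν e.1 := by
    convert hμ with e
    exact dif_pos e.2
  obtain ⟨a, b, c, h⟩ := exists_hasCounts_of_algebraicIndependent hν hH
  exact ⟨(a, b, c), fun μ' hμ' => h.of_algebraicIndependent hH.mem hν hμ'⟩

theorem eq_of_hasGenericCounts (hH : PreCalligraph H) {c c' : ℕ × ℕ × ℕ}
    (hc : H.HasGenericCounts c) (hc' : ∀ μ : Finset ℕ → ℂ,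
      AlgebraicIndependent ℚ (fun e : H.E => μ e.1) →
        HasCounts (AlgebraicClosure (RatFunc ℂ)) H μ (2 * c'.1, 2 * c'.2.1, 2 * c'.2.2)) :
    c = c' := by
  obtain ⟨μ, hμ⟩ := Complex.exists_algebraicIndependent (Finset ℕ)
  have hμ' : AlgebraicIndependent ℚ fun e : H.E => μ e.1 := hμ.comp _ Subtype.val_injective
  have := (genericOver_partField hμ' hH).hasCounts_unique (hc μ hμ') (hc' μ hμ')
  simp only [Prod.mk.injEq] at this
  exact Prod.ext (by omega) (Prod.ext (by omega) (by omega))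

theorem eq_left (hH : PreCalligraph H) {c : ℕ × ℕ × ℕ} (hc : H.HasGenericCounts c)
    (hV : H.V = {0, 1, 2}) (hE : H.E = {{1, 2}, {0, 1}}) : c = (1, 1, 0) :=
  hH.eq_of_hasGenericCounts hc fun _ hμ => (genericOver_partField hμ hH).hasCounts_left hV hE

theorem eq_right (hH : PreCalligraph H) {c : ℕ × ℕ × ℕ} (hc : H.HasGenericCounts c)
    (hV : H.V = {0, 1, 2}) (hE : H.E = {{1, 2}, {0, 2}}) : c = (1, 0, 1) :=
  hH.eq_of_hasGenericCounts hc fun _ hμ => (genericOver_partField hμ hH).hasCounts_right hV hE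

theorem eq_tripod (hH : PreCalligraph H) {c : ℕ × ℕ × ℕ} (hc : H.HasGenericCounts c)
    (hV : H.V = {0, 1, 2, 3}) (hE : H.E = {{1, 2}, {0, 3}, {1, 3}, {2, 3}}) : c = (2, 0, 0) :=
  hH.eq_of_hasGenericCounts hc fun _ hμ => (genericOver_partField hμ hH).hasCounts_tripod hV hE

end PreCalligraph

theorem ncard_isSol_of_hasGenericCounts {G H₁ H₂ : GeoGraph} {μ : Finset ℕ → ℂ}
    {c₁ c₂ : ℕ × ℕ × ℕ} (hc₁ : H₁.HasGenericCounts c₁) (hc₂ : H₂.HasGenericCounts c₂)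
    (h : AlgebraicIndependent ℚ fun e : G.E => μ e.1) (h₁ : PreCalligraph H₁)
    (h₂ : PreCalligraph H₂) (hs : IsSplit G H₁ H₂) (ht : G.E.card = 2 * G.V.card - 3) :
    {ρ | IsSol G μ ρ}.Finite ∧ ({ρ | IsSol G μ ρ}.ncard : ℤ) =
      2 * (c₁.1 * c₂.1 - c₁.2.1 * c₂.2.1 - c₁.2.2 * c₂.2.2) := by
  have hg := genericSplit_partField h h₁ h₂ hs ht
  have hu := transcendental_ratGen ℂ (AlgebraicClosure (RatFunc ℂ))
  obtain ⟨A, hA, hA1⟩ := exists_place_at_infinity ℂ (AlgebraicClosure (RatFunc ℂ))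
  have hS₁ := fun ρ => (hg.fst.finite_sectionSet (K := AlgebraicClosure (RatFunc ℂ))
    (hu.of_tower_top _)).mem_toFinset (a := ρ)
  have hS₂ := fun ρ => (hg.snd.finite_sectionSet (K := AlgebraicClosure (RatFunc ℂ))
    (hu.of_tower_top _)).mem_toFinset (a := ρ)
  obtain ⟨a1, b1, d1⟩ := hc₁ μ (h.edge_mono (hs.2.1 ▸ Finset.subset_union_left)) _ A hS₁ hA hA1
  obtain ⟨a2, b2, d2⟩ := hc₂ μ (h.edge_mono (hs.2.1 ▸ Finset.subset_union_right)) _ A hS₂ hA hA1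
  refine ⟨hg.finite_isSol, ?_⟩
  have := hg.card_formula hA hA1 hS₁ hS₂
  rw [a1, b1, d1, a2, b2, d2] at this
  push_cast at this
  linarith

section rotation

open Matrix

variable {F : Type*} [Field F]

theorem dotProduct_mulVec_mulVec {A : Matrix (Fin 3) (Fin 3) F} (hA : A * Aᵀ = 1)
    (p q : Fin 3 → F) : (A *ᵥ p) ⬝ᵥ (A *ᵥ q) = p ⬝ᵥ q := by
  rw [dotProduct_mulVec, vecMul_mulVec, ← dotProduct_mulVec, mul_eq_one_comm.1 hA, one_mulVec]

/-- The matrix with rows `p`, `q` and the vector product of `p` and `q`. -/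
def frame (p q : Fin 3 → F) : Matrix (Fin 3) (Fin 3) F :=
  of ![p, q, crossProduct p q]

theorem frame_mul_transpose (p q : Fin 3 → F) :
    frame p q * (frame p q)ᵀ = !![p ⬝ᵥ p, p ⬝ᵥ q, 0; p ⬝ᵥ q, q ⬝ᵥ q, 0;
      0, 0, p ⬝ᵥ p * q ⬝ᵥ q - (p ⬝ᵥ q) ^ 2] := by
  ext i j
  fin_cases i <;> fin_cases j <;>
    simp [frame, Matrix.mul_apply, Fin.sum_univ_three, cross_apply, dotProduct] <;> ring

theorem det_frame (p q : Fin 3 → F) :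
    (frame p q).det = p ⬝ᵥ p * q ⬝ᵥ q - (p ⬝ᵥ q) ^ 2 := by
  simp [frame, Matrix.det_fin_three, Fin.sum_univ_three, cross_apply, dotProduct]; ring

theorem exists_rotation {p q p' q' : Fin 3 → F} (hpp : p ⬝ᵥ p = p' ⬝ᵥ p')
    (hpq : p ⬝ᵥ q = p' ⬝ᵥ q') (hqq : q ⬝ᵥ q = q' ⬝ᵥ q')
    (h : p ⬝ᵥ p * q ⬝ᵥ q - (p ⬝ᵥ q) ^ 2 ≠ 0) :
    ∃ A : Matrix (Fin 3) (Fin 3) F, A * Aᵀ = 1 ∧ A.det = 1 ∧ A *ᵥ p = p' ∧ A *ᵥ q = q' := by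
  set M := frame p q with hM
  set N := frame p' q' with hN
  have hdet : M.det = N.det := by rw [det_frame, det_frame, hpp, hpq, hqq]
  have hMu : IsUnit M.det := by rw [det_frame]; exact h.isUnit
  have hMN : M * Mᵀ = N * Nᵀ := by rw [frame_mul_transpose, frame_mul_transpose, hpp, hpq, hqq]
  have key : (M⁻¹ * N)ᵀ * Mᵀ = Nᵀ := by
    rw [← transpose_mul, Matrix.mul_nonsing_inv_cancel_left _ _ hMu]
  have hrow (i : Fin 3) : (M⁻¹ * N)ᵀ *ᵥ M i = N i := by
    ext j
    exact congrFun (congrFun key j) i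
  refine ⟨(M⁻¹ * N)ᵀ, ?_, ?_, hrow 0, hrow 1⟩
  · rw [transpose_transpose]
    apply mul_eq_one_comm.1
    rw [transpose_mul, Matrix.mul_assoc, ← Matrix.mul_assoc N, ← hMN, Matrix.mul_assoc M,
      Matrix.nonsing_inv_mul_cancel_left _ _ hMu, ← transpose_mul, Matrix.nonsing_inv_mul _ hMu,
      transpose_one]
  · rw [det_transpose, det_mul, det_nonsing_inv, ← hdet, Ring.inverse_mul_cancel _ hMu]

theorem crossProduct_mulVec_mulVec (A : Matrix (Fin 3) (Fin 3) F) (p q : Fin 3 → F) :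
    crossProduct (A *ᵥ p) (A *ᵥ q) = A.adjugateᵀ *ᵥ crossProduct p q := by
  ext i
  fin_cases i <;>
    simp [adjugate_fin_three, mulVec, Fin.sum_univ_three, cross_apply, dotProduct] <;> ring

theorem eq_one_of_fixes_two {A : Matrix (Fin 3) (Fin 3) F} (hA : A * Aᵀ = 1) (hd : A.det = 1)
    {p q : Fin 3 → F} (h : p ⬝ᵥ p * q ⬝ᵥ q - (p ⬝ᵥ q) ^ 2 ≠ 0) (hp : A *ᵥ p = p)
    (hq : A *ᵥ q = q) : A = 1 := by
  have hMu : IsUnit (frame p q)ᵀ.det := by rw [det_transpose, det_frame]; exact h.isUnit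
  have hadj : A.adjugate = Aᵀ := by
    rw [← inv_eq_right_inv hA, inv_def, hd]; simp
  have hr : A *ᵥ crossProduct p q = crossProduct p q := by
    have := crossProduct_mulVec_mulVec A p q
    rw [hp, hq, hadj, transpose_transpose] at this
    exact this.symm
  have hM : A * (frame p q)ᵀ = (frame p q)ᵀ := by
    ext i j
    fin_cases j
    exacts [congrFun hp i, congrFun hq i, congrFun hr i]
  calc A = A * (frame p q)ᵀ * (frame p q)ᵀ⁻¹ := (Matrix.mul_nonsing_inv_cancel_right _ _ hMu).symm
    _ = 1 := by rw [hM, Matrix.mul_nonsing_inv _ hMu]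

end rotation

section sphere

open Matrix Complex

/-- The coordinates in which the form `X² + Y² + Z²` becomes `bil`. -/
noncomputable def toQuadric (p : Fin 3 → ℂ) : Fin 3 → ℂ := ![(p 0 - I * p 1) / 2, p 2,
    -(p 0 + I * p 1) / 2]

/-- The inverse of `toQuadric`. -/
noncomputable def ofQuadric (a : Fin 3 → ℂ) : Fin 3 → ℂ := ![a 0 - a 2, I * (a 0 + a 2), a 1]

theorem toQuadric_ofQuadric (a : Fin 3 → ℂ) : toQuadric (ofQuadric a) = a := by
  ext i
  fin_cases i <;> simp [toQuadric, ofQuadric] <;> linear_combination (-(a 0 + a 2) / 2) * I_sq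

theorem ofQuadric_toQuadric (p : Fin 3 → ℂ) : ofQuadric (toQuadric p) = p := by
  ext i
  fin_cases i <;> simp [toQuadric, ofQuadric]
  · ring
  · linear_combination (-p 1) * I_sq

theorem ofQuadric_dotProduct (a b : Fin 3 → ℂ) : ofQuadric a ⬝ᵥ ofQuadric b = bil a b := by
  simp [ofQuadric, bil, dotProduct, Fin.sum_univ_three]
  linear_combination (a 0 + a 2) * (b 0 + b 2) * I_sq

theorem bil_toQuadric (p q : Fin 3 → ℂ) : bil (toQuadric p) (toQuadric q) = p ⬝ᵥ q := by
  rw [← ofQuadric_dotProduct, ofQuadric_toQuadric, ofQuadric_toQuadric]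

/-- The scalar product of two points of the sphere whose difference has square `l`. -/
noncomputable def cosineOf (lam : Finset ℕ → ℝ) (e : Finset ℕ) : ℂ := 1 - (lam e : ℂ) / 2

theorem sum_sub_sq_eq_iff {p q : Fin 3 → ℂ} (hp : ∑ i, p i ^ 2 = 1) (hq : ∑ i, q i ^ 2 = 1)
    (l : ℂ) : ∑ i, (p i - q i) ^ 2 = l ↔ p ⬝ᵥ q = 1 - l / 2 := by
  simp only [dotProduct, Fin.sum_univ_three] at *
  constructor <;> intro h
  · linear_combination (hp + hq - h) / 2
  · linear_combination hp + hq - 2 * h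

theorem dotProduct_self_eq_sum (p : Fin 3 → ℂ) : p ⬝ᵥ p = ∑ i, p i ^ 2 := by
  simp [dotProduct, sq]

theorem GeoGraph.mem_of_edge (G : GeoGraph) {u v : ℕ} (h : ({u, v} : Finset ℕ) ∈ G.E) :
    u ∈ G.V ∧ v ∈ G.V :=
  ⟨G.edge_sub _ h (by simp), G.edge_sub _ h (by simp)⟩

theorem sphereCongruent_equivalence (G : GeoGraph) : Equivalence (SphereCongruent G) where
  refl ρ := ⟨1, by simp, by simp, by simp⟩
  symm := by
    rintro ρ ρ' ⟨A, hA, hd, h⟩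
    refine ⟨Aᵀ, by rw [transpose_transpose]; exact mul_eq_one_comm.1 hA, by rwa [det_transpose],
      fun v hv => ?_⟩
    rw [h v hv, mulVec_mulVec, mul_eq_one_comm.1 hA, one_mulVec]
  trans := by
    rintro ρ ρ' ρ'' ⟨A, hA, hd, h⟩ ⟨B, hB, hd', h'⟩
    refine ⟨B * A, ?_, by rw [det_mul, hd, hd', mul_one], fun v hv => ?_⟩
    · rw [transpose_mul, Matrix.mul_assoc, ← Matrix.mul_assoc A, hA, Matrix.one_mul, hB]
    · rw [h' v hv, h v hv, mulVec_mulVec]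

theorem sphereClasses_mk_eq_iff {G : GeoGraph} {lam : Finset ℕ → ℝ}
    (ρ ρ' : {ρ : ℕ → Fin 3 → ℂ // SphereRealization G ρ ∧ SphereInduces G ρ lam}) :
    (Quot.mk _ ρ : SphereClasses G lam) = Quot.mk _ ρ' ↔ SphereCongruent G ρ.1 ρ'.1 :=
  Equivalence.quot_mk_eq_iff ((sphereCongruent_equivalence G).comap Subtype.val) ρ ρ'

theorem IsSol.sphereRealization {G : GeoGraph} {lam : Finset ℕ → ℝ} {ρ : ℕ → Fin 3 → ℂ}
    (h : IsSol G (cosineOf lam) ρ) : SphereRealization G fun v => ofQuadric (ρ v) := fun v hv => by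
  rw [← dotProduct_self_eq_sum, ofQuadric_dotProduct, h.sph v hv]

theorem IsSol.sphereInduces {G : GeoGraph} {lam : Finset ℕ → ℝ} {ρ : ℕ → Fin 3 → ℂ}
    (h : IsSol G (cosineOf lam) ρ) : SphereInduces G (fun v => ofQuadric (ρ v)) lam :=
  fun u v he => by
    obtain ⟨hu, hv⟩ := G.mem_of_edge he
    rw [sum_sub_sq_eq_iff (h.sphereRealization u hu) (h.sphereRealization v hv),
      ofQuadric_dotProduct, h.edge u v he]
    rfl

/-- The class of the realization given by a normalized solution. -/
noncomputable def solClass (G : GeoGraph) (lam : Finset ℕ → ℝ) (ρ : {ρ // IsSol G (cosineOf lam) ρ})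
    :
    SphereClasses G lam :=
  Quot.mk _ ⟨fun v => ofQuadric (ρ.1 v), ρ.2.sphereRealization, ρ.2.sphereInduces⟩

theorem gram_ofQuadric (k : ℂ) :
    ofQuadric basePoint ⬝ᵥ ofQuadric basePoint *
      ofQuadric (secondPoint k) ⬝ᵥ ofQuadric (secondPoint k) -
      (ofQuadric basePoint ⬝ᵥ ofQuadric (secondPoint k)) ^ 2 = 1 - k ^ 2 := by
  simp only [ofQuadric_dotProduct, bil_basePoint_basePoint, bil_secondPoint_secondPoint,
    bil_basePoint_secondPoint, one_mul]

theorem solClass_injective {G : GeoGraph} {lam : Finset ℕ → ℝ} (he : ({1, 2} : Finset ℕ) ∈ G.E)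
    (hk : 1 - cosineOf lam {1, 2} ^ 2 ≠ 0) : Function.Injective (solClass G lam) := by
  rintro ⟨ρ, h⟩ ⟨σ, h'⟩ hq
  obtain ⟨A, hA, hd, hv⟩ := (sphereClasses_mk_eq_iff _ _).1 hq
  simp only at hv
  obtain ⟨h1, h2⟩ := G.mem_of_edge he
  have hA1 : A = 1 := by
    refine eq_one_of_fixes_two hA hd (p := ofQuadric basePoint)
      (q := ofQuadric (secondPoint (cosineOf lam {1, 2}))) (by rwa [gram_ofQuadric]) ?_ ?_
    · have := hv 1 h1
      rw [h.one, h'.one] at this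
      exact this.symm
    · have := hv 2 h2
      rw [h.two, h'.two] at this
      exact this.symm
  congr 1
  funext w
  by_cases hw : w ∈ G.V
  · have := congrArg toQuadric (hv w hw)
    rw [hA1, one_mulVec, toQuadric_ofQuadric, toQuadric_ofQuadric] at this
    exact this.symm
  · rw [h.off w hw, h'.off w hw]

theorem solClass_surjective {G : GeoGraph} {lam : Finset ℕ → ℝ} (he : ({1, 2} : Finset ℕ) ∈ G.E)
    (hk : 1 - cosineOf lam {1, 2} ^ 2 ≠ 0) : Function.Surjective (solClass G lam) := by
  rintro ⟨ρ, hs, hi⟩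
  obtain ⟨h1, h2⟩ := G.mem_of_edge he
  have hself (v) (hv : v ∈ G.V) : ρ v ⬝ᵥ ρ v = 1 := by rw [dotProduct_self_eq_sum, hs v hv]
  have hdot (u v) (h : ({u, v} : Finset ℕ) ∈ G.E) : ρ u ⬝ᵥ ρ v = cosineOf lam {u, v} :=
    (sum_sub_sq_eq_iff (hs u (G.mem_of_edge h).1) (hs v (G.mem_of_edge h).2) _).1 (hi u v h)
  obtain ⟨A, hA, hd, hA1, hA2⟩ := exists_rotation (p := ρ 1) (q := ρ 2)
    (p' := ofQuadric basePoint) (q' := ofQuadric (secondPoint (cosineOf lam {1, 2})))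
    (by rw [hself 1 h1, ofQuadric_dotProduct, bil_basePoint_basePoint])
    (by rw [hdot 1 2 he, ofQuadric_dotProduct, bil_basePoint_secondPoint])
    (by rw [hself 2 h2, ofQuadric_dotProduct, bil_secondPoint_secondPoint])
    (by rw [hself 1 h1, hself 2 h2, hdot 1 2 he, one_mul]; exact hk)
  set σ : ℕ → Fin 3 → ℂ := fun w => if w ∈ G.V then toQuadric (A *ᵥ ρ w) else 0 with hσ
  have hmem (w) (hw : w ∈ G.V) : σ w = toQuadric (A *ᵥ ρ w) := if_pos hw
  have hsol : IsSol G (cosineOf lam) σ :=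
    { off := fun w hw => if_neg hw
      one := by rw [hmem 1 h1, hA1, toQuadric_ofQuadric]
      two := by rw [hmem 2 h2, hA2, toQuadric_ofQuadric]
      sph := fun w hw => by
        rw [hmem w hw, bil_toQuadric, dotProduct_mulVec_mulVec hA, hself w hw]
      edge := fun u w h => by
        rw [hmem u (G.mem_of_edge h).1, hmem w (G.mem_of_edge h).2, bil_toQuadric,
          dotProduct_mulVec_mulVec hA, hdot u w h] }
  refine ⟨⟨σ, hsol⟩, Eq.symm ((sphereClasses_mk_eq_iff _ _).2 ⟨A, hA, hd, fun v hv => ?_⟩)⟩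
  simp only
  rw [hmem v hv, ofQuadric_toQuadric]

theorem Generic.algebraicIndependent_cosineOf {G : GeoGraph} {lam : Finset ℕ → ℝ}
    (h : Generic G lam) : AlgebraicIndependent ℚ fun e : G.E => cosineOf lam e.1 := by
  have h' : AlgebraicIndependent ℚ fun e : G.E => (lam e.1 : ℂ) :=
    h.2.map' (f := (Complex.ofRealAm.restrictScalars ℚ)) Complex.ofReal_injective
  let φ : MvPolynomial G.E ℚ →ₐ[ℚ] MvPolynomial G.E ℚ :=
    MvPolynomial.aeval fun e => 1 - MvPolynomial.C (1 / 2) * MvPolynomial.X e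
  let ψ : MvPolynomial G.E ℚ →ₐ[ℚ] MvPolynomial G.E ℚ :=
    MvPolynomial.aeval fun e => MvPolynomial.C 2 * (1 - MvPolynomial.X e)
  have hφ : Function.Injective φ := by
    refine Function.LeftInverse.injective (g := ψ) fun p => ?_
    have : ψ.comp φ = AlgHom.id ℚ _ := by
      ext e : 1
      simp only [φ, ψ, AlgHom.comp_apply, MvPolynomial.aeval_X, map_sub, map_one, map_mul,
        MvPolynomial.algHom_C, AlgHom.id_apply, MvPolynomial.algebraMap_eq]
      rw [← mul_assoc, ← map_mul]
      norm_num
    exact DFunLike.congr_fun this p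
  have : (MvPolynomial.aeval fun e : G.E => cosineOf lam e.1) =
      (MvPolynomial.aeval fun e : G.E => (lam e.1 : ℂ)).comp φ := by
    ext e
    simp [φ, cosineOf]; ring
  rw [AlgebraicIndependent, this, AlgHom.coe_comp]
  exact Function.Injective.comp h' hφ

theorem one_sub_sq_ne_zero_of_transcendental {k : ℂ} (h : Transcendental ℚ k) :
    1 - k ^ 2 ≠ 0 := fun h0 => h
  (.of_pow two_pos (by rw [← sub_eq_zero.1 h0]; exact isAlgebraic_one))

theorem Generic.finite_and_card {G : GeoGraph} {lam : Finset ℕ → ℝ} (h : Generic G lam)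
    (he : ({1, 2} : Finset ℕ) ∈ G.E) (hfin : {ρ | IsSol G (cosineOf lam) ρ}.Finite) :
    Finite (SphereClasses G lam) ∧
      Nat.card (SphereClasses G lam) = {ρ | IsSol G (cosineOf lam) ρ}.ncard := by
  have hk := one_sub_sq_ne_zero_of_transcendental
    (h.algebraicIndependent_cosineOf.transcendental ⟨_, he⟩)
  let f := Equiv.ofBijective (solClass G lam) ⟨solClass_injective he hk, solClass_surjective he hk⟩
  have : Finite {ρ // IsSol G (cosineOf lam) ρ} := hfin
  exact ⟨Finite.of_equiv _ f, (Nat.card_congr f).symm⟩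

end sphere

/-- **Main theorem.** There is an assignment of a triple (the `S²`-class) to every
calligraph, with value `(1,1,0)` on `L`, `(1,0,1)` on `R`, `(6,4,4)` on `C`, such
that for every minimally rigid graph with a calligraphic split, the number of
congruence classes of spherical realizations with generic edge lengths is the
quadratic-form product of the classes of the two parts. -/
theorem sphere_count_by_calligraphic_split_644 :
    ∃ cl : {H : GeoGraph // Calligraph H} → ℤ × ℤ × ℤ,
      (∀ H : {H : GeoGraph // Calligraph H},
        H.1.V = ({0, 1, 2} : Finset ℕ) →
        H.1.E = ({{1, 2}, {0, 1}} : Finset (Finset ℕ)) → cl H = (1, 1, 0)) ∧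
      (∀ H : {H : GeoGraph // Calligraph H},
        H.1.V = ({0, 1, 2} : Finset ℕ) →
        H.1.E = ({{1, 2}, {0, 2}} : Finset (Finset ℕ)) → cl H = (1, 0, 1)) ∧
      (∀ H : {H : GeoGraph // Calligraph H},
        H.1.V = ({0, 1, 2, 3} : Finset ℕ) →
        H.1.E = ({{1, 2}, {0, 3}, {1, 3}, {2, 3}} : Finset (Finset ℕ)) → cl H = (6, 4, 4)) ∧
      (∀ (G : GeoGraph) (G₁ G₂ : {H : GeoGraph // Calligraph H}) (lam : Finset ℕ → ℝ),
        Laman G → IsSplit G G₁.1 G₂.1 → Generic G lam →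
        Finite (SphereClasses G lam) ∧
        (Nat.card (SphereClasses G lam) : ℤ) =
          2 * ((cl G₁).1 * (cl G₂).1 - (cl G₁).2.1 * (cl G₂).2.1
                - (cl G₁).2.2 * (cl G₂).2.2)) := by
  choose c hc using fun H : {H : GeoGraph // Calligraph H} => H.2.pre.exists_hasGenericCounts
  refine ⟨fun H => (3 * (c H).1 - 2 * (c H).2.1 - 2 * (c H).2.2,
    2 * (c H).1 - (c H).2.1 - 2 * (c H).2.2, 2 * (c H).1 - 2 * (c H).2.1 - (c H).2.2),
    fun H hV hE => ?_, fun H hV hE => ?_, fun H hV hE => ?_, fun G G₁ G₂ lam hG hs hgen => ?_⟩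
  · simp [H.2.pre.eq_left (hc H) hV hE]
  · simp [H.2.pre.eq_right (hc H) hV hE]
  · simp [H.2.pre.eq_tripod (hc H) hV hE]
  · have he : ({1, 2} : Finset ℕ) ∈ G.E := by
      rw [hs.2.1]
      exact Finset.mem_union_left _ G₁.2.2.1
    obtain ⟨hfin, hcard⟩ := ncard_isSol_of_hasGenericCounts (hc G₁) (hc G₂)
      hgen.algebraicIndependent_cosineOf G₁.2.pre G₂.2.pre hs hG.2.1
    obtain ⟨hfin', hcard'⟩ := hgen.finite_and_card he hfin
    refine ⟨hfin', ?_⟩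
    rw [hcard', hcard]
    ring
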